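/- Marchenko–Pastur sum rule: Let 0 < τ ≤ 1 and set τ⁻ = (1−√τ)², τ⁺ = (1+√τ)². Let μ be a nontrivial probability measure with compact support contained in [0,∞), with canonical coefficients (z_k)_{k≥1}. Define G(x) = x − 1 − log x, I_L(μ) = ∑_{k=1}^∞ [τ⁻¹·G(z_{2k−1}) + G(τ⁻¹·z_{2k})], and for x > 0 with x ∉ (τ⁻,τ⁺), F_MP(x) = ∫_{I(x)} √((t−τ⁺)(t−τ⁻))/(τ t) dt where I(x) = [τ⁺, x] if x ≥ τ⁺ and I(x) = [x, τ⁻] if 0 < x ≤ τ⁻. If μ ∉ 𝒮₁(τ⁻,τ⁺) then I_L(μ) = +∞, and if μ ∈ 𝒮₁(τ⁻,τ⁺) then K(MP(τ) | μ) + ∑_{λ ∈ E(μ)} F_MP(λ) = I_L(μ), where both sides may be infinite simultaneously. -/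

import Mathlib

open MeasureTheory Real Filter Set Topology Polynomial
open scoped ENNReal ComplexConjugate

noncomputable section

namespace SumRules

-- Kullback–Leibler divergence `K(ν | μ)`.
open Classical in
def KLdiv {α : Type*} [MeasurableSpace α] (ν μ : Measure α) : ℝ≥0∞ :=
  if ν ≪ μ ∧ Integrable (llr ν μ) ν then ENNReal.ofReal (∫ x, llr ν μ x ∂ν) else ⊤

/-- The (topological) support of a measure. -/
def suppSet {α : Type*} [TopologicalSpace α] [MeasurableSpace α] (μ : Measure α) : Set α :=
  {x | ∀ U ∈ nhds x, μ U ≠ 0}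

/-- A measure is nontrivial if its support is infinite, i.e. it is not carried
by any finite set. -/
def InfiniteSupport {α : Type*} [MeasurableSpace α] (μ : Measure α) : Prop :=
  ∀ s : Finset α, μ (↑s : Set α)ᶜ ≠ 0

/-- The set of support points outside `[cm, cp]`. -/
def ES (μ : Measure ℝ) (cm cp : ℝ) : Set ℝ := suppSet μ \ Icc cm cp

/-- `μ ∈ 𝒮₁(cm, cp)`: the support of `μ` is contained in `[cm, cp]` together with an
at most countable set of points outside this interval. -/
def InS1 (μ : Measure ℝ) (cm cp : ℝ) : Prop := (ES μ cm cp).Countable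

/-- `a b` (indexed so that `a (k+1) = a_{k+1}`, `b (k+1) = b_{k+1}`, `k ≥ 0`) are the Jacobi
coefficients of `μ`: there is a sequence of orthonormal polynomials (with positive leading
coefficients, obtained by Gram-Schmidt from `1, x, x², …`) satisfying the three-term recursion. -/
def IsJacobi (μ : Measure ℝ) (a b : ℕ → ℝ) : Prop :=
  (∀ k : ℕ, 0 < a (k+1)) ∧
  ∃ p : ℕ → Polynomial ℝ,
    (∀ k, (p k).natDegree = k) ∧ (∀ k, 0 < (p k).leadingCoeff) ∧
    (∀ j k, ∫ x, (p j).eval x * (p k).eval x ∂μ = if j = k then 1 else 0) ∧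
    (∀ (k : ℕ) (x : ℝ), x * (p k).eval x =
      a (k+1) * (p (k+1)).eval x + b (k+1) * (p k).eval x +
        (if k = 0 then 0 else a k * (p (k-1)).eval x))

/-- `u` is the sequence of canonical moments of a measure on `[-2,2]` (with `u 0 = -1`). -/
def IsCanonicalMoments (μ : Measure ℝ) (u : ℕ → ℝ) : Prop :=
  u 0 = -1 ∧ (∀ k : ℕ, u (k+1) ∈ Ioo (-1 : ℝ) 1) ∧
  ∃ a b : ℕ → ℝ, IsJacobi μ a b ∧
    (∀ k : ℕ, b (k+1) = (1 - u (2*k)) * u (2*k+1) - (1 + u (2*k)) * u (2*k-1)) ∧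
    (∀ k : ℕ, (a (k+1))^2 = (1 - u (2*k)) * (1 - (u (2*k+1))^2) * (1 + u (2*k+2)))

/-- `z` is the sequence of canonical coefficients of a measure supported in `[0,∞)`. -/
def IsCanonicalZ (μ : Measure ℝ) (z : ℕ → ℝ) : Prop :=
  z 0 = 0 ∧ (∀ k : ℕ, 0 ≤ z (k+1)) ∧
  ∃ a b : ℕ → ℝ, IsJacobi μ a b ∧
    (∀ k : ℕ, b (k+1) = z (2*k) + z (2*k+1)) ∧
    (∀ k : ℕ, (a (k+1))^2 = z (2*k+1) * z (2*k+2))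

def Gfun (x : ℝ) : ℝ := x - 1 - Real.log x

/-- The semicircle law. -/
def SCm : Measure ℝ :=
  volume.withDensity fun x => ENNReal.ofReal (Real.sqrt (4 - x^2) / (2*π))

/-- The arcsine law on `(-2,2)`. -/
def ArcsineM : Measure ℝ :=
  volume.withDensity fun x => ENNReal.ofReal (1 / (π * Real.sqrt (4 - x^2)))

/-- The measure with density `(2/(π|q-p|)) √((x-p)/(q-x))` between `p` and `q`. -/
def Dmeas (p q : ℝ) : Measure ℝ :=
  volume.withDensity fun x => ENNReal.ofReal (2/(π * |q - p|) * Real.sqrt ((x - p)/(q - x)))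

/-- The point `e^{iθ}` on the unit circle. -/
def ctheta (θ : ℝ) : ℂ := Complex.exp (θ * Complex.I)

/-- Reversed polynomial `Φ*` with conjugated coefficients: `Φ*(z) = z^k conj(Φ(1/conj z))`. -/
def polyStar (P : Polynomial ℂ) : Polynomial ℂ := (P.map (starRingEnd ℂ)).reverse

/-- `α` is the sequence of Verblunsky coefficients of the measure `ν` on the unit circle
(`ν` being given in angle coordinates, carried by `[0, 2π)`): the monic orthogonal
polynomials of `ν` satisfy the Szegő recursion with coefficients `α`. -/
def IsVerblunsky (ν : Measure ℝ) (α : ℕ → ℂ) : Prop :=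
  (∀ k, ‖α k‖ < 1) ∧
  ∃ Φ : ℕ → Polynomial ℂ,
    (∀ k, (Φ k).Monic) ∧ (∀ k, (Φ k).natDegree = k) ∧
    (∀ j k, j ≠ k →
      ∫ θ, conj ((Φ j).eval (ctheta θ)) * (Φ k).eval (ctheta θ) ∂ν = 0) ∧
    (∀ k, Φ (k+1) = Polynomial.X * Φ k - Polynomial.C (conj (α k)) * polyStar (Φ k))

/-- `γ` is the sequence of deformed Verblunsky coefficients of `ν`. -/
def IsDeformedVerblunsky (ν : Measure ℝ) (γ : ℕ → ℂ) : Prop :=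
  ∃ α : ℕ → ℂ, IsVerblunsky ν α ∧
    ∀ k : ℕ, γ k = conj (α k) * ∏ j ∈ Finset.range k, (1 - conj (γ j)) / (1 - γ j)

/-- Symmetry of a measure on the circle (in angle coordinates): invariance under conjugation. -/
def SymmCircle (ν : Measure ℝ) : Prop :=
  (ν.map ctheta).map (starRingEnd ℂ) = ν.map ctheta

/-- The uniform measure on the circle, in angle coordinates. -/
def UNIFm : Measure ℝ :=
  volume.withDensity fun θ => ENNReal.ofReal (if 0 ≤ θ ∧ θ < 2*π then 1/(2*π) else 0)

end SumRules

namespace SumRules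

/-- Outlier contribution for the Killip–Simon sum rule (`+∞` inside `(-2,2)`). -/
def FSC (x : ℝ) : ℝ≥0∞ :=
  if 2 ≤ |x| then
    ENNReal.ofReal (|x|/2 * Real.sqrt (x^2 - 4) - 2 * Real.log ((|x| + Real.sqrt (x^2 - 4))/2))
  else ⊤

/-- Coefficient side of the Killip–Simon sum rule. -/
def IH (a b : ℕ → ℝ) : ℝ≥0∞ :=
  (1/2 : ℝ≥0∞) * ∑' k : ℕ, ENNReal.ofReal ((b (k+1))^2)
    + ∑' k : ℕ, ENNReal.ofReal (Gfun ((a (k+1))^2))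

def tauM (τ : ℝ) : ℝ := (1 - Real.sqrt τ)^2
def tauP (τ : ℝ) : ℝ := (1 + Real.sqrt τ)^2

/-- The Marchenko–Pastur law with parameter `τ`. -/
def MPm (τ : ℝ) : Measure ℝ :=
  volume.withDensity fun x =>
    ENNReal.ofReal (Real.sqrt ((x - tauM τ) * (tauP τ - x)) / (2*π*τ*x))

/-- Outlier contribution for the Marchenko–Pastur sum rule. -/
def FMP (τ : ℝ) (x : ℝ) : ℝ≥0∞ :=
  if tauP τ ≤ x then
    ENNReal.ofReal (∫ t in (tauP τ)..x, Real.sqrt ((t - tauP τ) * (t - tauM τ)) / (τ*t))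
  else if 0 < x ∧ x ≤ tauM τ then
    ENNReal.ofReal (∫ t in x..(tauM τ), Real.sqrt ((t - tauP τ) * (t - tauM τ)) / (τ*t))
  else ⊤

/-- Coefficient side of the Marchenko–Pastur sum rule. -/
def IL (τ : ℝ) (z : ℕ → ℝ) : ℝ≥0∞ :=
  ∑' k : ℕ, ENNReal.ofReal (τ⁻¹ * Gfun (z (2*k+1)) + Gfun (τ⁻¹ * z (2*k+2)))

def uPl (κ₁ κ₂ : ℝ) : ℝ :=
  2*(κ₂^2 - κ₁^2 + 4*Real.sqrt ((1+κ₁)*(1+κ₂)*(1+κ₁+κ₂)))/(2+κ₁+κ₂)^2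
def uMi (κ₁ κ₂ : ℝ) : ℝ :=
  2*(κ₂^2 - κ₁^2 - 4*Real.sqrt ((1+κ₁)*(1+κ₂)*(1+κ₁+κ₂)))/(2+κ₁+κ₂)^2

/-- The Kesten–McKay law with parameters `κ₁, κ₂`. -/
def KMKm (κ₁ κ₂ : ℝ) : Measure ℝ :=
  volume.withDensity fun x =>
    ENNReal.ofReal ((2+κ₁+κ₂)/(2*π) * Real.sqrt ((x - uMi κ₁ κ₂) * (uPl κ₁ κ₂ - x)) / (4 - x^2))

def ue (κ₁ κ₂ : ℝ) : ℝ := -(κ₁+κ₂)/(2+κ₁+κ₂)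
def uo (κ₁ κ₂ : ℝ) : ℝ := (κ₂-κ₁)/(2+κ₁+κ₂)

def He (κ₁ κ₂ u : ℝ) : ℝ :=
  -(1+κ₁+κ₂) * Real.log ((1-u)/(1 - ue κ₁ κ₂)) - Real.log ((1+u)/(1 + ue κ₁ κ₂))
def Ho (κ₁ κ₂ u : ℝ) : ℝ :=
  -(1+κ₁) * Real.log ((1-u)/(1 - uo κ₁ κ₂)) - (1+κ₂) * Real.log ((1+u)/(1 + uo κ₁ κ₂))

/-- Coefficient side of the Kesten–McKay sum rule. -/
def IJ (κ₁ κ₂ : ℝ) (u : ℕ → ℝ) : ℝ≥0∞ :=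
  ∑' k : ℕ, (ENNReal.ofReal (Ho κ₁ κ₂ (u (2*k+1))) + ENNReal.ofReal (He κ₁ κ₂ (u (2*k+2))))

/-- Outlier contribution for the Kesten–McKay sum rule. -/
def FKMK (κ₁ κ₂ : ℝ) (x : ℝ) : ℝ≥0∞ :=
  if uPl κ₁ κ₂ ≤ x then
    ENNReal.ofReal (∫ t in (uPl κ₁ κ₂)..x,
      (2+κ₁+κ₂) * Real.sqrt ((t - uPl κ₁ κ₂) * (t - uMi κ₁ κ₂)) / (4 - t^2))
  else if x ≤ uMi κ₁ κ₂ then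
    ENNReal.ofReal (∫ t in x..(uMi κ₁ κ₂),
      (2+κ₁+κ₂) * Real.sqrt ((t - uPl κ₁ κ₂) * (t - uMi κ₁ κ₂)) / (4 - t^2))
  else ⊤

def Hgw (g : ℝ) : ℝ := 1 - Real.sqrt (1 - g^2) + Real.log ((1 + Real.sqrt (1 - g^2))/2)

def thetaG (g : ℝ) : ℝ := 2 * Real.arcsin (Real.sqrt (1/|g|))

/-- The Gross–Witten measures, in angle coordinates. -/
def GWm (g : ℝ) : Measure ℝ :=
  if |g| ≤ 1 then
    volume.withDensity fun θ =>
      ENNReal.ofReal (if 0 ≤ θ ∧ θ < 2*π then (1 + g * Real.cos θ)/(2*π) else 0)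
  else if g < -1 then
    volume.withDensity fun θ => ENNReal.ofReal (
      if π - thetaG g ≤ θ ∧ θ ≤ π + thetaG g then
        |g| / π * Real.sin (θ/2) * Real.sqrt (Real.sin (θ/2)^2 - Real.cos (thetaG g/2)^2)
      else 0)
  else
    volume.withDensity fun θ => ENNReal.ofReal (
      if -thetaG g ≤ θ ∧ θ ≤ thetaG g then
        g/π * Real.cos (θ/2) * Real.sqrt (Real.sin (thetaG g/2)^2 - Real.sin (θ/2)^2)
      else 0)

def thetaD (d : ℝ) : ℝ := 2 * Real.arcsin (d/(1+d))
def gammaD (d : ℝ) : ℝ := -d/(1+d)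

/-- The Hua–Pickrell measure, in angle coordinates. -/
def HPm (d : ℝ) : Measure ℝ :=
  volume.withDensity fun θ => ENNReal.ofReal (
    if thetaD d < θ ∧ θ < 2*π - thetaD d then
      (1+d) * Real.sqrt (Real.sin (θ/2)^2 - Real.sin (thetaD d/2)^2) / (2*π*Real.sin (θ/2))
    else 0)

/-- The entropy-like function appearing in the Hua–Pickrell sum rule. -/
def HHP (d : ℝ) (γ : ℂ) : ℝ :=
  -Real.log ((1 - ‖γ‖^2)/(1 - (gammaD d)^2)) - 2*d*Real.log (‖1 - γ‖/(1 - gammaD d))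

/-- Outlier contribution for the Hua–Pickrell sum rule (in angle coordinates). -/
def FHP (d : ℝ) (θ : ℝ) : ℝ≥0∞ :=
  if θ ≤ thetaD d then
    ENNReal.ofReal (∫ φ in θ..(thetaD d),
      (1+d) * Real.sqrt (Real.sin (thetaD d/2)^2 - Real.sin (φ/2)^2) / Real.sin (φ/2))
  else if 2*π - thetaD d ≤ θ then
    ENNReal.ofReal (∫ φ in (2*π - thetaD d)..θ,
      (1+d) * Real.sqrt (Real.sin (thetaD d/2)^2 - Real.sin (φ/2)^2) / Real.sin (φ/2))
  else ⊤

/-- Set of outlying support points for a measure on the circle, in angle coordinates. -/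
def EST (ν : Measure ℝ) (tm tp : ℝ) : Set ℝ := suppSet ν \ Icc tm tp

/-- `ν ∈ 𝒮₁^𝕋(tm, tp)` (in angle coordinates). -/
def InS1T (ν : Measure ℝ) (tm tp : ℝ) : Prop := (EST ν tm tp).Countable

/-- The measure `𝒟(2,-2)`, with density `(1/2π)√((2-x)/(2+x))` on `(-2,2)`
(a shift of the hard-edge Marchenko–Pastur law). -/
def Dhard : Measure ℝ :=
  volume.withDensity fun x => ENNReal.ofReal (Real.sqrt ((2 - x)/(2 + x)) / (2*π))

/-- The mixture `μ_g = |g| 𝒟(2,-2) + (1-|g|) Arcsine`. -/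
def mugMix (g : ℝ) : Measure ℝ :=
  ENNReal.ofReal |g| • Dhard + ENNReal.ofReal (1 - |g|) • ArcsineM

/-- The mixture `ρ_g = |g| SC + (1-|g|) Arcsine`. -/
def rhog (g : ℝ) : Measure ℝ :=
  ENNReal.ofReal |g| • SCm + ENNReal.ofReal (1 - |g|) • ArcsineM

def Cg (g : ℝ) : ℝ :=
  -|g| * (1 - Real.log 2) + 1 - Real.sqrt (1 - g^2) + Real.log ((1 + Real.sqrt (1 - g^2))/2)

/-- The measure with density `(1/2π)(2+x)^{3/2}(2-x)^{1/2}` on `[-2,2]`. -/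
def muHat : Measure ℝ :=
  volume.withDensity fun x =>
    ENNReal.ofReal ((2 + x) * Real.sqrt (2 + x) * Real.sqrt (2 - x) / (2*π))

/-- The Poisson kernel measure `Pois(ζ)`, in angle coordinates. -/
def PoisM (ζ : ℂ) : Measure ℝ :=
  volume.withDensity fun θ => ENNReal.ofReal (
    if 0 ≤ θ ∧ θ < 2*π then (1 - ‖ζ‖^2)/(2*π*‖ctheta θ - ζ‖^2) else 0)

/-- The Carathéodory function of a measure on the circle (angle coordinates). -/
def Cara (ν : Measure ℝ) (z : ℂ) : ℂ := ∫ θ, (ctheta θ + z)/(ctheta θ - z) ∂ν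

/-- `f` is the Schur function of `ν`. -/
def IsSchurFn (ν : Measure ℝ) (f : ℂ → ℂ) : Prop :=
  DifferentiableOn ℂ f (Metric.ball 0 1) ∧
  (∀ z ∈ Metric.ball (0:ℂ) 1, ‖f z‖ ≤ 1) ∧
  (∀ z ∈ Metric.ball (0:ℂ) 1, Cara ν z - 1 = z * f z * (Cara ν z + 1))

/-- Möbius transform of the unit disk. -/
def mtrans (ρ z : ℂ) : ℂ := (z - ρ)/(1 - conj ρ * z)

def npRaw (ρ : ℂ) (g : ℂ → ℂ) (z : ℂ) : ℂ :=
  ((-ρ/(‖ρ‖ : ℂ)) / mtrans ρ z) * ((g z - g ρ)/(1 - conj (g ρ) * g z))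

-- One step of the Nevanlinna–Pick algorithm at `ρ` (the removable singularity at `ρ`
-- is filled in by the limit).
open Classical in
def npStep (ρ : ℂ) (g : ℂ → ℂ) : ℂ → ℂ := fun z =>
  if z = ρ then limUnder (𝓝[≠] ρ) (npRaw ρ g) else npRaw ρ g z

def schurRaw (g : ℂ → ℂ) (z : ℂ) : ℂ := ((g z - g 0)/z)/(1 - conj (g 0) * g z)

-- One step of the classical Schur algorithm (the removable singularity at `0`
-- is filled in by the limit).
open Classical in
def schurStep (g : ℂ → ℂ) : ℂ → ℂ := fun z =>
  if z = 0 then limUnder (𝓝[≠] (0:ℂ)) (schurRaw g) else schurRaw g z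

def xdHP (d : ℝ) : ℝ := 2*(1 + 2*d - d^2)/(1+d)^2

def uKMK (d : ℝ) : ℝ := 2*Real.sqrt (1 + 2*d)/(1+d)

end SumRules

namespace SumRules

/-! ### Orthogonal polynomials from canonical coefficients -/

def PQ (z : ℕ → ℝ) : ℕ → ℝ[X] × ℝ[X]
  | 0 => (1, 1)
  | k+1 => (X * (PQ z k).2 - C (z (2*k+1)) * (PQ z k).1,
      X * (PQ z k).2 - C (z (2*k+1)) * (PQ z k).1 - C (z (2*k+2)) * (PQ z k).2)

def PP (z : ℕ → ℝ) (k : ℕ) : ℝ[X] := (PQ z k).1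
def QQ (z : ℕ → ℝ) (k : ℕ) : ℝ[X] := (PQ z k).2

lemma PP_zero (z : ℕ → ℝ) : PP z 0 = 1 := rfl
lemma QQ_zero (z : ℕ → ℝ) : QQ z 0 = 1 := rfl
lemma PP_succ (z : ℕ → ℝ) (k : ℕ) : PP z (k+1) = X * QQ z k - C (z (2*k+1)) * PP z k := rfl
lemma QQ_succ (z : ℕ → ℝ) (k : ℕ) : QQ z (k+1) = PP z (k+1) - C (z (2*k+2)) * QQ z k := rfl

lemma PQ_deg (z : ℕ → ℝ) (k : ℕ) : ((PP z k).Monic ∧ (PP z k).natDegree = k) ∧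
    ((QQ z k).Monic ∧ (QQ z k).natDegree = k) := by
  induction k with
  | zero => simp [PP_zero, QQ_zero]
  | succ k ih =>
    obtain ⟨⟨hP, hPd⟩, hQ, hQd⟩ := ih
    have hXm : (X * QQ z k).Monic := monic_X.mul hQ
    have hXd : (X * QQ z k).natDegree = k + 1 := by
      rw [natDegree_X_mul hQ.ne_zero, hQd]
    have h1 : (C (z (2*k+1)) * PP z k).degree < (X * QQ z k).degree := by
      rw [degree_eq_natDegree hXm.ne_zero, hXd]
      refine lt_of_le_of_lt degree_le_natDegree (Nat.cast_lt.2 (lt_of_le_of_lt (natDegree_C_mul_le _ _) (by omega)))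
    have hPm : (PP z (k+1)).Monic := by rw [PP_succ]; exact hXm.sub_of_left h1
    have hPd' : (PP z (k+1)).natDegree = k + 1 := by
      rw [PP_succ, natDegree_sub_eq_left_of_natDegree_lt, hXd]
      rw [hXd]
      exact lt_of_le_of_lt (natDegree_C_mul_le _ _) (by omega)
    have h2 : (C (z (2*k+2)) * QQ z k).degree < (PP z (k+1)).degree := by
      rw [degree_eq_natDegree hPm.ne_zero, hPd']
      refine lt_of_le_of_lt degree_le_natDegree (Nat.cast_lt.2 (lt_of_le_of_lt (natDegree_C_mul_le _ _) (by omega)))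
    refine ⟨⟨hPm, hPd'⟩, ?_, ?_⟩
    · rw [QQ_succ]; exact hPm.sub_of_left h2
    · rw [QQ_succ, natDegree_sub_eq_left_of_natDegree_lt, hPd']
      rw [hPd']
      exact lt_of_le_of_lt (natDegree_C_mul_le _ _) (by omega)

lemma PP_monic (z : ℕ → ℝ) (k : ℕ) : (PP z k).Monic := (PQ_deg z k).1.1
lemma PP_deg (z : ℕ → ℝ) (k : ℕ) : (PP z k).natDegree = k := (PQ_deg z k).1.2
lemma QQ_monic (z : ℕ → ℝ) (k : ℕ) : (QQ z k).Monic := (PQ_deg z k).2.1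
lemma QQ_deg (z : ℕ → ℝ) (k : ℕ) : (QQ z k).natDegree = k := (PQ_deg z k).2.2

lemma monic_sub_deg {p q : ℝ[X]} {k : ℕ} (hp : p.Monic) (hq : q.Monic) (hpd : p.natDegree = k + 1)
    (hqd : q.natDegree = k + 1) : (p - q).natDegree < k + 1 := by
  have h := degree_sub_lt_left (p := p) (q := q)
    (by rw [degree_eq_natDegree hp.ne_zero, degree_eq_natDegree hq.ne_zero, hpd, hqd])
    hp.ne_zero (by rw [hp.leadingCoeff, hq.leadingCoeff])
  by_cases h0 : p - q = 0
  · rw [h0]; simp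
  · rw [degree_eq_natDegree hp.ne_zero, degree_eq_natDegree h0, hpd] at h
    exact_mod_cast h

lemma PP_eval_zero (z : ℕ → ℝ) (k : ℕ) :
    (PP z k).eval 0 = (-1)^k * ∏ j ∈ Finset.range k, z (2*j+1) := by
  induction k with
  | zero => simp [PP_zero]
  | succ k ih => rw [PP_succ, Finset.prod_range_succ]; simp [ih]; ring

lemma PQ_next (z : ℕ → ℝ) (k : ℕ) :
    (PP z (k+1)).coeff k = - (∑ j ∈ Finset.range k, (z (2*j+1) + z (2*j+2))) - z (2*k+1) ∧
    (QQ z (k+1)).coeff k = - ∑ j ∈ Finset.range (k+1), (z (2*j+1) + z (2*j+2)) := by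
  have hc : ∀ k, (PP z k).coeff k = 1 := fun k => by
    have := PP_monic z k; rwa [Monic, leadingCoeff, PP_deg] at this
  have hc' : ∀ k, (QQ z k).coeff k = 1 := fun k => by
    have := QQ_monic z k; rwa [Monic, leadingCoeff, QQ_deg] at this
  have key : ∀ k, (PP z (k+1)).coeff k =
      - (∑ j ∈ Finset.range k, (z (2*j+1) + z (2*j+2))) - z (2*k+1) →
      (QQ z (k+1)).coeff k = - ∑ j ∈ Finset.range (k+1), (z (2*j+1) + z (2*j+2)) := by
    intro k h
    rw [QQ_succ, coeff_sub, coeff_C_mul, hc', h, Finset.sum_range_succ]; ring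
  induction k with
  | zero =>
    have : (PP z (0+1)).coeff 0 =
      - (∑ j ∈ Finset.range 0, (z (2*j+1) + z (2*j+2))) - z (2*0+1) := by
      rw [PP_succ, coeff_sub, coeff_C_mul, hc]; simp
    exact ⟨this, key 0 this⟩
  | succ k ih =>
    have : (PP z (k+1+1)).coeff (k+1) =
      - (∑ j ∈ Finset.range (k+1), (z (2*j+1) + z (2*j+2))) - z (2*(k+1)+1) := by
      rw [PP_succ, coeff_sub, coeff_C_mul, hc, coeff_X_mul, ih.2]; ring
    exact ⟨this, key _ this⟩

/-- orthogonality up to order `n` -/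
def OrthTo (L : ℝ[X] →ₗ[ℝ] ℝ) (z : ℕ → ℝ) (n : ℕ) : Prop :=
  ∀ k ≤ n, ∀ f : ℝ[X], f.natDegree < k → L (PP z k * f) = 0

lemma L_C_mul (L : ℝ[X] →ₗ[ℝ] ℝ) (c : ℝ) (p : ℝ[X]) : L (C c * p) = c * L p := by
  rw [← smul_eq_C_mul, map_smul, smul_eq_mul]

lemma OrthTo.PQ_eq {L : ℝ[X] →ₗ[ℝ] ℝ} {z : ℕ → ℝ} {n : ℕ} (h : OrthTo L z n) {k : ℕ} (hk : k ≤ n)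
    {f : ℝ[X]} (hf : f.Monic) (hfd : f.natDegree = k) :
    L (PP z k * f) = L (PP z k * PP z k) := by
  rcases k with _ | k
  · have : f = 1 := hf.natDegree_eq_zero.1 hfd
    rw [this, PP_zero]
  · have := h (k+1) hk (f - PP z (k+1)) (monic_sub_deg hf (PP_monic z _) hfd (PP_deg z _))
    rw [mul_sub, map_sub] at this
    linarith

lemma OrthTo.XQQ {L : ℝ[X] →ₗ[ℝ] ℝ} {z : ℕ → ℝ} {n : ℕ} (h : OrthTo L z n) {k : ℕ} (hk : k + 1 ≤ n) :
    L (X * QQ z k * QQ z k) = z (2*k+1) * L (PP z k * PP z k) := by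
  have e : X * QQ z k * QQ z k = PP z (k+1) * QQ z k + C (z (2*k+1)) * (PP z k * QQ z k) := by
    rw [PP_succ]; ring
  rw [e, map_add, L_C_mul, h (k+1) hk _ (by rw [QQ_deg]; omega),
    h.PQ_eq (by omega) (QQ_monic z k) (QQ_deg z k)]; ring

lemma OrthTo.PP_sq {L : ℝ[X] →ₗ[ℝ] ℝ} {z : ℕ → ℝ} {n : ℕ} (h : OrthTo L z n) {k : ℕ} (hk : k + 2 ≤ n) :
    L (PP z (k+1) * PP z (k+1)) = z (2*k+2) * L (X * QQ z k * QQ z k) := by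
  have e1 : PP z (k+1) * (X * QQ z k) - C (z (2*k+2)) * (X * QQ z k * QQ z k)
      = PP z (k+2) * QQ z k + C (z (2*(k+1)+1)) * (PP z (k+1) * QQ z k) := by
    rw [PP_succ z (k+1), QQ_succ]; ring
  have := congrArg L e1
  rw [map_sub, map_add, L_C_mul, L_C_mul, h (k+2) hk _ (by rw [QQ_deg]; omega),
    h (k+1) (by omega) (QQ z k) (by rw [QQ_deg]; omega),
    h.PQ_eq (by omega) (monic_X.mul (QQ_monic z k))
      (by rw [natDegree_X_mul (QQ_monic z k).ne_zero, QQ_deg])] at this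
  linarith

lemma OrthTo.norm {L : ℝ[X] →ₗ[ℝ] ℝ} {z : ℕ → ℝ} {n : ℕ} (h : OrthTo L z n) (h1 : L 1 = 1)
    {k : ℕ} (hk : k + 1 ≤ n) :
    L (PP z k * PP z k) = ∏ j ∈ Finset.range k, (z (2*j+1) * z (2*j+2)) := by
  induction k with
  | zero => simp [PP_zero, h1]
  | succ k ih =>
    rw [h.PP_sq (by omega), h.XQQ (by omega), ih (by omega), Finset.prod_range_succ]; ring

/-- Atomic functional. -/
def Lat {n : ℕ} (x w : Fin n → ℝ) : ℝ[X] →ₗ[ℝ] ℝ where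
  toFun p := ∑ i, w i * p.eval (x i)
  map_add' p q := by simp [mul_add, Finset.sum_add_distrib]
  map_smul' c p := by simp [Finset.mul_sum]; refine Finset.sum_congr rfl fun i _ => by ring

lemma Lat_apply {n : ℕ} (x w : Fin n → ℝ) (p : ℝ[X]) : Lat x w p = ∑ i, w i * p.eval (x i) := rfl

structure FinSpec (n : ℕ) (x w : Fin n → ℝ) (z : ℕ → ℝ) : Prop where
  inj : Function.Injective x
  xpos : ∀ i, 0 < x i
  wpos : ∀ i, 0 < w i
  wsum : ∑ i, w i = 1
  zpos : ∀ j, 1 ≤ j → j < 2 * n → 0 < z j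
  zlast : z (2 * n) = 0
  orth : OrthTo (Lat x w) z n
  root : PP z n = ∏ i, (X - C (x i))

/-- Logarithmic energy -/
def En {n : ℕ} (x : Fin n → ℝ) : ℝ := ∑ i, ∑ j, Real.log |x i - x j|

lemma En_vdm {n : ℕ} (x : Fin n → ℝ) (hx : Function.Injective x) :
    Real.log ((Matrix.vandermonde x).det ^ 2) = En x := by
  have h0 : ∀ i j, i ≠ j → x i - x j ≠ 0 := fun i j h => sub_ne_zero.2 fun e => h (hx e)
  rw [Matrix.det_vandermonde, ← Real.log_abs, abs_pow, Real.log_pow, Finset.abs_prod]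
  rw [Real.log_prod]
  · have h1 : ∀ i, Real.log |∏ j ∈ Finset.Ioi i, (x j - x i)| =
        ∑ j ∈ Finset.Ioi i, Real.log |x j - x i| := by
      intro i
      rw [Finset.abs_prod, Real.log_prod]
      intro j hj
      have : i < j := by simpa using hj
      exact abs_ne_zero.2 (h0 _ _ this.ne')
    simp only [h1]
    have h2 := Finset.sum_sum_Ioi_add_eq_sum_sum_off_diag (fun i j : Fin n => Real.log |x i - x j|)
    have h3 : ∑ i, ∑ j ∈ Finset.Ioi i, (Real.log |x j - x i| + Real.log |x i - x j|) =
        ((2:ℕ):ℝ) * ∑ i, ∑ j ∈ Finset.Ioi i, Real.log |x j - x i| := by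
      rw [Finset.mul_sum]; refine Finset.sum_congr rfl fun i _ => ?_
      rw [Finset.mul_sum]; refine Finset.sum_congr rfl fun j _ => ?_
      rw [abs_sub_comm (x i)]; push_cast; ring
    rw [← h3, h2, En]
    conv_lhs => rw [Finset.sum_comm' (t' := Finset.univ) (s' := fun j => {j}ᶜ) (by
      intro a b; simp [eq_comm])]
    refine Finset.sum_congr rfl fun i _ => ?_
    rw [← Finset.add_sum_erase _ _ (Finset.mem_univ i)]
    simp only [sub_self, abs_zero, Real.log_zero, zero_add]
    refine Finset.sum_congr (by ext; simp) fun j _ => by rw [abs_sub_comm]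
  · intro i _
    rw [abs_ne_zero, Finset.prod_ne_zero_iff]
    intro j hj
    have : i < j := by simpa using hj
    exact h0 _ _ this.ne'

lemma FinSpec.vdm {n : ℕ} {x w : Fin n → ℝ} {z : ℕ → ℝ} (h : FinSpec n x w z) :
    (∏ i, w i) * (Matrix.vandermonde x).det ^ 2 =
      ∏ k ∈ Finset.range n, ∏ j ∈ Finset.range k, (z (2*j+1) * z (2*j+2)) := by
  classical
  set M : Matrix (Fin n) (Fin n) ℝ := Matrix.of fun i k => (PP z k).eval (x i) with hM
  have hdet : (Matrix.vandermonde x).det = M.det :=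
    Matrix.det_eval_matrixOfPolynomials_eq_det_vandermonde x (fun k => PP z k)
      (fun i => PP_deg z i) (fun i => PP_monic z i)
  have hL1 : Lat x w 1 = 1 := by simp [Lat_apply, h.wsum]
  have key : M.transpose * Matrix.diagonal w * M =
      Matrix.diagonal (fun k : Fin n => ∏ j ∈ Finset.range k, (z (2*j+1) * z (2*j+2))) := by
    ext k l
    have e : (M.transpose * Matrix.diagonal w * M) k l = Lat x w (PP z k * PP z l) := by
      rw [Matrix.mul_apply, Lat_apply]
      refine Finset.sum_congr rfl fun i _ => ?_
      rw [Matrix.mul_diagonal]; simp [hM]; ring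
    rw [e]
    rcases lt_trichotomy k l with hkl | hkl | hkl
    · rw [Matrix.diagonal_apply_ne _ hkl.ne, mul_comm]
      exact h.orth l (by omega) _ (by rw [PP_deg]; exact hkl)
    · subst hkl
      rw [Matrix.diagonal_apply_eq]
      exact h.orth.norm hL1 (by omega)
    · rw [Matrix.diagonal_apply_ne _ hkl.ne']
      exact h.orth k (by omega) _ (by rw [PP_deg]; exact hkl)
  have := congrArg Matrix.det key
  rw [Matrix.det_mul, Matrix.det_mul, Matrix.det_transpose, Matrix.det_diagonal,
    Matrix.det_diagonal, Fin.prod_univ_eq_prod_range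
      (fun k => ∏ j ∈ Finset.range k, (z (2*j+1) * z (2*j+2))) n] at this
  rw [hdet, ← this]; ring

lemma FinSpec.log_vdm {n : ℕ} {x w : Fin n → ℝ} {z : ℕ → ℝ} (h : FinSpec n x w z) :
    ∑ i, Real.log (w i) + En x = ∑ k ∈ Finset.range n,
      ((n:ℝ) - 1 - k) * (Real.log (z (2*k+1)) + Real.log (z (2*k+2))) := by
  have h1 := congrArg Real.log h.vdm
  have hz : ∀ j, j + 1 < n → z (2*j+1) * z (2*j+2) ≠ 0 := fun j hj =>
    (mul_pos (h.zpos _ (by omega) (by omega)) (h.zpos _ (by omega) (by omega))).ne'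
  have hv : (Matrix.vandermonde x).det ≠ 0 := Matrix.det_vandermonde_ne_zero_iff.2 h.inj
  rw [Real.log_mul (Finset.prod_ne_zero_iff.2 fun i _ => (h.wpos i).ne') (pow_ne_zero _ hv),
    En_vdm x h.inj, Real.log_prod (fun i _ => (h.wpos i).ne'), Real.log_prod] at h1
  · rw [h1]
    have h2 : ∀ k ∈ Finset.range n, Real.log (∏ j ∈ Finset.range k, (z (2*j+1) * z (2*j+2))) =
        ∑ j ∈ Finset.range k, (Real.log (z (2*j+1)) + Real.log (z (2*j+2))) := by
      intro k hk
      rw [Finset.mem_range] at hk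
      rw [Real.log_prod]
      · refine Finset.sum_congr rfl fun j hj => ?_
        rw [Finset.mem_range] at hj
        exact Real.log_mul (left_ne_zero_of_mul (hz j (by omega)))
          (right_ne_zero_of_mul (hz j (by omega)))
      · intro j hj; rw [Finset.mem_range] at hj; exact hz j (by omega)
    rw [Finset.sum_congr rfl h2]
    have : ∀ (f : ℕ → ℝ) (n : ℕ), ∑ k ∈ Finset.range n, ∑ j ∈ Finset.range k, f j =
        ∑ k ∈ Finset.range n, ((n:ℝ) - 1 - k) * f k := by
      intro f n
      induction n with
      | zero => simp
      | succ n ih =>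
        rw [Finset.sum_range_succ, ih, Finset.sum_range_succ, ← Finset.sum_add_distrib]
        push_cast
        simp only [add_sub_cancel_right, sub_self, zero_mul, add_zero]
        refine Finset.sum_congr rfl fun k _ => by ring
    exact this (fun j => Real.log (z (2*j+1)) + Real.log (z (2*j+2))) n
  · intro k hk
    rw [Finset.mem_range] at hk
    refine Finset.prod_ne_zero_iff.2 fun j hj => ?_
    rw [Finset.mem_range] at hj
    exact hz j (by omega)

lemma FinSpec.npos {n : ℕ} {x w : Fin n → ℝ} {z : ℕ → ℝ} (h : FinSpec n x w z) : 0 < n := by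
  rcases n with _ | n
  · have := h.wsum; simp at this
  · omega

lemma FinSpec.sum_x {n : ℕ} {x w : Fin n → ℝ} {z : ℕ → ℝ} (h : FinSpec n x w z) :
    ∑ i, x i = ∑ k ∈ Finset.range n, (z (2*k+1) + z (2*k+2)) := by
  obtain ⟨m, rfl⟩ : ∃ m, n = m + 1 := ⟨n - 1, by have := h.npos; omega⟩
  have h1 := (PQ_next z m).1
  have h2 : (PP z (m+1)).nextCoeff = (PP z (m+1)).coeff m := by
    rw [nextCoeff_of_natDegree_pos (by rw [PP_deg]; omega), PP_deg]; rfl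
  have h3 : (PP z (m+1)).nextCoeff = - ∑ i, x i := by
    rw [h.root, Polynomial.prod_X_sub_C_nextCoeff]
  have h4 := h.zlast
  rw [Finset.sum_range_succ, show 2*m+2 = 2*(m+1) by ring, h4]
  linarith

lemma FinSpec.sum_log_x {n : ℕ} {x w : Fin n → ℝ} {z : ℕ → ℝ} (h : FinSpec n x w z) :
    ∑ i, Real.log (x i) = ∑ k ∈ Finset.range n, Real.log (z (2*k+1)) := by
  rw [← Real.log_prod (fun i _ => (h.xpos i).ne'), ← Real.log_prod]
  · have h1 := PP_eval_zero z n
    rw [h.root, eval_prod] at h1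
    simp only [eval_sub, eval_X, eval_C, zero_sub, Finset.prod_neg] at h1
    simp only [Finset.card_univ, Fintype.card_fin] at h1
    have : ∏ i, x i = ∏ j ∈ Finset.range n, z (2*j+1) :=
      mul_left_cancel₀ (pow_ne_zero n (by norm_num : (-1:ℝ) ≠ 0)) h1
    rw [this]
  · intro k hk; rw [Finset.mem_range] at hk
    exact (h.zpos _ (by omega) (by omega)).ne'

/-- the basic finite identity -/
lemma FinSpec.identity {n : ℕ} {x w : Fin n → ℝ} {z : ℕ → ℝ} (h : FinSpec n x w z) (B c : ℝ) :
    B * ∑ i, x i - (c + 1 - n) * ∑ i, Real.log (x i) - En x - ∑ i, Real.log (w i) =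
    ∑ k ∈ Finset.range n, (B * (z (2*k+1) + z (2*k+2)) - (c - k) * Real.log (z (2*k+1))
      - (n - 1 - k) * Real.log (z (2*k+2))) := by
  have h1 := h.log_vdm
  rw [h.sum_x, h.sum_log_x]
  have : En x + ∑ i, Real.log (w i) = ∑ k ∈ Finset.range n,
      ((n:ℝ) - 1 - k) * (Real.log (z (2*k+1)) + Real.log (z (2*k+2))) := by linarith
  rw [sub_sub _ (En x), this, Finset.mul_sum, Finset.mul_sum, ← Finset.sum_sub_distrib,
    ← Finset.sum_sub_distrib]
  refine Finset.sum_congr rfl fun k _ => by ring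

lemma split_monic {p f : ℝ[X]} {k : ℕ} (hp : p.Monic) (hpd : p.natDegree = k)
    (hf : f.natDegree < k + 1) : ∃ (c : ℝ) (g : ℝ[X]), f = C c * p + g ∧ (g = 0 ∨ g.natDegree < k) := by
  refine ⟨f.coeff k, f - C (f.coeff k) * p, by ring, ?_⟩
  by_cases h0 : f - C (f.coeff k) * p = 0
  · exact Or.inl h0
  right
  have hpk : p.coeff k = 1 := by rw [← hpd]; exact hp
  rw [natDegree_lt_iff_degree_lt h0, degree_lt_iff_coeff_zero]
  intro m hm
  rw [coeff_sub, coeff_C_mul]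
  rcases hm.eq_or_lt with rfl | hm
  · rw [hpk]; ring
  · rw [coeff_eq_zero_of_natDegree_lt (p := f) (by omega), coeff_eq_zero_of_natDegree_lt (p := p) (by omega)]; ring

lemma orth_of_pairs (L : ℝ[X] →ₗ[ℝ] ℝ) (z : ℕ → ℝ) (k : ℕ) (h : ∀ l < k, L (PP z k * PP z l) = 0) :
    ∀ f : ℝ[X], f.natDegree < k → L (PP z k * f) = 0 := by
  have : ∀ d ≤ k, ∀ f : ℝ[X], (f = 0 ∨ f.natDegree < d) → L (PP z k * f) = 0 := by
    intro d
    induction d with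
    | zero => rintro _ f (rfl | h) <;> simp_all
    | succ d ih =>
      rintro hd f (rfl | hf)
      · simp
      · obtain ⟨c, g, rfl, hg⟩ := split_monic (PP_monic z d) (PP_deg z d) hf
        rw [mul_add, map_add, ih (by omega) g hg, mul_left_comm, L_C_mul, h d (by omega)]; ring
  exact fun f hf => this k le_rfl f (Or.inr hf)

/-! Gram-Schmidt -/
def GS (L : ℝ[X] →ₗ[ℝ] ℝ) : ℕ → ℝ[X] × ℝ[X]
  | 0 => (1, 1)
  | k+1 =>
    let P := (GS L k).1
    let Q := (GS L k).2
    let P' := X * Q - C (L (X * Q * Q) / L (P * P)) * P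
    (P', P' - C (L (P' * P') / L (X * Q * Q)) * Q)

def zGS (L : ℝ[X] →ₗ[ℝ] ℝ) (j : ℕ) : ℝ :=
  if j % 2 = 1 then
    L (X * (GS L (j/2)).2 * (GS L (j/2)).2) / L ((GS L (j/2)).1 * (GS L (j/2)).1)
  else L ((GS L (j/2)).1 * (GS L (j/2)).1) / L (X * (GS L (j/2-1)).2 * (GS L (j/2-1)).2)

lemma PQ_zGS (L : ℝ[X] →ₗ[ℝ] ℝ) (k : ℕ) : PQ (zGS L) k = GS L k := by
  induction k with
  | zero => rfl
  | succ k ih =>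
    have h1 : zGS L (2*k+1) = L (X * (GS L k).2 * (GS L k).2) / L ((GS L k).1 * (GS L k).1) := by
      rw [zGS, if_pos (by omega), show (2*k+1)/2 = k by omega]
    have h2 : zGS L (2*k+2) = L ((GS L (k+1)).1 * (GS L (k+1)).1) / L (X * (GS L k).2 * (GS L k).2) := by
      rw [zGS, if_neg (by omega), show (2*k+2)/2 = k+1 by omega]; rfl
    rw [PQ, ih, h1, h2]; rfl

lemma zGS_odd (L : ℝ[X] →ₗ[ℝ] ℝ) (k : ℕ) : zGS L (2*k+1) =
    L (X * QQ (zGS L) k * QQ (zGS L) k) / L (PP (zGS L) k * PP (zGS L) k) := by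
  rw [QQ, PP, PQ_zGS, zGS, if_pos (by omega), show (2*k+1)/2 = k by omega]

lemma zGS_even (L : ℝ[X] →ₗ[ℝ] ℝ) (k : ℕ) : zGS L (2*k+2) =
    L (PP (zGS L) (k+1) * PP (zGS L) (k+1)) / L (X * QQ (zGS L) k * QQ (zGS L) k) := by
  rw [QQ, PP, PQ_zGS, PQ_zGS, zGS, if_neg (by omega), show (2*k+2)/2 = k+1 by omega]; rfl

lemma GS_orth (L : ℝ[X] →ₗ[ℝ] ℝ) (n : ℕ)
    (hpos : ∀ f : ℝ[X], f.Monic → f.natDegree < n → 0 < L (f * f) ∧ 0 < L (X * f * f)) (k : ℕ) (hk : k ≤ n) :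
    (∀ f : ℝ[X], f.natDegree < k → L (PP (zGS L) k * f) = 0) ∧
    (∀ f : ℝ[X], f.natDegree < k → L (X * QQ (zGS L) k * f) = 0) := by
  induction k with
  | zero => simp
  | succ k ih =>
    obtain ⟨hP, hQ⟩ := ih (by omega)
    have hzo := zGS_odd L k
    have hze := zGS_even L k
    set z := zGS L with hz
    have hPk := (hpos (PP z k) (PP_monic z k) (by rw [PP_deg]; omega)).1
    have hQk := (hpos (QQ z k) (QQ_monic z k) (by rw [QQ_deg]; omega)).2
    have h0 : ∀ {A : ℝ[X]} {g : ℝ[X]} {d : ℕ}, (∀ f : ℝ[X], f.natDegree < d → L (A * f) = 0) →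
        (g = 0 ∨ g.natDegree < d) → L (A * g) = 0 := by
      rintro A g d h (rfl | h') <;> simp_all
    have hXQP : L (X * QQ z k * PP z k) = L (X * QQ z k * QQ z k) := by
      obtain ⟨c, g, e, hg⟩ := split_monic (QQ_monic z k) (QQ_deg z k)
        (f := PP z k) (by rw [PP_deg]; omega)
      have hc : c = 1 := by
        have h1 : (PP z k).coeff k = 1 := by
          have := PP_monic z k; rwa [Monic, leadingCoeff, PP_deg] at this
        have h2 : (QQ z k).coeff k = 1 := by
          have := QQ_monic z k; rwa [Monic, leadingCoeff, QQ_deg] at this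
        have h3 : g.coeff k = 0 := by
          rcases hg with rfl | hg
          · simp
          · exact coeff_eq_zero_of_natDegree_lt hg
        rw [e, coeff_add, coeff_C_mul, h2, h3] at h1; linarith
      rw [e, mul_add, map_add, h0 hQ hg, hc]; simp
    have hP' : ∀ f : ℝ[X], f.natDegree < k + 1 → L (PP z (k+1) * f) = 0 := by
      intro f hf
      obtain ⟨c, g, rfl, hg⟩ := split_monic (PP_monic z k) (PP_deg z k) hf
      have e : PP z (k+1) * (C c * PP z k + g) = C c * (X * QQ z k * PP z k)
        - C (c * z (2*k+1)) * (PP z k * PP z k) + X * QQ z k * g - C (z (2*k+1)) * (PP z k * g) := by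
        rw [PP_succ, C_mul]; ring
      rw [e, map_sub, map_add, map_sub, L_C_mul, L_C_mul, L_C_mul, h0 hQ hg, h0 hP hg, hXQP,
        hzo]
      field_simp; ring
    refine ⟨hP', fun f hf => ?_⟩
    obtain ⟨c, g, rfl, hg⟩ := split_monic (QQ_monic z k) (QQ_deg z k) hf
    have e : X * QQ z (k+1) * (C c * QQ z k + g) = C c * (PP z (k+1) * PP z (k+1)) +
        C (c * z (2*k+1)) * (PP z (k+1) * PP z k)
        - C (c * z (2*k+2)) * (X * QQ z k * QQ z k) + PP z (k+1) * (X * g)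
        - C (z (2*k+2)) * (X * QQ z k * g) := by
      rw [QQ_succ, C_mul, C_mul]
      have : X * QQ z k = PP z (k+1) + C (z (2*k+1)) * PP z k := by rw [PP_succ]; ring
      linear_combination (C c * PP z (k+1)) * this
    have hg' : X * g = 0 ∨ (X * g).natDegree < k + 1 := by
      rcases hg with rfl | hg
      · simp
      · by_cases hg0 : g = 0
        · simp [hg0]
        · right; rw [natDegree_X_mul hg0]; omega
    rw [e, map_sub, map_add, map_sub, map_add, L_C_mul, L_C_mul, L_C_mul, L_C_mul, h0 hQ hg,
      h0 hP' hg', hP' (PP z k) (by rw [PP_deg]; omega), hze]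
    field_simp; ring

lemma Lat_sq_pos {n : ℕ} {x w : Fin n → ℝ} (hx : Function.Injective x) (hx0 : ∀ i, 0 < x i)
    (hw : ∀ i, 0 < w i) (f : ℝ[X]) (hf : f.Monic) (hfd : f.natDegree < n) :
    0 < Lat x w (f * f) ∧ 0 < Lat x w (X * f * f) := by
  obtain ⟨i, hi⟩ : ∃ i, f.eval (x i) ≠ 0 := by
    by_contra! h
    have := Polynomial.eq_zero_of_natDegree_lt_card_of_eval_eq_zero f hx h (by simpa using hfd)
    exact hf.ne_zero this
  constructor <;> rw [Lat_apply] <;> refine Finset.sum_pos' (fun j _ => ?_) ⟨i, Finset.mem_univ _, ?_⟩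
  · rw [eval_mul]; exact mul_nonneg (hw j).le (mul_self_nonneg _)
  · rw [eval_mul]; exact mul_pos (hw i) (mul_self_pos.2 hi)
  · rw [mul_assoc, eval_mul, eval_X, eval_mul]
    exact mul_nonneg (hw j).le (mul_nonneg (hx0 j).le (mul_self_nonneg _))
  · rw [mul_assoc, eval_mul, eval_X, eval_mul]
    exact mul_pos (hw i) (mul_pos (hx0 i) (mul_self_pos.2 hi))

lemma eq_prod_of_roots {n : ℕ} {x : Fin n → ℝ} (hx : Function.Injective x) {p : ℝ[X]} (hp : p.Monic)
    (hpd : p.natDegree = n) (h : ∀ i, p.eval (x i) = 0) : p = ∏ i, (X - C (x i)) := by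
  refine Polynomial.eq_of_monic_of_dvd_of_natDegree_le (monic_prod_X_sub_C _ _) hp ?_ ?_
  · refine Finset.prod_dvd_of_coprime (fun i _ j _ hij => ?_) fun i _ => ?_
    · exact Polynomial.isCoprime_X_sub_C_of_isUnit_sub (isUnit_iff_ne_zero.2 (sub_ne_zero.2 fun e => hij (hx e)))
    · exact dvd_iff_isRoot.2 (h i)
  · rw [hpd, natDegree_finset_prod_X_sub_C_eq_card]; simp

/-- A6 -/
lemma exists_finSpec_of_atoms {n : ℕ} {x w : Fin n → ℝ} (hx : Function.Injective x)
    (hx0 : ∀ i, 0 < x i) (hw : ∀ i, 0 < w i) (hw1 : ∑ i, w i = 1) : ∃ z, FinSpec n x w z := by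
  have hn : 0 < n := by
    rcases n with _ | n
    · simp at hw1
    · omega
  have hpos := fun f hf hfd => Lat_sq_pos hx hx0 hw f hf hfd
  have ho := GS_orth (Lat x w) n hpos
  set z := zGS (Lat x w) with hz
  have hroot : ∀ i, (PP z n).eval (x i) = 0 := by
    intro i
    have h1 := (ho n le_rfl).1 (∏ j ∈ Finset.univ.erase i, (X - C (x j))) (by
      rw [natDegree_prod_of_monic _ _ fun j _ => monic_X_sub_C _]; simp; omega)
    rw [Lat_apply, Finset.sum_eq_single i] at h1
    · rw [eval_mul, eval_prod] at h1
      have h2 : ∏ j ∈ Finset.univ.erase i, eval (x i) (X - C (x j)) ≠ 0 := by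
        refine Finset.prod_ne_zero_iff.2 fun j hj => ?_
        simp only [eval_sub, eval_X, eval_C]
        exact sub_ne_zero.2 fun e => (Finset.ne_of_mem_erase hj) (hx e).symm
      have h3 := (hw i).ne'
      simp_all
    · intro j _ hj
      rw [eval_mul, eval_prod, Finset.prod_eq_zero (i := j) (by simp [hj]) (by simp)]; simp
    · simp
  refine ⟨z, hx, hx0, hw, hw1, ?_, ?_, fun k hk => (ho k hk).1, eq_prod_of_roots hx (PP_monic z n)
    (PP_deg z n) hroot⟩
  · intro j hj hjn
    obtain ⟨k, rfl | rfl⟩ : ∃ k, j = 2*k+1 ∨ j = 2*k+2 := ⟨(j-1)/2, by omega⟩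
    · rw [hz, zGS_odd]
      exact div_pos (hpos _ (QQ_monic _ _) (by rw [QQ_deg]; omega)).2
        (hpos _ (PP_monic _ _) (by rw [PP_deg]; omega)).1
    · rw [hz, zGS_even]
      exact div_pos (hpos _ (PP_monic _ _) (by rw [PP_deg]; omega)).1
        (hpos _ (QQ_monic _ _) (by rw [QQ_deg]; omega)).2
  · obtain ⟨m, rfl⟩ : ∃ m, n = m + 1 := ⟨n - 1, by omega⟩
    rw [show 2*(m+1) = 2*m+2 by ring, hz, zGS_even, ← hz, Lat_apply, Finset.sum_eq_zero, zero_div]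
    intro i _
    rw [eval_mul, hroot]; ring

lemma PP_three (z : ℕ → ℝ) (k : ℕ) : PP z (k+2) =
    (X - C (z (2*k+2) + z (2*k+3))) * PP z (k+1) - C (z (2*k+1) * z (2*k+2)) * PP z k := by
  rw [PP_succ z (k+1), QQ_succ]
  have : X * QQ z k = PP z (k+1) + C (z (2*k+1)) * PP z k := by rw [PP_succ]; ring
  rw [C_add, C_mul, show 2*(k+1)+1 = 2*k+3 by ring]
  linear_combination (- C (z (2*k+2))) * this

lemma PP_sign {z : ℕ → ℝ} {n : ℕ} (hz : ∀ j, 1 ≤ j → j < 2*n → 0 < z j) {x : ℝ} (hx : x ≤ 0) (k : ℕ)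
    (hk : k ≤ n) : 0 < (-1)^k * (PP z k).eval x ∧ (k < n → 0 < (-1)^k * (QQ z k).eval x) := by
  induction k with
  | zero => simp [PP_zero, QQ_zero]
  | succ k ih =>
    obtain ⟨h1, h2⟩ := ih (by omega)
    have h2 := h2 (by omega)
    have e1 : (-1)^(k+1) * (PP z (k+1)).eval x = (-x) * ((-1)^k * (QQ z k).eval x) +
      z (2*k+1) * ((-1)^k * (PP z k).eval x) := by rw [PP_succ]; simp; ring
    have e2 : (-1)^(k+1) * (QQ z (k+1)).eval x = (-1)^(k+1) * (PP z (k+1)).eval x +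
      z (2*k+2) * ((-1)^k * (QQ z k).eval x) := by rw [QQ_succ]; simp; ring
    have h3 : 0 < (-1)^(k+1) * (PP z (k+1)).eval x := by
      rw [e1]
      exact add_pos_of_nonneg_of_pos (mul_nonneg (by linarith) h2.le)
        (mul_pos (hz _ (by omega) (by omega)) h1)
    refine ⟨h3, fun hk => ?_⟩
    rw [e2]
    exact add_pos h3 (mul_pos (hz _ (by omega) (by omega)) h2)

lemma real_spectral {n : ℕ} (A : Matrix (Fin n) (Fin n) ℝ) (hA : A.IsHermitian) :
    ∃ (U : Matrix (Fin n) (Fin n) ℝ) (l : Fin n → ℝ), (∀ k k', ∑ i, U k i * U k' i = if k = k' then 1 else 0) ∧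
      (∀ i i', ∑ k, U k i * U k i' = if i = i' then 1 else 0) ∧
      (∀ i k, ∑ k', A k k' * U k' i = l i * U k i) ∧ ∀ p : ℕ, (A^p).trace = ∑ i, l i ^ p := by
  have h1 : (hA.eigenvectorUnitary : Matrix (Fin n) (Fin n) ℝ) * star (hA.eigenvectorUnitary : Matrix (Fin n) (Fin n) ℝ) = 1 :=
    Unitary.coe_mul_star_self _
  have h2 : star (hA.eigenvectorUnitary : Matrix (Fin n) (Fin n) ℝ) * (hA.eigenvectorUnitary : Matrix (Fin n) (Fin n) ℝ) = 1 :=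
    Unitary.coe_star_mul_self _
  have h3 : A * (hA.eigenvectorUnitary : Matrix (Fin n) (Fin n) ℝ) =
      (hA.eigenvectorUnitary : Matrix (Fin n) (Fin n) ℝ) * Matrix.diagonal hA.eigenvalues := by
    ext k i
    have := congrFun (hA.mulVec_eigenvectorBasis i) k
    rw [Matrix.mul_diagonal, Matrix.IsHermitian.eigenvectorUnitary_apply, mul_comm]
    exact this
  generalize (hA.eigenvectorUnitary : Matrix (Fin n) (Fin n) ℝ) = U at h1 h2 h3
  refine ⟨U, hA.eigenvalues, ?_, ?_, ?_, ?_⟩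
  · intro k k'
    have := congrFun (congrFun h1 k) k'
    simpa [Matrix.mul_apply, Matrix.star_apply, Matrix.one_apply] using this
  · intro i i'
    have := congrFun (congrFun h2 i) i'
    simpa [Matrix.mul_apply, Matrix.star_apply, Matrix.one_apply] using this
  · intro i k
    have := congrFun (congrFun h3 k) i
    rw [Matrix.mul_diagonal, mul_comm] at this
    exact this
  · intro p
    have h4 : A^p * U = U * Matrix.diagonal (fun i => hA.eigenvalues i ^ p) := by
      induction p with
      | zero => simp
      | succ p ih =>
        rw [pow_succ, Matrix.mul_assoc, h3, ← Matrix.mul_assoc, ih, Matrix.mul_assoc,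
          Matrix.diagonal_mul_diagonal]
        simp [pow_succ]
    have h5 : A^p = U * (Matrix.diagonal (fun i => hA.eigenvalues i ^ p) * star U) := by
      rw [← Matrix.mul_assoc, ← h4, Matrix.mul_assoc, h1, Matrix.mul_one]
    rw [h5, Matrix.trace_mul_comm, Matrix.mul_assoc, h2, Matrix.mul_one, Matrix.trace_diagonal]

/-- Jacobi matrix entries -/
def Jb (z : ℕ → ℝ) (k : ℕ) : ℝ := if k = 0 then z 1 else z (2*k) + z (2*k+1)
def Ja (z : ℕ → ℝ) (k : ℕ) : ℝ := √(z (2*k+1) * z (2*k+2))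
def Jent (z : ℕ → ℝ) (k l : ℕ) : ℝ :=
  (if l = k then Jb z k else 0) + (if l = k + 1 then Ja z k else 0) + (if k = l + 1 then Ja z l else 0)
def Jmat (n : ℕ) (z : ℕ → ℝ) : Matrix (Fin n) (Fin n) ℝ := fun k l => Jent z k l

lemma Jent_symm (z : ℕ → ℝ) (k l : ℕ) : Jent z k l = Jent z l k := by
  unfold Jent
  rcases lt_trichotomy k l with h | rfl | h
  · simp [h.ne, h.ne', show k ≠ l+1 by omega]
  · rfl
  · simp [h.ne, h.ne', show l ≠ k+1 by omega]

lemma Jrow (z u : ℕ → ℝ) {n k : ℕ} (hk : k < n) (hu : u n = 0) :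
    ∑ l ∈ Finset.range n, Jent z k l * u l = Jb z k * u k + Ja z k * u (k+1) +
      (if k = 0 then 0 else Ja z (k-1) * u (k-1)) := by
  simp only [Jent, add_mul, Finset.sum_add_distrib, ite_mul, zero_mul]
  rw [Finset.sum_ite_eq' , Finset.sum_ite_eq', if_pos (by simpa using hk)]
  congr 1
  · congr 1
    split_ifs with h
    · rfl
    · have : k + 1 = n := by simp at h; omega
      rw [this, hu, mul_zero]
  · rcases k with _ | k
    · simp
    · simp only [Nat.add_right_cancel_iff, Finset.sum_ite_eq, if_neg (Nat.succ_ne_zero k)]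
      rw [if_pos (by simp; omega)]; rfl

lemma PP_three' (z : ℕ → ℝ) (k : ℕ) : PP z (k+1) = (X - C (Jb z k)) * PP z k -
    (if k = 0 then 0 else C (z (2*k-1) * z (2*k)) * PP z (k-1)) := by
  rcases k with _ | k
  · simp [Jb, PP_succ, PP_zero, QQ_zero]
  · rw [PP_three, Jb, if_neg (by omega), if_neg (by omega)]
    rfl

lemma eig_formula {z u : ℕ → ℝ} {n : ℕ} (hz : ∀ j, 1 ≤ j → j < 2*n → 0 < z j) (hz0 : z (2*n) = 0)
    {x : ℝ} (h : ∀ k < n, Jb z k * u k + Ja z k * u (k+1) +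
      (if k = 0 then 0 else Ja z (k-1) * u (k-1)) = x * u k) (k : ℕ) (hk : k ≤ n) :
    (∏ j ∈ Finset.range k, Ja z j) * u k = u 0 * (PP z k).eval x := by
  induction k using Nat.strong_induction_on with
  | _ k ih =>
  rcases k with _ | k
  · simp [PP_zero]
  have h1 := ih k (by omega) (by omega)
  have h2 := h k (by omega)
  rw [Finset.prod_range_succ, PP_three', mul_assoc, show Ja z k * u (k+1) = (x - Jb z k) * u k -
      (if k = 0 then 0 else Ja z (k-1) * u (k-1)) by linarith]
  rcases k with _ | k
  · simp [PP_zero]; ring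
  · have h3 := ih k (by omega) (by omega)
    simp only [if_neg (Nat.succ_ne_zero k), Nat.add_sub_cancel] at *
    rw [show 2*(k+1)-1 = 2*k+1 by omega, show 2*(k+1) = 2*k+2 by omega]
    simp only [eval_sub, eval_mul, eval_X, eval_C]
    have h4 : Ja z k ^ 2 = z (2*k+1) * z (2*k+2) := by
      rw [Ja, Real.sq_sqrt (mul_nonneg (hz _ (by omega) (by omega)).le (hz _ (by omega) (by omega)).le)]
    rw [Finset.prod_range_succ] at *
    linear_combination (x - Jb z (k+1)) * h1 - (z (2*k+1) * z (2*k+2)) * h3 - (∏ j ∈ Finset.range k, Ja z j) * u k * h4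

lemma favard {z : ℕ → ℝ} {n : ℕ} (hn : 0 < n) (hz : ∀ j, 1 ≤ j → j < 2*n → 0 < z j) (hz0 : z (2*n) = 0) :
    ∃ x w, FinSpec n x w z ∧ ∀ p : ℕ, ((Jmat n z)^p).trace = ∑ i, x i ^ p := by
  obtain ⟨U, x, h1, h2, h3, h4⟩ := real_spectral (Jmat n z) (by
    ext k l; simp [Jmat]; exact Jent_symm _ _ _)
  let u : Fin n → ℕ → ℝ := fun i k => if h : k < n then U ⟨k, h⟩ i else 0
  have hu : ∀ i (k : Fin n), u i k = U k i := fun i k => by simp [u]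
  have hun : ∀ i, u i n = 0 := fun i => by simp [u]
  set s : ℕ → ℝ := fun k => ∏ j ∈ Finset.range k, Ja z j with hs
  have hspos : ∀ k < n, 0 < s k := fun k hk => Finset.prod_pos fun j hj => by
    have := Finset.mem_range.1 hj
    exact Real.sqrt_pos.2 (mul_pos (hz _ (by omega) (by omega)) (hz _ (by omega) (by omega)))
  have hform : ∀ i, ∀ k ≤ n, s k * u i k = u i 0 * (PP z k).eval (x i) := by
    intro i
    refine eig_formula hz hz0 fun k hk => ?_
    rw [← Jrow z (u i) hk (hun i), Finset.sum_range]
    have := h3 i ⟨k, hk⟩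
    simp only [Jmat] at this
    rw [show u i k = U ⟨k, hk⟩ i from hu i ⟨k, hk⟩, ← this]
    exact Finset.sum_congr rfl fun l _ => by rw [hu]
  have hu0 : ∀ i, u i 0 ≠ 0 := by
    intro i h0
    have := h2 i i
    rw [if_pos rfl, Finset.sum_eq_zero] at this
    · norm_num at this
    intro k _
    have h5 := hform i k k.2.le
    rw [h0, zero_mul, hu] at h5
    have := (hspos k k.2).ne'
    simp_all
  have hroot : ∀ i, (PP z n).eval (x i) = 0 := by
    intro i
    have h5 := hform i n le_rfl
    rw [hun, mul_zero] at h5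
    exact (mul_eq_zero.1 h5.symm).resolve_left (hu0 i)
  have hinj : Function.Injective x := by
    intro i j hij
    by_contra hne
    have h5 := h2 i j
    rw [if_neg hne] at h5
    have h6 : ∀ k, U k i * U k j = (u j 0 / u i 0) * (U k i * U k i) := by
      intro k
      have h7 := hform i k k.2.le
      have h8 := hform j k k.2.le
      rw [hu] at h7 h8
      have h9 : U k j = (u j 0 / u i 0) * U k i := by
        have := hu0 i
        field_simp
        apply mul_left_cancel₀ (hspos k k.2).ne'
        rw [hij] at h7
        linear_combination (u i 0) * h8 - (u j 0) * h7
      rw [h9]; ring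
    simp_rw [h6, ← Finset.mul_sum, h2, if_true] at h5
    simp [hu0] at h5
  refine ⟨x, fun i => u i 0 ^ 2, ⟨hinj, ?_, fun i => by have := hu0 i; positivity, ?_, hz, hz0, ?_,
    eq_prod_of_roots hinj (PP_monic z n) (PP_deg z n) hroot⟩, h4⟩
  · intro i
    by_contra! hx
    have := (PP_sign hz hx n le_rfl).1
    rw [hroot] at this; simp at this
  · have := h1 ⟨0, hn⟩ ⟨0, hn⟩
    rw [if_pos rfl] at this
    rw [← this]
    refine Finset.sum_congr rfl fun i _ => ?_
    rw [← hu]; simp; ring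
  · intro k hk
    refine orth_of_pairs _ _ _ fun l hl => ?_
    rw [Lat_apply]
    have : ∀ i, u i 0 ^ 2 * eval (x i) (PP z k * PP z l) = s k * s l * (u i k * u i l) := by
      intro i
      rw [eval_mul]
      linear_combination (-s l * u i l) * hform i k hk - (u i 0 * (PP z k).eval (x i)) * hform i l (by omega)
    rw [Finset.sum_congr rfl fun i _ => this i, ← Finset.mul_sum]
    rcases hk.eq_or_lt with rfl | hk
    · simp [hun]
    · have := h1 ⟨k, hk⟩ ⟨l, by omega⟩
      rw [if_neg (by simp; omega)] at this
      rw [Finset.sum_congr rfl fun i _ => show u i k * u i l = U ⟨k, hk⟩ i * U ⟨l, by omega⟩ i by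
        rw [← hu, ← hu], this, mul_zero]

lemma Gfun_nonneg {x : ℝ} (hx : 0 < x) : 0 ≤ Gfun x := by
  have := Real.log_le_sub_one_of_pos hx; unfold Gfun; linarith

lemma Gfun_one : Gfun 1 = 0 := by simp [Gfun]

/-- ground state -/
def gs (B c : ℝ) (n j : ℕ) : ℝ := if j % 2 = 1 then (c - (j/2 : ℕ)) / B else (n - (j/2 : ℕ)) / B

lemma gs_odd (B c : ℝ) (n k : ℕ) : gs B c n (2*k+1) = (c - k) / B := by
  rw [gs, if_pos (by omega), show (2*k+1)/2 = k by omega]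
lemma gs_even (B c : ℝ) (n k : ℕ) : gs B c n (2*k+2) = (n - 1 - k) / B := by
  rw [gs, if_neg (by omega), show (2*k+2)/2 = k + 1 by omega]; push_cast; ring

def phi (B x : ℝ) : ℝ := x - x * Real.log (x / B)
def cst (B c : ℝ) (n : ℕ) : ℝ := ∑ k ∈ Finset.range n, (phi B (c - k) + phi B (n - 1 - k))

lemma phi_G {B a z : ℝ} (hB : 0 < B) (ha : 0 < a) (hz : 0 < z) :
    B * z - a * Real.log z = phi B a + a * Gfun (z / (a / B)) := by
  rw [phi, Gfun, Real.log_div hz.ne' (by positivity)]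
  field_simp; ring

def Sf {n : ℕ} (B a : ℝ) (x : Fin n → ℝ) : ℝ := B * ∑ i, x i - a * ∑ i, Real.log (x i) - En x

lemma FinSpec.gform {n : ℕ} {x w : Fin n → ℝ} {z : ℕ → ℝ} (h : FinSpec n x w z) {B c : ℝ} (hB : 0 < B)
    (hc : (n:ℝ) - 1 < c) : Sf B (c+1-n) x - ∑ i, Real.log (w i) = cst B c n + ∑ k ∈ Finset.range n,
      ((c - k) * Gfun (z (2*k+1) / gs B c n (2*k+1)) + (n - 1 - k) * Gfun (z (2*k+2) / gs B c n (2*k+2))) := by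
  rw [Sf, h.identity B c, cst, ← Finset.sum_add_distrib]
  refine Finset.sum_congr rfl fun k hk => ?_
  rw [Finset.mem_range] at hk
  have hk1 : (k:ℝ) + 1 ≤ n := by exact_mod_cast hk
  rw [gs_odd, gs_even]
  have h1 := phi_G hB (show 0 < c - k by linarith) (h.zpos (2*k+1) (by omega) (by omega))
  rcases (show k + 1 ≤ n by omega).eq_or_lt with h2 | h2
  · have h3 : (n:ℝ) - 1 - k = 0 := by rw [← h2]; push_cast; ring
    have h4 : z (2*k+2) = 0 := by rw [← h.zlast, ← h2]; rfl
    rw [h3, h4]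
    simp [phi] at h1 ⊢; linarith
  · have h3 : (k:ℝ) + 1 < n := by exact_mod_cast h2
    have h5 := phi_G hB (show 0 < (n:ℝ) - 1 - k by linarith) (h.zpos (2*k+2) (by omega) (by omega))
    linarith

lemma gs_pos {B c : ℝ} {n : ℕ} (hB : 0 < B) (hc : (n:ℝ) - 1 < c) (j : ℕ) (h1 : 1 ≤ j) (h2 : j < 2*n) :
    0 < gs B c n j := by
  obtain ⟨k, rfl | rfl⟩ : ∃ k, j = 2*k+1 ∨ j = 2*k+2 := ⟨(j-1)/2, by omega⟩
  · have : (k:ℝ) + 1 ≤ n := by exact_mod_cast (show k + 1 ≤ n by omega)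
    rw [gs_odd]; apply div_pos _ hB; linarith
  · have : (k:ℝ) + 1 < n := by exact_mod_cast (show k + 1 < n by omega)
    rw [gs_even]; apply div_pos _ hB; linarith

lemma gs_last (B c : ℝ) (n : ℕ) : gs B c n (2*n) = 0 := by simp [gs]

lemma FinSpec.lower {n : ℕ} {x w : Fin n → ℝ} {z : ℕ → ℝ} (h : FinSpec n x w z) {B c : ℝ} (hB : 0 < B)
    (hc : (n:ℝ) - 1 < c) (K : ℕ) (hK : K < n) : cst B c n + ∑ k ∈ Finset.range K,
      ((c - k) * Gfun (z (2*k+1) / gs B c n (2*k+1)) + (n - 1 - k) * Gfun (z (2*k+2) / gs B c n (2*k+2))) ≤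
     Sf B (c+1-n) x - ∑ i, Real.log (w i) := by
  rw [h.gform hB hc, add_le_add_iff_left]
  refine Finset.sum_le_sum_of_subset_of_nonneg (by simpa using hK.le) fun k hk _ => ?_
  rw [Finset.mem_range] at hk
  have h1 : (k:ℝ) + 1 ≤ n := by exact_mod_cast hk
  have h2 := Gfun_nonneg (div_pos (h.zpos (2*k+1) (by omega) (by omega)) (gs_pos hB hc (2*k+1) (by omega) (by omega)))
  refine add_nonneg (mul_nonneg (by linarith) h2) ?_
  rcases (show k + 1 ≤ n by omega).eq_or_lt with h3 | h3
  · rw [show (n:ℝ) - 1 - k = 0 by rw [← h3]; push_cast; ring, zero_mul]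
  · exact mul_nonneg (by linarith) (Gfun_nonneg (div_pos (h.zpos _ (by omega) (by omega)) (gs_pos hB hc _ (by omega) (by omega))))

lemma energy_lower {n : ℕ} (hn : 0 < n) {x : Fin n → ℝ} (hx : Function.Injective x) (hx0 : ∀ i, 0 < x i)
    {B c : ℝ} (hB : 0 < B) (hc : (n:ℝ) - 1 < c) : cst B c n ≤ Sf B (c+1-n) x + n * Real.log n := by
  have hn' : (0:ℝ) < n := by exact_mod_cast hn
  obtain ⟨z, h⟩ := exists_finSpec_of_atoms (w := fun _ => 1/(n:ℝ)) hx hx0 (fun _ => by positivity)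
    (by simp; field_simp)
  have := h.lower hB hc 0 hn
  simp at this; linarith

lemma ground {n : ℕ} (hn : 0 < n) {B c : ℝ} (hB : 0 < B) (hc : (n:ℝ) - 1 < c) :
    ∃ x : Fin n → ℝ, FinSpec n x (fun _ => 1/(n:ℝ)) (gs B c n) ∧ Sf B (c+1-n) x + n * Real.log n = cst B c n ∧
     ∀ p : ℕ, ((Jmat n (gs B c n))^p).trace = ∑ i, x i ^ p := by
  have hn' : (0:ℝ) < n := by exact_mod_cast hn
  obtain ⟨x, w, h, ht⟩ := favard hn (gs_pos hB hc) (gs_last B c n)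
  have h1 := h.gform hB hc
  rw [Finset.sum_eq_zero (s := Finset.range n), add_zero] at h1
  swap
  · intro k hk
    rw [Finset.mem_range] at hk
    rw [div_self (gs_pos hB hc (2*k+1) (by omega) (by omega)).ne', Gfun_one]
    rcases (show k + 1 ≤ n by omega).eq_or_lt with h3 | h3
    · rw [show (n:ℝ) - 1 - k = 0 by rw [← h3]; push_cast; ring]; ring
    · rw [div_self (gs_pos hB hc (2*k+2) (by omega) (by omega)).ne', Gfun_one]; ring
  have h2 := energy_lower hn h.inj h.xpos hB hc
  have h3 : ∀ i, Real.log (n * w i) ≤ n * w i - 1 := fun i =>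
    Real.log_le_sub_one_of_pos (mul_pos hn' (h.wpos i))
  have h4 : ∑ i, (n * w i - 1) = 0 := by
    rw [Finset.sum_sub_distrib, ← Finset.mul_sum, h.wsum]; simp
  have h5 : ∑ i, Real.log (n * w i) = n * Real.log n + ∑ i, Real.log (w i) := by
    rw [Finset.sum_congr rfl fun i _ => Real.log_mul hn'.ne' (h.wpos i).ne', Finset.sum_add_distrib]; simp
  have h6 : ∀ i, w i = 1 / n := by
    by_contra! hne
    obtain ⟨i, hi⟩ := hne
    have h7 : Real.log (n * w i) < n * w i - 1 := by
      refine Real.log_lt_sub_one_of_pos (mul_pos hn' (h.wpos i)) fun e => hi ?_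
      field_simp; linarith
    have := Finset.sum_lt_sum (fun i _ => h3 i) ⟨i, Finset.mem_univ _, h7⟩
    linarith
  obtain rfl : w = fun _ => 1/(n:ℝ) := funext h6
  refine ⟨x, h, ?_, ht⟩
  simp at h1; linarith

lemma cst_diff (B : ℝ) {N m : ℕ} (hm : m ≤ N) : cst B B N - cst B (B - m) (N - m) =
    ∑ k ∈ Finset.range m, (phi B (B - k) + phi B (N - 1 - k)) := by
  obtain ⟨M, rfl⟩ := Nat.exists_eq_add_of_le hm
  rw [cst, cst, Finset.sum_range_add, Nat.add_sub_cancel_left, sub_eq_iff_eq_add, add_right_inj]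
  refine Finset.sum_congr rfl fun k _ => ?_
  push_cast; congr 2 <;> ring

lemma PP_pos_upper {z : ℕ → ℝ} {n : ℕ} {a b x : ℝ} (ha : 0 < a) (hb : 0 < b)
    (h1 : ∀ k < n, z (2*k+1) ≤ a^2) (h2 : ∀ k, k + 1 < n → z (2*k+2) ≤ b^2)
    (hx : (a+b)^2 ≤ x) (k : ℕ) (hk : k ≤ n) :
    0 < (PP z k).eval x ∧ (k < n → (a/(a+b)) * (PP z k).eval x ≤ (QQ z k).eval x) := by
  induction k with
  | zero =>
    simp only [PP_zero, QQ_zero, eval_one]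
    refine ⟨one_pos, fun _ => ?_⟩
    rw [mul_one, div_le_one (by positivity)]; linarith
  | succ k ih =>
    obtain ⟨h3, h4⟩ := ih (by omega)
    have h4 := h4 (by omega)
    have h5 := h1 k (by omega)
    have hQ : 0 < (QQ z k).eval x := lt_of_lt_of_le (by positivity) h4
    have hP : (PP z k).eval x ≤ (a+b)/a * (QQ z k).eval x := by
      have := mul_le_mul_of_nonneg_left h4 (show 0 ≤ (a+b)/a by positivity)
      rwa [← mul_assoc, show (a+b)/a * (a/(a+b)) = 1 by field_simp, one_mul] at this
    have e1 : (PP z (k+1)).eval x = x * (QQ z k).eval x - z (2*k+1) * (PP z k).eval x := by rw [PP_succ]; simp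
    have e2 : (QQ z (k+1)).eval x = (PP z (k+1)).eval x - z (2*k+2) * (QQ z k).eval x := by rw [QQ_succ]; simp
    have h6 : b*(a+b) * (QQ z k).eval x ≤ (PP z (k+1)).eval x := by
      have h7 : z (2*k+1) * (PP z k).eval x ≤ a^2 * ((a+b)/a * (QQ z k).eval x) :=
        (mul_le_mul_of_nonneg_right h5 h3.le).trans (mul_le_mul_of_nonneg_left hP (by positivity))
      have h8 := mul_le_mul_of_nonneg_right hx hQ.le
      have h9 : a^2 * ((a+b)/a * (QQ z k).eval x) = a*(a+b) * (QQ z k).eval x := by field_simp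
      nlinarith
    refine ⟨lt_of_lt_of_le (by positivity) h6, fun hk => ?_⟩
    rw [e2]
    have h7 := mul_le_mul_of_nonneg_right (h2 k (by omega)) hQ.le
    have h8 : b^2 * (QQ z k).eval x ≤ b/(a+b) * (PP z (k+1)).eval x := by
      have := mul_le_mul_of_nonneg_left h6 (show 0 ≤ b/(a+b) by positivity)
      refine le_trans (le_of_eq ?_) this; field_simp
    have h9 : a/(a+b) * (PP z (k+1)).eval x = (PP z (k+1)).eval x - b/(a+b) * (PP z (k+1)).eval x := by
      field_simp; ring
    linarith

lemma FinSpec.atom_root {n : ℕ} {x w : Fin n → ℝ} {z : ℕ → ℝ} (h : FinSpec n x w z) (i : Fin n) :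
    (PP z n).eval (x i) = 0 := by
  rw [h.root, eval_prod, Finset.prod_eq_zero (Finset.mem_univ i)]; simp

lemma FinSpec.atom_lt {n : ℕ} {x w : Fin n → ℝ} {z : ℕ → ℝ} (h : FinSpec n x w z) {a b : ℝ} (ha : 0 < a) (hb : 0 < b)
    (h1 : ∀ k < n, z (2*k+1) ≤ a^2) (h2 : ∀ k, k + 1 < n → z (2*k+2) ≤ b^2) (i : Fin n) :
    x i < (a+b)^2 := by
  by_contra! hx
  have := (PP_pos_upper ha hb h1 h2 hx n le_rfl).1
  rw [h.atom_root] at this; exact lt_irrefl _ this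

lemma PP_lower {z t : ℕ → ℝ} {n : ℕ} {r x : ℝ} (hr : 0 < r) (hr1 : r < 1)
    (hz : ∀ k, k + 1 < n → 0 < z (2*k+2))
    (ht0 : ∀ k < n, 0 ≤ t k) (ht1 : ∀ k < n, t k < 1)
    (h1 : ∀ k < n, 1 - r^2 * t k ≤ z (2*k+1)) (h2 : ∀ k, k + 1 < n → z (2*k+2) ≤ r^2 * (1 - t k))
    (hx0 : 0 < x) (hx : x ≤ (1-r)^2) (k : ℕ) (hk : k ≤ n) :
    0 < (-1)^k * (PP z k).eval x ∧ (k < n → 0 < (-1)^k * (QQ z k).eval x ∧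
      (1-r) * ((-1)^k * (QQ z k).eval x) ≤ (-1)^k * (PP z k).eval x) := by
  induction k with
  | zero =>
    simp only [PP_zero, QQ_zero, eval_one]
    refine ⟨by norm_num, fun _ => ⟨by norm_num, by norm_num; linarith⟩⟩
  | succ k ih =>
    obtain ⟨h3, h4'⟩ := ih (by omega)
    obtain ⟨h4, h5⟩ := h4' (by omega)
    clear h4' ih
    have e1 : (-1)^(k+1) * (PP z (k+1)).eval x = z (2*k+1) * ((-1)^k * (PP z k).eval x) -
       x * ((-1)^k * (QQ z k).eval x) := by rw [PP_succ]; simp; ring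
    have e2 : (-1)^(k+1) * (QQ z (k+1)).eval x = (-1)^(k+1) * (PP z (k+1)).eval x +
      z (2*k+2) * ((-1)^k * (QQ z k).eval x) := by rw [QQ_succ]; simp; ring
    set p := (-1)^k * (PP z k).eval x
    set q := (-1)^k * (QQ z k).eval x
    set p' := (-1)^(k+1) * (PP z (k+1)).eval x
    set q' := (-1)^(k+1) * (QQ z (k+1)).eval x
    have ht := ht0 k (by omega)
    have ht' := ht1 k (by omega)
    have hz1 := h1 k (by omega)
    have hrt : 0 < 1 - r * t k := by nlinarith
    have hrt2 : 0 < 1 - r^2 * t k := by nlinarith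
    have h6 : (1-r) * (r * (1 - r * t k)) * q ≤ p' := by
      have h7 : (1 - r^2 * t k) * p ≤ z (2*k+1) * p := mul_le_mul_of_nonneg_right hz1 h3.le
      have h8 : x * q ≤ (1-r)^2 * q := mul_le_mul_of_nonneg_right hx h4.le
      have h9 : (1 - r^2 * t k) * ((1-r) * q) ≤ (1 - r^2 * t k) * p := mul_le_mul_of_nonneg_left h5 hrt2.le
      nlinarith
    have hp' : 0 < p' := lt_of_lt_of_le (mul_pos (mul_pos (by linarith) (mul_pos hr hrt)) h4) h6
    refine ⟨hp', fun hk => ?_⟩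
    have hz2 := hz k (by omega)
    refine ⟨by rw [e2]; exact add_pos hp' (mul_pos hz2 h4), ?_⟩
    have h7 : z (2*k+2) * q ≤ r^2 * (1 - r * t k) * q := by
      refine mul_le_mul_of_nonneg_right ((h2 k (by omega)).trans ?_) h4.le
      have : r * t k ≤ t k := by nlinarith
      nlinarith [sq_nonneg r]
    rw [e2]
    have h8 : (1-r) * (z (2*k+2) * q) ≤ (1-r) * (r^2 * (1 - r * t k) * q) :=
      mul_le_mul_of_nonneg_left h7 (by linarith)
    have h9 := mul_le_mul_of_nonneg_left h6 hr.le
    nlinarith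

lemma gs_edges {τ : ℝ} (hτ0 : 0 < τ) (hτ1 : τ ≤ 1) {N m : ℕ} (hm : m < N) {x : Fin (N-m) → ℝ} {w : Fin (N-m) → ℝ}
    (h : FinSpec (N-m) x w (gs (N/τ) (N/τ - m) (N-m))) (i : Fin (N-m)) : tauM τ ≤ x i ∧ x i ≤ tauP τ := by
  have hN : (0:ℝ) < N := by exact_mod_cast (by omega : 0 < N)
  have hcast : ((N - m : ℕ) : ℝ) = N - m := by rw [Nat.cast_sub hm.le]
  have hs := Real.sq_sqrt hτ0.le
  have hs0 := Real.sqrt_pos.2 hτ0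
  have e1 : ∀ k : ℕ, gs (N/τ) (N/τ - m) (N-m) (2*k+1) = 1 - (√τ)^2 * ((m + k)/N) := by
    intro k; rw [gs_odd, hs]; field_simp; ring
  have e2 : ∀ k : ℕ, gs (N/τ) (N/τ - m) (N-m) (2*k+2) = (√τ)^2 * (1 - (m + k)/N) - τ/N := by
    intro k; rw [gs_even, hs, hcast]; field_simp; ring
  have ht0 : ∀ k : ℕ, (0:ℝ) ≤ (m+k:ℝ)/N := fun k => by positivity
  constructor
  · by_contra! hx
    have hs1 : √τ < 1 := by
      rcases hτ1.eq_or_lt with rfl | h1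
      · simp [tauM] at hx; linarith [h.xpos i]
      · rw [Real.sqrt_lt' one_pos]; simpa using h1
    have := (PP_lower (t := fun k => (m+k:ℝ)/N) hs0 hs1 (fun k hk => h.zpos _ (by omega) (by omega))
      (fun k _ => ht0 k) (fun k hk => ?_) (fun k _ => (e1 k).ge) (fun k _ => ?_) (h.xpos i) hx.le (N-m) le_rfl).1
    · rw [h.atom_root] at this; simp at this
    · rw [div_lt_one hN]; exact_mod_cast (by omega : m + k < N)
    · rw [e2]; have : 0 < τ/N := by positivity
      linarith
  · refine (h.atom_lt one_pos hs0 (fun k _ => ?_) (fun k _ => ?_) i).le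
    · rw [e1]; have := ht0 k; nlinarith [mul_nonneg (sq_nonneg √τ) (ht0 k)]
    · rw [e2]; have : 0 < τ/N := by positivity
      nlinarith [mul_nonneg (sq_nonneg √τ) (ht0 k)]

structure PConv {ι : Type*} (l : Filter ι) (d : ℕ) (pN : ι → ℝ[X]) (p : ℝ[X]) : Prop where
  deg : ∀ N, (pN N).natDegree ≤ d
  deg' : p.natDegree ≤ d
  conv : ∀ i, Tendsto (fun N => (pN N).coeff i) l (𝓝 (p.coeff i))

lemma PConv.mul {ι : Type*} {l : Filter ι} {d e : ℕ} {pN qN : ι → ℝ[X]} {p q : ℝ[X]} (hp : PConv l d pN p)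
    (hq : PConv l e qN q) : PConv l (d+e) (fun N => pN N * qN N) (p * q) := by
  refine ⟨fun N => natDegree_mul_le_of_le (hp.deg N) (hq.deg N), natDegree_mul_le_of_le hp.deg' hq.deg', fun i => ?_⟩
  simp only [coeff_mul]
  exact tendsto_finsetSum _ fun x _ => (hp.conv _).mul (hq.conv _)

lemma PConv.const {ι : Type*} (l : Filter ι) (p : ℝ[X]) : PConv l p.natDegree (fun _ => p) p :=
  ⟨fun _ => le_rfl, le_rfl, fun _ => tendsto_const_nhds⟩

lemma L_sum (L : ℝ[X] →ₗ[ℝ] ℝ) {p : ℝ[X]} {d : ℕ} (h : p.natDegree ≤ d) :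
    L p = ∑ i ∈ Finset.range (d+1), p.coeff i * L (X^i) := by
  conv_lhs => rw [p.as_sum_range_C_mul_X_pow' (Nat.lt_succ_of_le h)]
  simp [map_sum, L_C_mul]

lemma PConv.L {ι : Type*} {l : Filter ι} {d : ℕ} {pN : ι → ℝ[X]} {p : ℝ[X]} (hp : PConv l d pN p)
    {LN : ι → ℝ[X] →ₗ[ℝ] ℝ} {L : ℝ[X] →ₗ[ℝ] ℝ} (h : ∀ i ≤ d, Tendsto (fun N => LN N (X^i)) l (𝓝 (L (X^i)))) :
    Tendsto (fun N => LN N (pN N)) l (𝓝 (L p)) := by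
  rw [L_sum L hp.deg', funext fun N => L_sum (LN N) (hp.deg N)]
  exact tendsto_finsetSum _ fun i hi => (hp.conv i).mul (h i (by simp at hi; omega))

lemma PQ_conv {ι : Type*} {l : Filter ι} {zN : ι → ℕ → ℝ} {z : ℕ → ℝ} (k : ℕ)
    (h : ∀ j, 1 ≤ j → j ≤ 2*k → Tendsto (fun N => zN N j) l (𝓝 (z j))) :
    PConv l k (fun N => PP (zN N) k) (PP z k) ∧ PConv l k (fun N => QQ (zN N) k) (QQ z k) := by
  induction k with
  | zero =>
    simp only [PP_zero, QQ_zero]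
    have := PConv.const l (1:ℝ[X])
    rw [natDegree_one] at this
    exact ⟨this, this⟩
  | succ k ih =>
    obtain ⟨h1, h2⟩ := ih fun j hj hj' => h j hj (by omega)
    have h3 : PConv l (k+1) (fun N => PP (zN N) (k+1)) (PP z (k+1)) := by
      refine ⟨fun N => (PP_deg _ _).le, (PP_deg _ _).le, fun i => ?_⟩
      simp only [PP_succ, coeff_sub, coeff_C_mul]
      refine Tendsto.sub ?_ ((h _ (by omega) (by omega)).mul (h1.conv i))
      rcases i with _ | i
      · simp [tendsto_const_nhds]
      · simpa only [coeff_X_mul] using h2.conv i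
    refine ⟨h3, fun N => (QQ_deg _ _).le, (QQ_deg _ _).le, fun i => ?_⟩
    simp only [QQ_succ, coeff_sub, coeff_C_mul]
    exact (h3.conv i).sub ((h _ (by omega) (by omega)).mul (h2.conv i))

lemma PP1_conv {ι : Type*} {l : Filter ι} {zN : ι → ℕ → ℝ} {z : ℕ → ℝ} (k : ℕ)
    (h : ∀ j, 1 ≤ j → j ≤ 2*k+1 → Tendsto (fun N => zN N j) l (𝓝 (z j))) :
    PConv l (k+1) (fun N => PP (zN N) (k+1)) (PP z (k+1)) := by
  obtain ⟨h1, h2⟩ := PQ_conv (l := l) (zN := zN) (z := z) k fun j hj hj' => h j hj (by omega)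
  refine ⟨fun N => (PP_deg _ _).le, (PP_deg _ _).le, fun i => ?_⟩
  simp only [PP_succ, coeff_sub, coeff_C_mul]
  refine Tendsto.sub ?_ ((h _ (by omega) (by omega)).mul (h1.conv i))
  rcases i with _ | i
  · simp [tendsto_const_nhds]
  · simpa only [coeff_X_mul] using h2.conv i

/-- coordinates → functionals -/
lemma func_conv {ι : Type*} {l : Filter ι} {zN : ι → ℕ → ℝ} {z : ℕ → ℝ}
    {LN : ι → ℝ[X] →ₗ[ℝ] ℝ} {L : ℝ[X] →ₗ[ℝ] ℝ} {nN : ι → ℕ} (hn : Tendsto nN l atTop)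
    (hLN : ∀ N, OrthTo (LN N) (zN N) (nN N)) (hLN1 : ∀ N, LN N 1 = 1) (hL : ∀ n, OrthTo L z n) (hL1 : L 1 = 1)
    (h : ∀ j, 1 ≤ j → Tendsto (fun N => zN N j) l (𝓝 (z j))) (p : ℝ[X]) :
    Tendsto (fun N => LN N p) l (𝓝 (L p)) := by
  have key : ∀ d, Tendsto (fun N => LN N (X^d)) l (𝓝 (L (X^d))) := by
    intro d
    induction d using Nat.strong_induction_on with
    | _ d ih =>
    rcases d with _ | d
    · simp only [pow_zero, hLN1, hL1]; exact tendsto_const_nhds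
    have e : ∀ (M : ℝ[X] →ₗ[ℝ] ℝ) (y : ℕ → ℝ), M (PP y (d+1)) = 0 → M (X^(d+1)) =
        - ∑ i ∈ Finset.range (d+1), (PP y (d+1)).coeff i * M (X^i) := by
      intro M y hM
      rw [L_sum M (PP_deg y (d+1)).le, Finset.sum_range_succ] at hM
      have : (PP y (d+1)).coeff (d+1) = 1 := by
        have := PP_monic y (d+1); rwa [Monic, leadingCoeff, PP_deg] at this
      rw [this] at hM; linarith
    have e0 : ∀ (M : ℝ[X] →ₗ[ℝ] ℝ) (y : ℕ → ℝ) n, d + 1 ≤ n → OrthTo M y n → M (PP y (d+1)) = 0 := by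
      intro M y n hn hM
      have := hM (d+1) hn 1 (by simp)
      simpa using this
    have h1 : ∀ᶠ N in l, - ∑ i ∈ Finset.range (d+1), (PP (zN N) (d+1)).coeff i * LN N (X^i) = LN N (X^(d+1)) := by
      filter_upwards [hn.eventually_ge_atTop (d+1)] with N hN
      exact (e _ _ (e0 _ _ _ hN (hLN N))).symm
    refine Tendsto.congr' h1 ?_
    rw [e L z (e0 _ _ _ le_rfl (hL (d+1)))]
    refine (tendsto_finsetSum _ fun i hi => ?_).neg
    exact (((PQ_conv (l := l) (zN := zN) (z := z) (d+1) fun j hj _ => h j hj).1).conv i).mul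
      (ih i (by simpa using hi))
  exact (PConv.const l p).L fun i _ => key i

/-- functionals → coordinates -/
lemma coord_conv {ι : Type*} {l : Filter ι} {zN : ι → ℕ → ℝ} {z : ℕ → ℝ}
    {LN : ι → ℝ[X] →ₗ[ℝ] ℝ} {L : ℝ[X] →ₗ[ℝ] ℝ} {nN : ι → ℕ} (hn : Tendsto nN l atTop)
    (hLN : ∀ N, OrthTo (LN N) (zN N) (nN N)) (hL : ∀ n, OrthTo L z n) (hL1 : L 1 = 1)
    (hz : ∀ j, 1 ≤ j → 0 < z j)
    (h : ∀ p, Tendsto (fun N => LN N p) l (𝓝 (L p))) (j : ℕ) (hj : 1 ≤ j) :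
    Tendsto (fun N => zN N j) l (𝓝 (z j)) := by
  induction j using Nat.strong_induction_on with
  | _ j ih =>
  have hpos : ∀ k, 0 < L (PP z k * PP z k) := fun k => by
    rw [(hL (k+1)).norm hL1 le_rfl]
    exact Finset.prod_pos fun j _ => mul_pos (hz _ (by omega)) (hz _ (by omega))
  have hX := PConv.const l (X : ℝ[X])
  obtain ⟨k, rfl | rfl⟩ : ∃ k, j = 2*k+1 ∨ j = 2*k+2 := ⟨(j-1)/2, by omega⟩
  · obtain ⟨h1, h2⟩ := PQ_conv (l := l) (zN := zN) (z := z) k fun j hj hj' => ih j (by omega) hj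
    have h3 := ((hX.mul h2).mul h2).L (LN := LN) (L := L) fun i _ => h _
    have h4 := (h1.mul h1).L (LN := LN) (L := L) fun i _ => h _
    have h5 := h3.div h4 (hpos k).ne'
    rw [(hL (k+1)).XQQ le_rfl, mul_div_cancel_right₀ _ (hpos k).ne'] at h5
    refine h5.congr' ?_
    filter_upwards [hn.eventually_ge_atTop (k+1), h4.eventually (lt_mem_nhds (hpos k))] with N hN hN2
    rw [Pi.div_apply, (hLN N).XQQ hN, mul_div_cancel_right₀ _ hN2.ne']
  · have h1 := PP1_conv (l := l) (zN := zN) (z := z) k fun j hj hj' => ih j (by omega) hj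
    obtain ⟨-, h2⟩ := PQ_conv (l := l) (zN := zN) (z := z) k fun j hj hj' => ih j (by omega) hj
    have h3 := ((hX.mul h2).mul h2).L (LN := LN) (L := L) fun i _ => h _
    have h4 := (h1.mul h1).L (LN := LN) (L := L) fun i _ => h _
    have hp : 0 < L (X * QQ z k * QQ z k) := by
      rw [(hL (k+1)).XQQ le_rfl]; exact mul_pos (hz _ (by omega)) (hpos k)
    have h5 := h4.div h3 hp.ne'
    rw [(hL (k+2)).PP_sq le_rfl, mul_div_cancel_right₀ _ hp.ne'] at h5
    refine h5.congr' ?_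
    filter_upwards [hn.eventually_ge_atTop (k+2), h3.eventually (lt_mem_nhds hp)] with N hN hN2
    rw [Pi.div_apply, (hLN N).PP_sq hN, mul_div_cancel_right₀ _ hN2.ne']

lemma integrable_of_contOn {μ : Measure ℝ} [IsFiniteMeasure μ] {a b : ℝ} (h : μ (Icc a b)ᶜ = 0) {f : ℝ → ℝ}
    (hf : ContinuousOn f (Icc a b)) : Integrable f μ := by
  have h1 : μ.restrict (Icc a b) = μ := Measure.restrict_eq_self_of_ae_mem (by
    rw [ae_iff]; exact h)
  have := hf.integrableOn_Icc (μ := μ)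
  rwa [IntegrableOn, h1] at this

lemma ae_mem_Icc {μ : Measure ℝ} {a b : ℝ} (h : μ (Icc a b)ᶜ = 0) : ∀ᵐ x ∂μ, x ∈ Icc a b := by
  rw [ae_iff]; exact h

/-- moment functional -/
def Lm (μ : Measure ℝ) (h : ∀ p : ℝ[X], Integrable (fun x => p.eval x) μ) : ℝ[X] →ₗ[ℝ] ℝ where
  toFun p := ∫ x, p.eval x ∂μ
  map_add' p q := by simp only [eval_add]; exact integral_add (h p) (h q)
  map_smul' c p := by simp only [eval_smul, smul_eq_mul, RingHom.id_apply]; exact integral_const_mul _ _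

lemma Lm_apply (μ : Measure ℝ) (h : ∀ p : ℝ[X], Integrable (fun x => p.eval x) μ) (p : ℝ[X]) :
  Lm μ h p = ∫ x, p.eval x ∂μ := rfl

lemma link {μ : Measure ℝ} [IsProbabilityMeasure μ] (h : ∀ p : ℝ[X], Integrable (fun x => p.eval x) μ)
    {z : ℕ → ℝ} (hz : IsCanonicalZ μ z) : (∀ j, 1 ≤ j → 0 < z j) ∧ ∀ n, OrthTo (Lm μ h) z n := by
  obtain ⟨hz0, hznn, a, b, ⟨ha, p, hpd, hpl, hpo, hpr⟩, hb, haz⟩ := hz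
  have hprod : ∀ k, 0 < z (2*k+1) * z (2*k+2) := fun k => by rw [← haz]; exact pow_pos (ha k) 2
  have hzpos : ∀ j, 1 ≤ j → 0 < z j := by
    intro j hj
    obtain ⟨k, rfl | rfl⟩ : ∃ k, j = 2*k+1 ∨ j = 2*k+2 := ⟨(j-1)/2, by omega⟩
    · exact pos_of_mul_pos_left (hprod k) (hznn _)
    · exact pos_of_mul_pos_right (hprod k) (hznn _)
  refine ⟨hzpos, ?_⟩
  have hp0 : ∀ x, (p 0).eval x = 1 := by
    have h1 := eq_C_of_natDegree_eq_zero (hpd 0)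
    have h2 := hpl 0
    have h3 := hpo 0 0
    rw [leadingCoeff, hpd] at h2
    rw [h1] at h3
    simp at h3
    intro x
    rw [h1, eval_C]
    nlinarith
  have key : ∀ k x, (∏ j ∈ Finset.range k, a (j+1)) * (p k).eval x = (PP z k).eval x := by
    intro k
    induction k using Nat.strong_induction_on with
    | _ k ih =>
    intro x
    rcases k with _ | k
    · simp [hp0, PP_zero]
    have h1 := ih k (by omega) x
    have h2 := hpr k x
    rw [Finset.prod_range_succ, PP_three', mul_assoc, show a (k+1) * (p (k+1)).eval x = (x - b (k+1)) * (p k).eval x -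
      (if k = 0 then 0 else a k * (p (k-1)).eval x) by linarith, hb]
    rcases k with _ | k
    · simp [PP_zero, Jb, hp0, hz0]
    · have h3 := ih k (by omega) x
      have h4 := haz k
      rw [Jb]
      simp only [if_neg (Nat.succ_ne_zero k), Nat.add_sub_cancel] at *
      rw [show 2*(k+1)-1 = 2*k+1 by omega, show 2*(k+1) = 2*k+2 by omega]
      simp only [eval_sub, eval_mul, eval_X, eval_C]
      rw [Finset.prod_range_succ] at *
      linear_combination (x - z (2*k+2) - z (2*k+2+1)) * h1 - (z (2*k+1) * z (2*k+2)) * h3 -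
        (∏ j ∈ Finset.range k, a (j+1)) * (p k).eval x * h4
  intro n k _
  refine orth_of_pairs _ _ _ fun l hl => ?_
  rw [Lm_apply]
  simp only [eval_mul, ← key]
  have e : (fun x => (∏ j ∈ Finset.range k, a (j+1)) * (p k).eval x * ((∏ j ∈ Finset.range l, a (j+1)) * (p l).eval x))
    = fun x => ((∏ j ∈ Finset.range k, a (j+1)) * (∏ j ∈ Finset.range l, a (j+1))) * ((p k).eval x * (p l).eval x) := by
    ext x; ring
  rw [e, integral_const_mul, hpo, if_neg (by omega), mul_zero]

/-- weak convergence from moments -/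
lemma weak_conv {ι : Type*} {l : Filter ι} {n : ι → ℕ} {x w : (N : ι) → Fin (n N) → ℝ}
    {μ : Measure ℝ} [IsProbabilityMeasure μ] {a b : ℝ} (hμ : μ (Icc a b)ᶜ = 0)
    (hx : ∀ N i, x N i ∈ Icc a b) (hw : ∀ N i, 0 ≤ w N i) (hw1 : ∀ N, ∑ i, w N i = 1)
    (h : ∀ p : ℝ[X], Tendsto (fun N => ∑ i, w N i * p.eval (x N i)) l (𝓝 (∫ t, p.eval t ∂μ)))
    {f : ℝ → ℝ} (hf : ContinuousOn f (Icc a b)) :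
    Tendsto (fun N => ∑ i, w N i * f (x N i)) l (𝓝 (∫ t, f t ∂μ)) := by
  rw [Metric.tendsto_nhds]
  intro ε hε
  obtain ⟨p, hp⟩ := exists_polynomial_near_of_continuousOn a b f hf (ε/3) (by positivity)
  filter_upwards [(Metric.tendsto_nhds.1 (h p)) (ε/3) (by positivity)] with N hN
  rw [Real.dist_eq] at *
  have h1 : |∑ i, w N i * f (x N i) - ∑ i, w N i * p.eval (x N i)| ≤ ε/3 := by
    rw [← Finset.sum_sub_distrib]
    calc _ ≤ ∑ i, |w N i * f (x N i) - w N i * p.eval (x N i)| := Finset.abs_sum_le_sum_abs _ _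
      _ ≤ ∑ i, w N i * (ε/3) := Finset.sum_le_sum fun i _ => by
          rw [← mul_sub, abs_mul, abs_of_nonneg (hw N i), abs_sub_comm]
          exact mul_le_mul_of_nonneg_left (hp _ (hx N i)).le (hw N i)
      _ = ε/3 := by rw [← Finset.sum_mul, hw1, one_mul]
  have h2 : |∫ t, f t ∂μ - ∫ t, p.eval t ∂μ| ≤ ε/3 := by
    rw [← integral_sub (integrable_of_contOn hμ hf) (integrable_of_contOn hμ (by fun_prop))]
    have := norm_integral_le_of_norm_le_const (μ := μ) (f := fun t => f t - p.eval t) (C := ε/3) (by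
      filter_upwards [ae_mem_Icc hμ] with t ht
      rw [Real.norm_eq_abs, abs_sub_comm]; exact (hp t ht).le)
    simpa using this
  rw [abs_lt] at *
  rw [abs_le] at h1 h2
  constructor <;> linarith

def yy (r θ : ℝ) : ℝ := 1 + r^2 + 2*r*Real.cos θ

lemma yy_ge (r θ : ℝ) : Real.sin θ ^ 2 ≤ yy r θ := by
  unfold yy; nlinarith [Real.sin_sq_add_cos_sq θ, sq_nonneg (r + Real.cos θ)]

lemma yy_pos (r : ℝ) {θ : ℝ} (h : θ ∈ Ioo 0 π) : 0 < yy r θ :=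
  lt_of_lt_of_le (pow_pos (Real.sin_pos_of_mem_Ioo h) 2) (yy_ge r θ)

lemma yy_image {r : ℝ} (hr : 0 < r) : yy r '' Ioo 0 π = Ioo ((1-r)^2) ((1+r)^2) := by
  ext x
  constructor
  · rintro ⟨θ, hθ, rfl⟩
    have h1 : Real.cos θ < 1 := by
      have := Real.cos_lt_cos_of_nonneg_of_le_pi le_rfl hθ.2.le hθ.1; rwa [Real.cos_zero] at this
    have h2 : -1 < Real.cos θ := by
      have := Real.cos_lt_cos_of_nonneg_of_le_pi hθ.1.le le_rfl hθ.2; rwa [Real.cos_pi] at this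
    unfold yy
    constructor <;> nlinarith
  · rintro ⟨h1, h2⟩
    refine ⟨Real.arccos ((x - 1 - r^2)/(2*r)), ⟨?_, ?_⟩, ?_⟩
    · rw [Real.arccos_pos, div_lt_one (by positivity)]; nlinarith
    · rw [lt_iff_le_and_ne]
      refine ⟨Real.arccos_le_pi _, fun h => ?_⟩
      rw [Real.arccos_eq_pi, div_le_iff₀ (by positivity)] at h; nlinarith
    · unfold yy
      rw [Real.cos_arccos]
      · field_simp; ring
      · rw [le_div_iff₀ (by positivity)]; nlinarith
      · rw [div_le_iff₀ (by positivity)]; nlinarith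

lemma yy_deriv (r θ : ℝ) : HasDerivAt (yy r) (-(2*r*Real.sin θ)) θ := by
  unfold yy
  have := ((Real.hasDerivAt_cos θ).const_mul (2*r)).const_add (1 + r^2)
  exact this.congr_deriv (by ring)

lemma yy_inj {r : ℝ} (hr : 0 < r) : InjOn (yy r) (Ioo 0 π) := by
  intro a ha b hb h
  unfold yy at h
  exact Real.injOn_cos ⟨ha.1.le, ha.2.le⟩ ⟨hb.1.le, hb.2.le⟩ (mul_left_cancel₀ (show 2*r ≠ 0 by positivity) (by linarith))

def mpd (τ x : ℝ) : ℝ := Real.sqrt ((x - tauM τ) * (tauP τ - x)) / (2*π*τ*x)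

lemma mpd_meas (τ : ℝ) : Measurable (mpd τ) := by unfold mpd; fun_prop

lemma mpd_zero {τ x : ℝ} (hx : x ∉ Ioo (tauM τ) (tauP τ)) : mpd τ x = 0 := by
  have hle : tauM τ ≤ tauP τ := by unfold tauM tauP; nlinarith [Real.sqrt_nonneg τ]
  unfold mpd
  rw [Real.sqrt_eq_zero_of_nonpos, zero_div]
  simp only [mem_Ioo, not_and_or, not_lt] at hx
  rcases hx with h | h
  · exact mul_nonpos_of_nonpos_of_nonneg (by linarith) (by linarith)
  · exact mul_nonpos_of_nonneg_of_nonpos (by linarith) (by linarith)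

lemma tauM_nonneg (τ : ℝ) : 0 ≤ tauM τ := sq_nonneg _

lemma mpd_nonneg {τ : ℝ} (hτ : 0 < τ) (x : ℝ) : 0 ≤ mpd τ x := by
  by_cases hx : x ∈ Ioo (tauM τ) (tauP τ)
  · have : 0 < x := lt_of_le_of_lt (tauM_nonneg τ) hx.1
    unfold mpd; positivity
  · rw [mpd_zero hx]

lemma mpd_yy {τ : ℝ} (hτ : 0 < τ) {θ : ℝ} (hθ : θ ∈ Ioo 0 π) :
    |-(2*√τ*Real.sin θ)| * mpd τ (yy (√τ) θ) = 2/π * (Real.sin θ ^ 2 / yy (√τ) θ) := by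
  have hs := Real.sin_pos_of_mem_Ioo hθ
  have hy := yy_pos (√τ) hθ
  have hr := Real.sqrt_pos.2 hτ
  have e : (yy (√τ) θ - tauM τ) * (tauP τ - yy (√τ) θ) = (2*√τ*Real.sin θ)^2 := by
    unfold yy tauM tauP
    have := Real.sin_sq_add_cos_sq θ
    rw [mul_pow, show Real.sin θ ^ 2 = 1 - Real.cos θ ^ 2 by linarith]; ring
  rw [mpd, e, Real.sqrt_sq (by positivity), abs_neg, abs_of_pos (by positivity)]
  have h2 := Real.sq_sqrt hτ.le
  field_simp
  rw [h2]

lemma MPm_eq (τ : ℝ) : MPm τ = volume.withDensity fun x => ENNReal.ofReal (mpd τ x) := rfl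

lemma mp_bound (r θ : ℝ) : Real.sin θ ^ 2 / yy r θ ≤ 1 :=
  div_le_one_of_le₀ (yy_ge r θ) ((sq_nonneg _).trans (yy_ge r θ))

lemma yy_cont (r : ℝ) : Continuous (yy r) := by unfold yy; fun_prop

lemma mp_integrableOn (r : ℝ) {f : ℝ → ℝ} (hf : Measurable f) {C : ℝ} (hC : ∀ x, |f x| ≤ C) :
    IntegrableOn (fun θ => f θ * (2/π * (Real.sin θ ^ 2 / yy r θ))) (Ioo 0 π) := by
  have hm := (yy_cont r).measurable
  refine Measure.integrableOn_of_bounded (M := C * (2/π)) (by simp) (by fun_prop) ?_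
  refine Eventually.of_forall fun θ => ?_
  have h1 : 0 ≤ Real.sin θ ^ 2 / yy r θ := div_nonneg (sq_nonneg _) ((sq_nonneg _).trans (yy_ge r θ))
  have h2 := mp_bound r θ
  have hC0 : 0 ≤ C := (abs_nonneg _).trans (hC 0)
  rw [Real.norm_eq_abs, abs_mul, abs_of_nonneg (show 0 ≤ 2/π * (Real.sin θ ^ 2 / yy r θ) by positivity)]
  refine mul_le_mul (hC θ) ?_ (by positivity) hC0
  exact mul_le_of_le_one_right (by positivity) h2

lemma mp_integral {τ : ℝ} (hτ : 0 < τ) (f : ℝ → ℝ) :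
    ∫ x, f x ∂(MPm τ) = ∫ θ in Ioo 0 π, f (yy (√τ) θ) * (2/π * (Real.sin θ ^ 2 / yy (√τ) θ)) := by
  rw [MPm_eq, integral_withDensity_eq_integral_toReal_smul (mpd_meas τ).ennreal_ofReal (by simp)]
  simp only [ENNReal.toReal_ofReal (mpd_nonneg hτ _), smul_eq_mul]
  rw [← setIntegral_eq_integral_of_forall_compl_eq_zero (s := Ioo (tauM τ) (tauP τ))
    (fun x hx => by rw [mpd_zero hx, zero_mul])]
  have := integral_image_eq_integral_abs_deriv_smul measurableSet_Ioo
    (fun θ _ => (yy_deriv (√τ) θ).hasDerivWithinAt (s := Ioo 0 π)) (yy_inj (Real.sqrt_pos.2 hτ)) (fun x => mpd τ x * f x)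
  rw [yy_image (Real.sqrt_pos.2 hτ)] at this
  rw [tauM, tauP, this]
  refine setIntegral_congr_fun measurableSet_Ioo fun θ hθ => ?_
  simp only [smul_eq_mul]
  rw [← mul_assoc, mpd_yy hτ hθ, mul_comm]

lemma mpd_integrable {τ : ℝ} (hτ : 0 < τ) : Integrable (mpd τ) := by
  have h := (integrableOn_image_iff_integrableOn_abs_deriv_smul measurableSet_Ioo
    (fun θ _ => (yy_deriv (√τ) θ).hasDerivWithinAt (s := Ioo 0 π)) (yy_inj (Real.sqrt_pos.2 hτ)) (mpd τ)).2 (by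
      have := mp_integrableOn (√τ) (f := fun _ => 1) measurable_const (C := 1) (by simp)
      refine this.congr_fun (fun θ hθ => ?_) measurableSet_Ioo
      simp only [smul_eq_mul, one_mul]
      exact (mpd_yy hτ hθ).symm)
  rw [yy_image (Real.sqrt_pos.2 hτ)] at h
  rw [← integrableOn_iff_integrable_of_support_subset (s := Ioo (tauM τ) (tauP τ))]
  · exact h
  · intro x hx
    by_contra h; exact hx (mpd_zero h)

instance MPm_finite {τ : ℝ} [hτ : Fact (0 < τ)] : IsFiniteMeasure (MPm τ) := by
  rw [MPm_eq]
  exact isFiniteMeasure_withDensity_ofReal (mpd_integrable hτ.out).2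

lemma MPm_supp (τ : ℝ) : MPm τ (Icc (tauM τ) (tauP τ))ᶜ = 0 := by
  rw [MPm_eq, withDensity_apply _ measurableSet_Icc.compl]
  rw [setLIntegral_congr_fun (g := fun _ => 0) measurableSet_Icc.compl]
  · simp
  · intro x hx
    simp only
    rw [mpd_zero (fun h => hx (Ioo_subset_Icc_self h)), ENNReal.ofReal_zero]

lemma mp_int' {τ : ℝ} (hτ : 0 < τ) {f g : ℝ → ℝ}
    (h : ∀ θ ∈ Ioo 0 π, f (yy (√τ) θ) * (Real.sin θ ^ 2 / yy (√τ) θ) = g θ) :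
    ∫ x, f x ∂(MPm τ) = 2/π * ∫ θ in (0:ℝ)..π, g θ := by
  rw [mp_integral hτ, intervalIntegral.integral_of_le pi_pos.le, integral_Ioc_eq_integral_Ioo, ← integral_const_mul]
  refine setIntegral_congr_fun measurableSet_Ioo fun θ hθ => ?_
  beta_reduce
  rw [← h θ hθ]; ring

def zMP (τ : ℝ) (j : ℕ) : ℝ := if j % 2 = 1 then 1 else τ

lemma zMP_odd (τ : ℝ) (k : ℕ) : zMP τ (2*k+1) = 1 := by rw [zMP, if_pos (by omega)]
lemma zMP_even (τ : ℝ) (k : ℕ) : zMP τ (2*k+2) = τ := by rw [zMP, if_neg (by omega)]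

lemma QP_yy {τ : ℝ} (hτ : 0 < τ) (θ : ℝ) (k : ℕ) :
    (PP (zMP τ) k).eval (yy (√τ) θ) * Real.sin θ = (√τ)^k * (Real.sin ((k+1)*θ) + √τ * Real.sin (k*θ)) ∧
    (QQ (zMP τ) k).eval (yy (√τ) θ) * Real.sin θ = (√τ)^k * Real.sin ((k+1)*θ) := by
  induction k with
  | zero => simp [PP_zero, QQ_zero]
  | succ k ih =>
    have h1 : Real.sin ((((k+1:ℕ):ℝ)+1)*θ) = 2 * Real.cos θ * Real.sin ((k+1)*θ) - Real.sin (k*θ) := by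
      rw [show (((k+1:ℕ):ℝ)+1)*θ = (k+1)*θ + θ by push_cast; ring, show (k:ℝ)*θ = (k+1)*θ - θ by ring,
        Real.sin_add, Real.sin_sub]; ring
    have h2 := Real.sq_sqrt hτ.le
    have hP : (PP (zMP τ) (k+1)).eval (yy (√τ) θ) * Real.sin θ
        = (√τ)^(k+1) * (Real.sin ((((k+1:ℕ):ℝ)+1)*θ) + √τ * Real.sin (((k+1:ℕ):ℝ)*θ)) := by
      rw [PP_succ, zMP_odd, h1]
      simp only [eval_sub, eval_mul, eval_X, eval_C, one_mul]
      push_cast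
      rw [sub_mul, ih.1, mul_assoc, ih.2]; unfold yy; ring
    refine ⟨hP, ?_⟩
    rw [QQ_succ, zMP_even]
    simp only [eval_sub, eval_mul, eval_C]
    rw [sub_mul, hP, mul_assoc, ih.2]
    push_cast
    rw [← h2, Real.sqrt_sq (Real.sqrt_nonneg _)]; ring

lemma int_cos_nat (m : ℕ) (hm : m ≠ 0) : ∫ θ in (0:ℝ)..π, Real.cos (m*θ) = 0 := by
  have hm' : (m:ℝ) ≠ 0 := by exact_mod_cast hm
  rw [intervalIntegral.integral_comp_mul_left (fun x => Real.cos x) hm', integral_cos]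
  simp [Real.sin_nat_mul_pi]

lemma int_sin_sin (k l : ℕ) : ∫ θ in (0:ℝ)..π, Real.sin ((k+1)*θ) * Real.sin ((l+1)*θ) = if k = l then π/2 else 0 := by
  wlog h : l ≤ k generalizing k l
  · have := this l k (by omega)
    simp only [mul_comm (Real.sin (((k:ℝ)+1)*_))]
    rw [this]; simp only [eq_comm]
  have e : ∀ θ, Real.sin ((k+1)*θ) * Real.sin ((l+1)*θ) = (1/2) * Real.cos ((k-l:ℕ)*θ) - (1/2) * Real.cos ((k+l+2:ℕ)*θ) := by
    intro θ
    rw [show ((k-l:ℕ):ℝ)*θ = (k+1)*θ - (l+1)*θ by rw [Nat.cast_sub h]; ring,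
      show ((k+l+2:ℕ):ℝ)*θ = (k+1)*θ + (l+1)*θ by push_cast; ring, Real.cos_sub, Real.cos_add]; ring
  simp only [e]
  rw [intervalIntegral.integral_sub (by apply Continuous.intervalIntegrable; fun_prop) (by apply Continuous.intervalIntegrable; fun_prop),
    intervalIntegral.integral_const_mul, intervalIntegral.integral_const_mul, int_cos_nat (k+l+2) (by omega)]
  split_ifs with hkl
  · subst hkl; simp; ring
  · rw [int_cos_nat _ (by omega)]; simp

lemma mp_XQQ {τ : ℝ} (hτ : 0 < τ) (k l : ℕ) :
    ∫ x, x * (QQ (zMP τ) k).eval x * (QQ (zMP τ) l).eval x ∂(MPm τ) = if k = l then (√τ)^(k+l) else 0 := by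
  rw [mp_int' hτ (g := fun θ => (√τ)^(k+l) * (Real.sin ((k+1)*θ) * Real.sin ((l+1)*θ)))]
  · rw [intervalIntegral.integral_const_mul, int_sin_sin]
    split_ifs
    · field_simp
    · simp
  · intro θ hθ
    have h1 := (QP_yy hτ θ k).2
    have h2 := (QP_yy hτ θ l).2
    have hy := (yy_pos (√τ) hθ).ne'
    rw [pow_add, show (√τ)^k * (√τ)^l * (Real.sin ((k+1)*θ) * Real.sin ((l+1)*θ)) =
      ((√τ)^k * Real.sin ((k+1)*θ)) * ((√τ)^l * Real.sin ((l+1)*θ)) by ring, ← h1, ← h2]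
    field_simp

lemma mp_poly {τ : ℝ} (hτ : 0 < τ) (p : ℝ[X]) : Integrable (fun x => p.eval x) (MPm τ) := by
  have := Fact.mk hτ
  exact integrable_of_contOn (MPm_supp τ) p.continuous.continuousOn

def LMP {τ : ℝ} (hτ : 0 < τ) := Lm (MPm τ) (mp_poly hτ)

lemma LMP_XQQ {τ : ℝ} (hτ : 0 < τ) (k l : ℕ) :
    LMP hτ (X * QQ (zMP τ) k * QQ (zMP τ) l) = if k = l then (√τ)^(k+l) else 0 := by
  rw [LMP, Lm_apply, ← mp_XQQ hτ]; simp

lemma sin_nat_le (k : ℕ) (θ : ℝ) : |Real.sin (k*θ)| ≤ k * |Real.sin θ| := by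
  induction k with
  | zero => simp
  | succ k ih =>
    push_cast
    rw [add_mul, one_mul, Real.sin_add]
    calc _ ≤ |Real.sin (k*θ) * Real.cos θ| + |Real.cos (k*θ) * Real.sin θ| := abs_add_le _ _
      _ ≤ |Real.sin (k*θ)| * 1 + 1 * |Real.sin θ| := by
        rw [abs_mul, abs_mul]; gcongr <;> exact Real.abs_cos_le_one _
      _ ≤ _ := by linarith

lemma LMP_P_succ {τ : ℝ} (hτ : 0 < τ) (k : ℕ) :
    LMP hτ (PP (zMP τ) (k+1)) = (if k = 0 then 1 else 0) - LMP hτ (PP (zMP τ) k) := by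
  have h := LMP_XQQ hτ k 0
  rw [QQ_zero, mul_one] at h
  rw [PP_succ, zMP_odd, map_sub, h, C_1, one_mul]
  congr 1
  split_ifs with h
  · simp [h]
  · rfl

lemma LMP_P_bound {τ : ℝ} (hτ : 0 < τ) (k : ℕ) :
    |LMP hτ (PP (zMP τ) k)| ≤ (√τ)^k * ((k+1) + √τ*k) * 2 := by
  rw [LMP, Lm_apply, mp_integral hτ, ← Real.norm_eq_abs]
  have hr := Real.sqrt_nonneg τ
  refine (norm_setIntegral_le_of_norm_le_const (C := (√τ)^k * ((k+1) + √τ*k) * (2/π)) (by simp) fun θ hθ => ?_).trans ?_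
  · have hs := Real.sin_pos_of_mem_Ioo hθ
    have hy := yy_pos (√τ) hθ
    have h1 : |(PP (zMP τ) k).eval (yy (√τ) θ)| ≤ (√τ)^k * ((k+1) + √τ*k) := by
      have h := congrArg abs (QP_yy hτ θ k).1
      rw [abs_mul, abs_mul, abs_of_pos hs, abs_of_nonneg (pow_nonneg hr k)] at h
      refine le_of_mul_le_mul_right ?_ hs
      rw [h, mul_assoc]
      refine mul_le_mul_of_nonneg_left ?_ (pow_nonneg hr k)
      have h2 := sin_nat_le (k+1) θ
      have h3 := sin_nat_le k θ
      rw [abs_of_pos hs] at h2 h3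
      push_cast at h2
      calc _ ≤ |Real.sin ((k+1)*θ)| + |√τ * Real.sin (k*θ)| := abs_add_le _ _
        _ ≤ (k+1)*Real.sin θ + √τ * (k * Real.sin θ) := by
          rw [abs_mul, abs_of_nonneg hr]; gcongr
        _ = _ := by ring
    rw [Real.norm_eq_abs, abs_mul, abs_of_nonneg (show 0 ≤ 2/π * (Real.sin θ ^ 2 / yy (√τ) θ) by positivity)]
    refine mul_le_mul h1 ?_ (by positivity) (by positivity)
    exact mul_le_of_le_one_right (by positivity) (mp_bound _ _)
  · simp [measureReal_def, pi_pos.le]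
    rw [mul_assoc, div_mul_cancel₀ _ pi_pos.ne']

lemma LMP_one {τ : ℝ} (hτ : 0 < τ) (hτ1 : τ ≤ 1) : LMP hτ 1 = 1 := by
  rcases hτ1.lt_or_eq with h | rfl
  · have key : ∀ k : ℕ, |LMP hτ (PP (zMP τ) (k+1))| = |1 - LMP hτ 1| := by
      intro k
      induction k with
      | zero => rw [LMP_P_succ, if_pos rfl, PP_zero]
      | succ k ih => rw [LMP_P_succ, if_neg (by omega), zero_sub, abs_neg, ih]
    have hlim : Tendsto (fun k : ℕ => (√τ)^(k+1) * (((k+1:ℕ):ℝ)+1 + √τ*((k+1:ℕ):ℝ)) * 2) atTop (𝓝 0) := by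
      have h1 : √τ < 1 := by rw [Real.sqrt_lt' one_pos]; simpa
      have h2 := tendsto_self_mul_const_pow_of_lt_one (Real.sqrt_nonneg τ) h1
      have h3 := tendsto_pow_atTop_nhds_zero_of_lt_one (Real.sqrt_nonneg τ) h1
      have h4 := ((h2.mul_const (1+√τ)).add h3).mul_const 2
      rw [zero_mul, zero_add, zero_mul] at h4
      refine (h4.comp (tendsto_add_atTop_nat 1)).congr fun k => ?_
      simp; ring
    have := ge_of_tendsto' hlim fun k => (key k).symm.le.trans (LMP_P_bound hτ (k+1))
    have := abs_eq_zero.1 (le_antisymm this (abs_nonneg _))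
    linarith
  · rw [LMP, Lm_apply, mp_int' hτ (g := fun θ => (1 - Real.cos θ)/2)]
    · rw [intervalIntegral.integral_div, intervalIntegral.integral_sub (by simp) (by apply Continuous.intervalIntegrable; fun_prop), integral_cos]
      simp
    · intro θ hθ
      have hy := yy_pos 1 hθ
      have h := Real.sin_sq_add_cos_sq θ
      simp only [Real.sqrt_one, eval_one, one_mul] 
      rw [div_eq_iff hy.ne']; unfold yy; linear_combination h

lemma MPm_prob {τ : ℝ} (hτ : 0 < τ) (hτ1 : τ ≤ 1) : IsProbabilityMeasure (MPm τ) := by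
  have := Fact.mk hτ
  have h := LMP_one hτ hτ1
  rw [LMP, Lm_apply] at h
  simp [measureReal_def] at h
  exact ⟨by rwa [ENNReal.toReal_eq_one_iff] at h⟩

lemma LMP_P {τ : ℝ} (hτ : 0 < τ) (hτ1 : τ ≤ 1) (k : ℕ) : LMP hτ (PP (zMP τ) (k+1)) = 0 := by
  induction k with
  | zero => rw [LMP_P_succ, if_pos rfl, PP_zero, LMP_one hτ hτ1, sub_self]
  | succ k ih => rw [LMP_P_succ, if_neg (by omega), ih, sub_self]

lemma LMP_orth {τ : ℝ} (hτ : 0 < τ) (hτ1 : τ ≤ 1) (n : ℕ) : OrthTo (LMP hτ) (zMP τ) n := by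
  intro k _
  refine orth_of_pairs _ _ _ fun l hl => ?_
  obtain ⟨k, rfl⟩ : ∃ k', k = k'+1 := ⟨k-1, by omega⟩
  induction l with
  | zero => rw [PP_zero, mul_one, LMP_P hτ hτ1]
  | succ l ih =>
    have e : PP (zMP τ) (k+1) * PP (zMP τ) (l+1) = X * QQ (zMP τ) (k+1) * QQ (zMP τ) l +
       C τ * (X * QQ (zMP τ) k * QQ (zMP τ) l) - PP (zMP τ) (k+1) * PP (zMP τ) l := by
      rw [PP_succ _ l, zMP_odd, QQ_succ, zMP_even, C_1]; ring
    rw [e, map_sub, map_add, L_C_mul, LMP_XQQ, LMP_XQQ, ih (by omega), if_neg (by omega), if_neg (by omega)]; ring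

lemma hasSum_of_eq {f g : ℕ → ℝ} {a b : ℝ} (h : HasSum f a) (hf : ∀ k, g k = f k) (hab : b = a) : HasSum g b := by
  rw [hab, funext hf]; exact h

lemma LMP_Q {τ : ℝ} (hτ : 0 < τ) (hτ1 : τ ≤ 1) (k : ℕ) : LMP hτ (QQ (zMP τ) k) = (-τ)^k := by
  induction k with
  | zero => rw [QQ_zero, LMP_one hτ hτ1, pow_zero]
  | succ k ih => rw [QQ_succ, zMP_even, map_sub, L_C_mul, LMP_P hτ hτ1, ih]; ring

def cc (τ : ℝ) (k : ℕ) : ℝ := ∫ θ in Ioo 0 π, Real.cos (k*θ) * (2/π * (Real.sin θ ^ 2 / yy (√τ) θ))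

lemma cc_poly {τ : ℝ} (hτ : 0 < τ) {p : ℝ[X]} {c : ℝ} {k : ℕ}
    (h : ∀ θ, p.eval (yy (√τ) θ) * Real.sin θ = c * Real.cos (k*θ) * Real.sin θ) : c * cc τ k = LMP hτ p := by
  rw [LMP, Lm_apply, mp_integral hτ, cc, ← integral_const_mul]
  refine setIntegral_congr_fun measurableSet_Ioo fun θ hθ => ?_
  have h1 := mul_right_cancel₀ (Real.sin_pos_of_mem_Ioo hθ).ne' (h θ)
  simp only [h1]; ring

lemma cc_eq {τ : ℝ} (hτ : 0 < τ) (hτ1 : τ ≤ 1) (k : ℕ) :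
    2 * cc τ (k+2) = (-√τ)^(k+2) * (1 - 1/τ) := by
  have hr := Real.sqrt_pos.2 hτ
  have h := cc_poly hτ (p := QQ (zMP τ) (k+2) - C τ * QQ (zMP τ) k) (c := 2 * (√τ)^(k+2)) (k := k+2) (fun θ => by
    have h1 := (QP_yy hτ θ (k+2)).2
    have h2 := (QP_yy hτ θ k).2
    rw [eval_sub, eval_mul, eval_C, sub_mul, h1, mul_assoc, h2,
      show (((k+2:ℕ):ℝ)+1)*θ = (k+2:ℕ)*θ + θ by ring, show ((k:ℝ)+1)*θ = (k+2:ℕ)*θ - θ by push_cast; ring,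
      Real.sin_add, Real.sin_sub]
    have := Real.sq_sqrt hτ.le
    generalize √τ = s at *
    subst this
    ring)
  rw [map_sub, L_C_mul, LMP_Q hτ hτ1, LMP_Q hτ hτ1] at h
  have e : (-τ)^(k+2) = (-√τ)^(k+2) * (√τ)^(k+2) := by
    rw [← mul_pow, neg_mul, Real.mul_self_sqrt hτ.le]
  have e2 : τ * (-τ)^k = (-τ)^(k+2) / τ := by field_simp; ring
  rw [e2, e] at h
  refine mul_right_cancel₀ (pow_pos hr (k+2)).ne' ?_
  linear_combination h

lemma cc_one {τ : ℝ} (hτ : 0 < τ) (hτ1 : τ ≤ 1) : 2 * cc τ 1 = -√τ := by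
  have hr := Real.sqrt_pos.2 hτ
  have h := cc_poly hτ (p := QQ (zMP τ) 1) (c := 2 * (√τ)) (k := 1) (fun θ => by
    have h1 := (QP_yy hτ θ 1).2
    rw [h1]; norm_num; rw [Real.sin_two_mul]; ring)
  rw [LMP_Q hτ hτ1] at h
  refine mul_left_cancel₀ hr.ne' ?_
  have := Real.mul_self_sqrt hτ.le
  linear_combination h + this

lemma log_series {r : ℝ} (hr : |r| < 1) (θ : ℝ) :
    HasSum (fun k : ℕ => -2 * r^k / k * Real.cos (k*θ)) (Real.log (1 - 2*r*Real.cos θ + r^2)) := by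
  have hz : ‖(r:ℂ) * Complex.exp (θ * Complex.I)‖ < 1 := by
    rw [norm_mul, Complex.norm_exp_ofReal_mul_I, mul_one, Complex.norm_real]; exact hr
  have h := (Complex.hasSum_re (Complex.hasSum_taylorSeries_neg_log hz)).mul_left (-2)
  refine hasSum_of_eq h (fun k => ?_) ?_
  · have e : ((r:ℂ) * Complex.exp (θ * Complex.I))^k / (k:ℂ) = ((r^k / k : ℝ) : ℂ) * Complex.exp ((k*θ:ℝ) * Complex.I) := by
      rw [mul_pow, ← Complex.exp_nat_mul]; push_cast
      rw [show (k:ℂ) * (θ * Complex.I) = k * θ * Complex.I by ring]; ring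
    rw [e, Complex.re_ofReal_mul, Complex.exp_ofReal_mul_I_re]; ring
  · rw [Complex.neg_re, Complex.log_re, neg_mul_neg]
    have : (1 - 2*r*Real.cos θ + r^2) = ‖1 - (r:ℂ) * Complex.exp (θ * Complex.I)‖^2 := by
      rw [← Complex.normSq_eq_norm_sq, Complex.normSq_apply]
      simp only [Complex.sub_re, Complex.sub_im, Complex.re_ofReal_mul, Complex.im_ofReal_mul, Complex.exp_ofReal_mul_I_re,
        Complex.exp_ofReal_mul_I_im, Complex.one_re, Complex.one_im]
      linear_combination (r^2) * (-(Real.sin_sq_add_cos_sq θ))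
    rw [this, Real.log_pow]; norm_num

lemma int_log {τ : ℝ} (hτ : 0 < τ) (hτ1 : τ ≤ 1) {r : ℝ} (hr : |r| < 1) :
    ∫ θ in Ioo 0 π, Real.log (1 - 2*r*Real.cos θ + r^2) * (2/π * (Real.sin θ ^ 2 / yy (√τ) θ)) =
      r/√τ + (1 - 1/τ) * Real.log (1 + √τ * r) := by
  have hs := Real.sqrt_pos.2 hτ
  have hb : ∀ k : ℕ, ∀ θ, |(-2 * r^k / k) * Real.cos (k*θ)| ≤ 2*|r|^k := by
    intro k θ
    rw [abs_mul, abs_div, abs_mul, abs_pow]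
    refine (mul_le_of_le_one_right (by positivity) (Real.abs_cos_le_one _)).trans ?_
    rw [abs_neg, abs_two, Nat.abs_cast]
    rcases k with _ | k
    · simp
    · exact div_le_self (by positivity) (by simp)
  have hint : ∀ k : ℕ, IntegrableOn (fun θ => (-2 * r^k / k * Real.cos (k*θ)) * (2/π * (Real.sin θ ^ 2 / yy (√τ) θ))) (Ioo 0 π) :=
    fun k => mp_integrableOn _ (by fun_prop) (hb k)
  have h := hasSum_integral_of_summable_integral_norm hint (by
    refine Summable.of_nonneg_of_le (f := fun k => 2*|r|^k*2) (fun k => integral_nonneg fun _ => norm_nonneg _) (fun k => ?_)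
      ((summable_geometric_of_lt_one (abs_nonneg r) hr).mul_left 2 |>.mul_right 2)
    refine (le_norm_self _).trans ((norm_setIntegral_le_of_norm_le_const (C := 2*|r|^k*(2/π)) (by simp) fun θ hθ => ?_).trans ?_)
    · have hy := yy_pos (√τ) hθ
      rw [norm_norm, Real.norm_eq_abs, abs_mul, abs_of_nonneg (show 0 ≤ 2/π * (Real.sin θ ^ 2 / yy (√τ) θ) by positivity)]
      refine mul_le_mul (hb k θ) ?_ (by positivity) (by positivity)
      exact mul_le_of_le_one_right (by positivity) (mp_bound _ _)
    · simp [measureReal_def, pi_pos.le]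
      rw [mul_assoc, div_mul_cancel₀ _ pi_pos.ne'])
  have e1 : ∀ θ, ∑' k : ℕ, (-2 * r^k / k * Real.cos (k*θ)) * (2/π * (Real.sin θ ^ 2 / yy (√τ) θ)) =
      Real.log (1 - 2*r*Real.cos θ + r^2) * (2/π * (Real.sin θ ^ 2 / yy (√τ) θ)) := fun θ =>
    ((log_series hr θ).mul_right _).tsum_eq
  simp only [e1] at h
  refine h.unique ?_
  have hq : |√τ * r| < 1 := by
    rw [abs_mul, abs_of_pos hs]
    have : √τ ≤ 1 := Real.sqrt_le_one.2 hτ1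
    nlinarith [abs_nonneg r]
  have h2 : HasSum (fun k : ℕ => (1 - 1/τ) * (-((-(√τ * r))^k / k))) ((1 - 1/τ) * Real.log (1 + √τ * r)) := by
    refine HasSum.mul_left _ ?_
    have h3 := log_series (r := -(√τ * r)) (by rwa [abs_neg]) 0
    have h4 := h3.mul_left (1/2)
    refine hasSum_of_eq h4 (fun k => ?_) ?_
    · simp; ring
    · have : (1 - 2 * -(√τ*r) * Real.cos 0 + (-(√τ*r))^2) = (1 + √τ*r)^2 := by rw [Real.cos_zero]; ring
      rw [this, Real.log_pow]; push_cast; ring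
  have h5 := (hasSum_ite_eq (1:ℕ) (r/√τ)).add h2
  refine hasSum_of_eq h5 (fun k => ?_) rfl
  rw [show (fun θ => (-2 * r^k / k * Real.cos (k*θ)) * (2/π * (Real.sin θ ^ 2 / yy (√τ) θ))) =
    fun θ => (-2 * r^k / k) * (Real.cos (k*θ) * (2/π * (Real.sin θ ^ 2 / yy (√τ) θ))) by ext; ring, integral_const_mul]
  change (-2 * r^k / k) * cc τ k = _
  have hsq := Real.mul_self_sqrt hτ.le
  rcases k with _ | _ | k
  · simp
  · have := cc_one hτ hτ1
    rw [if_pos rfl]; push_cast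
    rw [show -2 * r^1 / 1 * cc τ 1 = -r * (2 * cc τ 1) by ring, this]
    have : 1/τ = 1/√τ/√τ := by rw [div_div, hsq]
    rw [this]
    field_simp; ring
  · have := cc_eq hτ hτ1 k
    rw [if_neg (by omega), zero_add, show -2 * r^(k+1+1) / ((k+1+1:ℕ):ℝ) * cc τ (k+1+1) = -(r^(k+2)) / ((k+1+1:ℕ):ℝ) * (2 * cc τ (k+2)) by ring_nf, this]
    rw [show -(√τ * r) = (-√τ) * r by ring, mul_pow]; ring

/-- logarithmic potential -/
def UU (τ x : ℝ) : ℝ := ∫ y, Real.log |x - y| ∂(MPm τ)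

def xx (ρ r : ℝ) : ℝ := (1 + ρ*r) * (1 + ρ/r)

lemma UU_xx {τ : ℝ} (hτ : 0 < τ) (hτ1 : τ ≤ 1) {r : ℝ} (hr : |r| < 1) (hr0 : r ≠ 0) :
    UU τ (xx (√τ) r) = Real.log (√τ) - Real.log r + r/√τ + (1 - 1/τ) * Real.log (1 + √τ * r) := by
  have hs := Real.sqrt_pos.2 hτ
  rw [UU, mp_integral hτ, add_assoc, ← int_log hτ hτ1 hr]
  have hone : ∫ θ in Ioo 0 π, (1:ℝ) * (2/π * (Real.sin θ ^ 2 / yy (√τ) θ)) = 1 := by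
    have := LMP_one hτ hτ1
    rw [LMP, Lm_apply, mp_integral hτ] at this
    simpa using this
  have hpos : ∀ θ, 0 < 1 - 2*r*Real.cos θ + r^2 := fun θ => by
    have h1 := Real.abs_cos_le_one θ
    have h2 : r * Real.cos θ ≤ |r| := (le_abs_self _).trans (by rw [abs_mul]; exact mul_le_of_le_one_right (abs_nonneg _) h1)
    nlinarith [sq_abs r]
  rw [← mul_one (Real.log (√τ) - Real.log r), ← congrArg (fun t => (Real.log (√τ) - Real.log r) * t) hone, ← integral_const_mul, ← integral_add]
  · refine setIntegral_congr_fun measurableSet_Ioo fun θ hθ => ?_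
    have e : xx (√τ) r - yy (√τ) θ = √τ / r * (1 - 2*r*Real.cos θ + r^2) := by
      unfold xx yy; field_simp; ring
    simp only [e]
    rw [Real.log_abs, Real.log_mul (by positivity) (hpos θ).ne', Real.log_div hs.ne' hr0]; ring
  · exact (mp_integrableOn _ (f := fun _ => 1) measurable_const (C := 1) (by simp)).const_mul _
  · have hcont : Continuous fun θ => Real.log (1 - 2*r*Real.cos θ + r^2) :=
      Continuous.log (by fun_prop) fun θ => (hpos θ).ne'
    refine mp_integrableOn _ hcont.measurable (C := max |Real.log ((1-|r|)^2)| |Real.log ((1+|r|)^2)|) fun θ => ?_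
    have h1 := Real.abs_cos_le_one θ
    have h2 : |r * Real.cos θ| ≤ |r| := by rw [abs_mul]; exact mul_le_of_le_one_right (abs_nonneg _) h1
    rw [abs_le] at h2
    have hr' : 0 < 1 - |r| := by linarith
    refine abs_le_max_abs_abs ?_ ?_
    · exact Real.log_le_log (by positivity) (by nlinarith [sq_abs r])
    · exact Real.log_le_log (hpos θ) (by nlinarith [sq_abs r])

def HH (τ r : ℝ) : ℝ := (1/r - r)/√τ + 2*Real.log r +
  ((1-τ)/τ) * (Real.log (1 + √τ*r) - Real.log (r + √τ) + Real.log r)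

lemma HH_deriv {τ s : ℝ} (hτ : 0 < τ) (hs : s ≠ 0) (h1 : 1 + √τ*s ≠ 0) (h2 : s + √τ ≠ 0) :
    HasDerivAt (HH τ) ((1/s - s) * (1 - 1/s^2) / xx (√τ) s) s := by
  have hr := (Real.sqrt_pos.2 hτ).ne'
  have hsq := Real.sq_sqrt hτ.le
  have d1 := (((hasDerivAt_inv hs).sub (hasDerivAt_id s)).div_const (√τ)).add ((Real.hasDerivAt_log hs).const_mul 2)
  have d2 := (((((hasDerivAt_id s).const_mul (√τ)).const_add 1).log h1).sub (((hasDerivAt_id s).add_const (√τ)).log h2)).add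
    (Real.hasDerivAt_log hs)
  have d3 := d1.add (d2.const_mul ((1-τ)/τ))
  have d4 : HasDerivAt (HH τ) _ s := d3.congr_of_eventuallyEq (Eventually.of_forall fun r => by
    simp [HH])
  refine d4.congr_deriv ?_
  unfold xx
  generalize √τ = ρ at *
  subst hsq
  simp only [id]
  rw [show 1 + ρ/s = (s + ρ)/s by field_simp]
  generalize hu : 1 + ρ*s = u at *
  generalize hv : s + ρ = v at *
  clear d1 d2 d3 d4
  field_simp
  subst hu hv
  ring

def gMP (τ t : ℝ) : ℝ := Real.sqrt ((t - tauP τ) * (t - tauM τ)) / (τ*t)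

lemma xx_one (τ : ℝ) : xx (√τ) 1 = tauP τ := by unfold xx tauP; ring
lemma xx_neg_one (τ : ℝ) : xx (√τ) (-1) = tauM τ := by unfold xx tauM; ring

lemma xx_prod {τ s : ℝ} (hs : s ≠ 0) : (xx (√τ) s - tauP τ) * (xx (√τ) s - tauM τ) = (√τ * (1/s - s))^2 := by
  unfold xx tauP tauM; field_simp; ring

lemma xx_deriv {ρ s : ℝ} (hs : s ≠ 0) : HasDerivAt (xx ρ) (ρ * (1 - 1/s^2)) s := by
  have d := (((hasDerivAt_id s).const_mul ρ).const_add 1).mul (((hasDerivAt_inv hs).const_mul ρ).const_add 1)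
  have e : xx ρ = fun s => (1 + ρ*s) * (1 + ρ * s⁻¹) := by ext; unfold xx; rw [div_eq_mul_inv]
  rw [e]
  refine d.congr_deriv ?_
  simp only [id]; field_simp; ring

/-- substitution -/
lemma gMP_int {τ : ℝ} (hτ : 0 < τ) {a b σ : ℝ} (hσ : σ^2 = 1) (h0 : ∀ s ∈ uIcc a b, s ≠ 0 ∧ 0 < 1 + √τ*s ∧ 0 < xx (√τ) s ∧
     0 ≤ σ * (1/s - s)) :
    ∫ t in (xx (√τ) a)..(xx (√τ) b), gMP τ t = σ * (HH τ b - HH τ a) := by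
  have hr := Real.sqrt_pos.2 hτ
  have hsq := Real.sq_sqrt hτ.le
  have h2 : ∀ s ∈ uIcc a b, s + √τ ≠ 0 := fun s hs h => by
    obtain ⟨h1, -, h3, -⟩ := h0 s hs
    rw [xx, show √τ = -s by linarith, neg_div, div_self h1] at h3; simp at h3
  have hI : ContinuousOn (fun s => (1/s - s) * (1 - 1/s^2) / xx (√τ) s) (uIcc a b) := by
    have hx : ContinuousOn (xx (√τ)) (uIcc a b) := fun s hs => (xx_deriv (h0 s hs).1).continuousAt.continuousWithinAt
    have hinv : ContinuousOn (fun s : ℝ => 1/s) (uIcc a b) := continuousOn_const.div continuousOn_id fun s hs => (h0 s hs).1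
    have hinv2 : ContinuousOn (fun s : ℝ => 1/s^2) (uIcc a b) := continuousOn_const.div (continuousOn_id.pow 2) fun s hs => pow_ne_zero 2 (h0 s hs).1
    exact ((hinv.sub continuousOn_id).mul (continuousOn_const.sub hinv2)).div hx fun s hs => (h0 s hs).2.2.1.ne'
  rw [← intervalIntegral.integral_comp_mul_deriv' (fun s hs => xx_deriv (h0 s hs).1)]
  · have e : ∀ s ∈ uIcc a b, (gMP τ ∘ xx (√τ)) s * (√τ * (1 - 1/s^2)) = σ * ((1/s - s) * (1 - 1/s^2) / xx (√τ) s) := by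
      intro s hs
      obtain ⟨h1, h2, h3, h4⟩ := h0 s hs
      rw [Function.comp, gMP, xx_prod h1, show (√τ * (1/s - s))^2 = (√τ * (σ * (1/s-s)))^2 by rw [mul_pow, mul_pow, mul_pow, hσ]; ring,
        Real.sqrt_sq (mul_nonneg hr.le h4)]
      generalize √τ = ρ at *
      subst hsq
      field_simp
    rw [intervalIntegral.integral_congr e, intervalIntegral.integral_const_mul,
      intervalIntegral.integral_eq_sub_of_hasDerivAt (fun s hs => HH_deriv hτ (h0 s hs).1 (h0 s hs).2.1.ne' (h2 s hs)) hI.intervalIntegrable]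
  · exact continuousOn_const.mul (continuousOn_const.sub (continuousOn_const.div (continuousOn_id.pow 2) fun s hs => pow_ne_zero 2 (h0 s hs).1))
  · unfold gMP
    refine ContinuousOn.div (by fun_prop) (by fun_prop) ?_
    rintro _ ⟨s, hs, rfl⟩
    exact (mul_pos hτ (h0 s hs).2.2.1).ne'

def FF (τ x : ℝ) : ℝ := (x - (1-τ) * Real.log x)/τ - 2 * UU τ x - (1/τ + 1 - Real.log τ)

lemma FF_eq {τ : ℝ} (hτ : 0 < τ) (hτ1 : τ ≤ 1) {r : ℝ} (hr : |r| < 1) (hr0 : r ≠ 0) (h1 : 1 + √τ*r ≠ 0) (h2 : r + √τ ≠ 0) :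
    FF τ (xx (√τ) r) = HH τ r := by
  have hs := Real.sqrt_pos.2 hτ
  have hsq := Real.sq_sqrt hτ.le
  have e : xx (√τ) r = (1 + √τ*r) * (r + √τ) / r := by unfold xx; field_simp
  have e2 : Real.log τ = 2 * Real.log (√τ) := by rw [Real.log_sqrt hτ.le]; ring
  have e3 : Real.log (xx (√τ) r) = Real.log (1 + √τ*r) + Real.log (r + √τ) - Real.log r := by
    rw [e, Real.log_div (by positivity) hr0, Real.log_mul h1 h2]
  rw [FF, UU_xx hτ hτ1 hr hr0, e3, e2, e, HH]
  generalize Real.log (1 + √τ*r) = l1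
  generalize Real.log (r + √τ) = l2
  generalize Real.log r = l3
  generalize Real.log (√τ) = l4
  generalize √τ = ρ at *
  subst hsq
  field_simp
  ring

/-- inverse Joukowski -/
lemma jouk {s : ℝ} (hs : 2 < s) : ∃ r, 0 < r ∧ r < 1 ∧ r + 1/r = s := by
  have h1 : 0 < s^2 - 4 := by nlinarith
  have h2 := Real.sq_sqrt h1.le
  have h3 := Real.sqrt_pos.2 h1
  have h4 : √(s^2-4) < s := by rw [Real.sqrt_lt' (by linarith)]; linarith
  refine ⟨(s - √(s^2-4))/2, by linarith, ?_, ?_⟩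
  · have : s - 2 < √(s^2-4) := Real.lt_sqrt_of_sq_lt (by nlinarith)
    linarith
  · have : s - √(s^2-4) ≠ 0 := by linarith
    field_simp; nlinarith

lemma FMP_eq_P {τ : ℝ} (hτ : 0 < τ) (hτ1 : τ ≤ 1) {x : ℝ} (hx : tauP τ < x) :
    FMP τ x = ENNReal.ofReal (FF τ x) := by
  have hs := Real.sqrt_pos.2 hτ
  obtain ⟨r, hr0, hr1, hr⟩ := jouk (s := (x - 1 - √τ^2)/√τ) (by rw [lt_div_iff₀ hs]; unfold tauP at hx; nlinarith)
  have hx' : x = xx (√τ) r := by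
    rw [eq_div_iff hs.ne'] at hr
    unfold xx; rw [div_eq_mul_one_div √τ r]; field_simp at hr ⊢; linarith
  rw [FMP, if_pos hx.le, hx', FF_eq hτ hτ1 (by rwa [abs_of_pos hr0]) hr0.ne' (by positivity) (by positivity), ← xx_one τ]
  have := gMP_int hτ (a := 1) (b := r) (σ := 1) (by norm_num) (fun s hs' => by
    rw [uIcc_of_ge hr1.le] at hs'
    have : 0 < s := lt_of_lt_of_le hr0 hs'.1
    refine ⟨this.ne', by positivity, by unfold xx; positivity, ?_⟩
    rw [one_mul, sub_nonneg, le_div_iff₀ this]; nlinarith [hs'.2])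
  unfold gMP at this
  rw [xx_one] at this ⊢
  rw [this]
  congr 1
  simp [HH, add_comm]

lemma FMP_eq_M {τ : ℝ} (hτ : 0 < τ) (hτ1 : τ ≤ 1) {x : ℝ} (hx0 : 0 < x) (hx : x < tauM τ) :
    FMP τ x = ENNReal.ofReal (FF τ x) := by
  have hs := Real.sqrt_pos.2 hτ
  have hs1 : √τ < 1 := by
    refine lt_of_le_of_ne (Real.sqrt_le_one.2 hτ1) fun h => ?_
    rw [tauM, h] at hx; norm_num at hx; linarith
  obtain ⟨r, hr0, hr1, hr⟩ := jouk (s := -(x - 1 - √τ^2)/√τ) (by rw [lt_div_iff₀ hs]; unfold tauM at hx; nlinarith)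
  have hx' : x = xx (√τ) (-r) := by
    rw [eq_div_iff hs.ne'] at hr
    unfold xx; field_simp at hr ⊢; linarith
  have hr2 : √τ < r := by
    rw [hx', xx] at hx0
    have h1 : 0 < 1 + √τ * -r := by nlinarith
    have h2 := (mul_pos_iff_of_pos_left h1).1 hx0
    rw [div_neg, ← sub_eq_add_neg, sub_pos, div_lt_one hr0] at h2; exact h2
  have hMP : tauM τ < tauP τ := by unfold tauM tauP; nlinarith
  rw [FMP, if_neg (by linarith), if_pos ⟨hx0, hx.le⟩, hx', FF_eq hτ hτ1 (by rwa [abs_neg, abs_of_pos hr0]) (by linarith) (by nlinarith) (by linarith), ← xx_neg_one τ]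
  have := gMP_int hτ (a := -r) (b := -1) (σ := -1) (by norm_num) (fun s hs' => by
    rw [uIcc_of_ge (by linarith)] at hs'
    have h1 : s < 0 := by linarith [hs'.2]
    have h2 : 0 < 1 + √τ * s := by nlinarith [hs'.1]
    refine ⟨h1.ne, h2, mul_pos h2 ?_, ?_⟩
    · rw [← div_self h1.ne, ← add_div]; exact div_pos_of_neg_of_neg (by linarith [hs'.2]) h1
    · rw [neg_one_mul, neg_sub, sub_nonneg, div_le_iff_of_neg h1]; nlinarith [hs'.1])
  unfold gMP at this
  rw [xx_neg_one] at this ⊢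
  rw [this]
  congr 1
  have e : HH τ (-1) = 0 := by
    rw [HH, show (-1:ℝ) + √τ = -(1 + √τ * -1) by ring, Real.log_neg_eq_log, Real.log_neg_eq_log, Real.log_one]; ring
  rw [e]; ring

lemma gMP_nonneg {τ t : ℝ} (hτ : 0 < τ) (ht : 0 ≤ t) : 0 ≤ gMP τ t := div_nonneg (Real.sqrt_nonneg _) (by positivity)

lemma gMP_cont {τ a b : ℝ} (hτ : 0 < τ) (h : ∀ t ∈ uIcc a b, 0 < t) : ContinuousOn (gMP τ) (uIcc a b) := by
  unfold gMP
  exact ContinuousOn.div (by fun_prop) (by fun_prop) fun t ht => (mul_pos hτ (h t ht)).ne'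

lemma tauP_pos {τ : ℝ} : 0 < tauP τ := by unfold tauP; have := Real.sqrt_nonneg τ; positivity

lemma FMP_mono_P {τ : ℝ} (hτ : 0 < τ) {a x : ℝ} (ha : tauP τ < a) (hx : a ≤ x) : FMP τ a ≤ FMP τ x ∧ 0 < FMP τ a := by
  have h0 := tauP_pos (τ := τ)
  rw [FMP, if_pos ha.le, FMP, if_pos (ha.le.trans hx)]
  constructor
  · refine ENNReal.ofReal_le_ofReal (intervalIntegral.integral_mono_interval le_rfl ha.le hx ?_ ?_)
    · refine (ae_restrict_mem measurableSet_Ioc).mono fun t ht => gMP_nonneg hτ (h0.trans ht.1).le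
    · refine (gMP_cont hτ fun t ht => ?_).intervalIntegrable
      rw [uIcc_of_le (by linarith)] at ht; exact h0.trans_le ht.1
  · rw [ENNReal.ofReal_pos]
    refine intervalIntegral.intervalIntegral_pos_of_pos_on ?_ ?_ ha
    · refine (gMP_cont hτ fun t ht => ?_).intervalIntegrable
      rw [uIcc_of_le (by linarith)] at ht; exact h0.trans_le ht.1
    · intro t ht
      have hle : tauM τ ≤ tauP τ := by unfold tauM tauP; nlinarith [Real.sqrt_nonneg τ]
      have : 0 < t := h0.trans ht.1
      refine div_pos (Real.sqrt_pos.2 (mul_pos (by linarith [ht.1]) (by linarith [ht.1]))) (by positivity)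

lemma FMP_top {τ x : ℝ} (hx : x ≤ 0) : FMP τ x = ⊤ := by
  rw [FMP, if_neg (by have := tauP_pos (τ := τ); linarith), if_neg (by intro h; linarith [h.1])]

lemma FMP_mono_M {τ : ℝ} (hτ : 0 < τ) {a x : ℝ} (ha : a < tauM τ) (hx : x ≤ a) : FMP τ a ≤ FMP τ x ∧ 0 < FMP τ a := by
  have hle : tauM τ < tauP τ := by unfold tauM tauP; nlinarith [Real.sqrt_pos.2 hτ]
  rcases le_or_gt a 0 with h | h0a
  · rw [FMP_top h, FMP_top (hx.trans h)]; simp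
  rw [FMP, if_neg (by linarith), if_pos ⟨h0a, ha.le⟩]
  constructor
  · rcases le_or_gt x 0 with h | h0
    · rw [FMP_top h]; exact le_top
    rw [FMP, if_neg (by linarith), if_pos ⟨h0, by linarith⟩]
    refine ENNReal.ofReal_le_ofReal (intervalIntegral.integral_mono_interval hx ha.le le_rfl ?_ ?_)
    · refine (ae_restrict_mem measurableSet_Ioc).mono fun t ht => gMP_nonneg hτ (h0.trans ht.1).le
    · refine (gMP_cont hτ fun t ht => ?_).intervalIntegrable
      rw [uIcc_of_le (by linarith)] at ht; exact h0.trans_le ht.1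
  · rw [ENNReal.ofReal_pos]
    refine intervalIntegral.intervalIntegral_pos_of_pos_on ?_ ?_ ha
    · refine (gMP_cont hτ fun t ht => ?_).intervalIntegrable
      rw [uIcc_of_le (by linarith)] at ht; exact h0a.trans_le ht.1
    · intro t ht
      have : 0 < t := h0a.trans ht.1
      refine div_pos (Real.sqrt_pos.2 (mul_pos_of_neg_of_neg (by linarith [ht.2]) (by linarith [ht.2]))) (by positivity)

/-- the outlier function is bounded below away from the edges -/
lemma FMP_far {τ : ℝ} (hτ : 0 < τ) {η : ℝ} (hη : 0 < η) :
    ∃ c : ℝ≥0∞, 0 < c ∧ ∀ x, (tauP τ + η ≤ x ∨ x ≤ tauM τ - η) → c ≤ FMP τ x := by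
  refine ⟨min (FMP τ (tauP τ + η)) (FMP τ (tauM τ - η)), lt_min (FMP_mono_P hτ (by linarith) le_rfl).2
    (FMP_mono_M hτ (by linarith) le_rfl).2, ?_⟩
  rintro x (h | h)
  · exact (min_le_left _ _).trans (FMP_mono_P hτ (by linarith) h).1
  · exact (min_le_right _ _).trans (FMP_mono_M hτ (by linarith) h).1

lemma FMP_eq {τ : ℝ} (hτ : 0 < τ) (hτ1 : τ ≤ 1) {x : ℝ} (hx0 : 0 < x) (hx : x ∉ Icc (tauM τ) (tauP τ)) :
    FMP τ x = ENNReal.ofReal (FF τ x) ∧ 0 < FF τ x := by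
  have h : FMP τ x = ENNReal.ofReal (FF τ x) ∧ 0 < FMP τ x := by
    rcases lt_or_ge x (tauM τ) with h | h
    · exact ⟨FMP_eq_M hτ hτ1 hx0 h, (FMP_mono_M hτ h le_rfl).2⟩
    · have : tauP τ < x := by by_contra h'; exact hx ⟨h, not_lt.1 h'⟩
      exact ⟨FMP_eq_P hτ hτ1 this, (FMP_mono_P hτ this le_rfl).2⟩
  exact ⟨h.1, by rw [h.1, ENNReal.ofReal_pos] at h; exact h.2⟩

lemma bdd_int {μ : Measure ℝ} [IsFiniteMeasure μ] {f : ℝ → ℝ} (hf : Measurable f) {K : ℝ}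
    (hK : ∀ x, |f x| ≤ K) : Integrable f μ :=
  Integrable.of_bound hf.aestronglyMeasurable K (Eventually.of_forall hK)

lemma exp_lip {K a b : ℝ} (ha : a ≤ K) : exp a ≤ exp b + exp K * |a - b| := by
  have h1 : exp a * (b - a + 1) ≤ exp b := by
    have := add_one_le_exp (b - a)
    calc exp a * (b - a + 1) ≤ exp a * exp (b - a) := by gcongr
      _ = exp b := by rw [← exp_add]; congr 1; ring
  have h2 : exp a * (a - b) ≤ exp K * |a - b| :=
    (mul_le_mul_of_nonneg_left (le_abs_self (a-b)) (exp_pos a).le).trans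
      (mul_le_mul_of_nonneg_right (exp_le_exp.2 ha) (abs_nonneg _))
  nlinarith

lemma dv_meas {ν μ : Measure ℝ} [IsProbabilityMeasure ν] [IsProbabilityMeasure μ] {C : ℝ}
    (h : ∀ f : ℝ → ℝ, Continuous f → (∃ K, ∀ x, |f x| ≤ K) →
      ∫ x, f x ∂ν ≤ ∫ x, exp (f x) ∂μ - 1 + C)
    (f : ℝ → ℝ) (hf : Measurable f) (K : ℝ) (hK : ∀ x, |f x| ≤ K) :
    ∫ x, f x ∂ν ≤ ∫ x, exp (f x) ∂μ - 1 + C := by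
  have key : ∀ ε > 0, ∫ x, f x ∂ν ≤ ∫ x, exp (f x) ∂μ - 1 + C + (1 + exp K) * ε := by
    intro ε hε
    obtain ⟨g, hg, -⟩ := (bdd_int (μ := ν + μ) hf hK).exists_boundedContinuous_integral_sub_le hε
    set g' : ℝ → ℝ := fun x => max (-K) (min K (g x)) with hg'
    have hK0 : 0 ≤ K := (abs_nonneg _).trans (hK 0)
    have gc : Continuous g' := continuous_const.max (continuous_const.min g.continuous)
    have gb : ∀ x, |g' x| ≤ K := fun x => abs_le.2
      ⟨le_max_left _ _, max_le (by linarith) (min_le_left _ _)⟩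
    have hle : ∀ x, |f x - g' x| ≤ ‖f x - g x‖ := by
      intro x
      have := abs_le.1 (hK x)
      rw [Real.norm_eq_abs]
      simp only [hg']
      rcases max_cases (-K) (min K (g x)) with ⟨h2, _⟩ | ⟨h2, _⟩ <;>
      rcases min_cases K (g x) with ⟨h1, _⟩ | ⟨h1, _⟩ <;> rw [h2] <;> (try rw [h1]) <;>
      rw [abs_le] <;> constructor <;>
      rcases abs_cases (f x - g x) with ⟨_, _⟩ | ⟨_, _⟩ <;> linarith
    have i1 : Integrable (fun x => |f x - g' x|) (ν + μ) :=
      ((bdd_int hf hK).sub (bdd_int gc.measurable gb)).abs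
    have i2 : Integrable (fun x => ‖f x - g x‖) (ν + μ) :=
      ((bdd_int hf hK).sub (g.integrable _)).norm
    have hs : ∫ x, |f x - g' x| ∂(ν + μ) ≤ ε := (integral_mono i1 i2 hle).trans hg
    rw [integral_add_measure i1.left_of_add_measure i1.right_of_add_measure] at hs
    have n1 : 0 ≤ ∫ x, |f x - g' x| ∂ν := integral_nonneg fun _ => abs_nonneg _
    have n2 : 0 ≤ ∫ x, |f x - g' x| ∂μ := integral_nonneg fun _ => abs_nonneg _
    have a1 : ∫ x, f x ∂ν ≤ ∫ x, g' x ∂ν + ∫ x, |f x - g' x| ∂ν := by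
      rw [← integral_add (bdd_int gc.measurable gb) i1.left_of_add_measure]
      refine integral_mono (bdd_int hf hK) ((bdd_int gc.measurable gb).add
        i1.left_of_add_measure) fun x => ?_
      have := le_abs_self (f x - g' x); simp only []; linarith
    have eb : ∀ φ : ℝ → ℝ, Measurable φ → (∀ x, |φ x| ≤ K) → Integrable (fun x => exp (φ x)) μ :=
      fun φ h1 h2 => bdd_int (K := exp K) (measurable_exp.comp h1) fun x => by
        rw [abs_of_pos (exp_pos _)]; exact exp_le_exp.2 (abs_le.1 (h2 x)).2
    have a2 : ∫ x, exp (g' x) ∂μ ≤ ∫ x, exp (f x) ∂μ + exp K * ∫ x, |f x - g' x| ∂μ := by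
      rw [← integral_const_mul, ← integral_add (eb f hf hK) (i1.right_of_add_measure.const_mul _)]
      refine integral_mono (eb g' gc.measurable gb) ((eb f hf hK).add
        (i1.right_of_add_measure.const_mul _)) fun x => ?_
      have := exp_lip (b := f x) (abs_le.1 (gb x)).2
      rwa [abs_sub_comm] at this
    have a3 := h g' gc ⟨K, gb⟩
    have := exp_pos K
    nlinarith
  refine le_of_forall_pos_le_add fun δ hδ => ?_
  have hp : 0 < 1 + exp K := by positivity
  have := key (δ / (1 + exp K)) (by positivity)
  rwa [mul_div_cancel₀ _ hp.ne'] at this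

open InformationTheory in
lemma KLdiv_eq {ν μ : Measure ℝ} [IsProbabilityMeasure ν] [IsProbabilityMeasure μ] :
    KLdiv ν μ = klDiv ν μ := by
  unfold KLdiv
  split_ifs with h
  · rw [klDiv_of_ac_of_integrable h.1 h.2]; simp
  · rw [eq_comm, klDiv_eq_top_iff]; tauto

lemma kl_ptw {ρ q : ℝ} (hq : 0 < q) (h : 0 ≤ (ρ - q) * log q) :
    0 ≤ ρ * log q - q + 1 := by
  have := InformationTheory.klFun_nonneg hq.le
  unfold InformationTheory.klFun at this
  nlinarith

open InformationTheory in
theorem KLdiv_le_of_dv {ν μ : Measure ℝ} [IsProbabilityMeasure ν] [IsProbabilityMeasure μ] {C : ℝ}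
    (h : ∀ f : ℝ → ℝ, Continuous f → (∃ K, ∀ x, |f x| ≤ K) →
      ∫ x, f x ∂ν ≤ ∫ x, exp (f x) ∂μ - 1 + C) : KLdiv ν μ ≤ ENNReal.ofReal C := by
  have hm := dv_meas h
  have hac : ν ≪ μ := by
    refine Measure.AbsolutelyContinuous.mk fun A hA h0 => ?_
    by_contra hne
    have hpos : 0 < ν.real A := ENNReal.toReal_pos hne (measure_ne_top _ _)
    have h2 : ∀ K : ℝ, 0 ≤ K → K * ν.real A ≤ C := by
      intro K hK
      have := hm (A.indicator fun _ => K) (measurable_const.indicator hA) K (fun x => by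
        by_cases hx : x ∈ A <;> simp [hx, abs_of_nonneg hK, hK])
      rw [integral_indicator_const _ hA] at this
      have e : ∫ x, exp (A.indicator (fun _ => K) x) ∂μ = 1 := by
        rw [integral_congr_ae (g := fun _ => (1:ℝ))]
        · simp
        · filter_upwards [measure_eq_zero_iff_ae_notMem.1 h0] with x hx
          simp [hx]
      rw [e, smul_eq_mul] at this
      linarith
    have hC := h2 0 le_rfl
    rw [zero_mul] at hC
    have := h2 ((C + 1) / ν.real A) (by positivity)
    rw [div_mul_cancel₀ _ hpos.ne'] at this
    linarith
  rw [KLdiv_eq, klDiv_eq_lintegral_klFun_of_ac hac]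
  set ρ : ℝ → ℝ := fun x => (ν.rnDeriv μ x).toReal with hρ
  have hρm : Measurable ρ := (Measure.measurable_rnDeriv _ _).ennreal_toReal
  have hρ0 : ∀ x, 0 ≤ ρ x := fun x => ENNReal.toReal_nonneg
  set q : ℕ → ℝ → ℝ := fun m x => max (exp (-m)) (min (exp m) (ρ x)) with hq
  have qm : ∀ m, Measurable (q m) := fun m => measurable_const.max (measurable_const.min hρm)
  have ql : ∀ (m : ℕ) x, exp (-m) ≤ q m x := fun m x => le_max_left _ _
  have qu : ∀ (m : ℕ) x, q m x ≤ exp m := fun m x => max_le (exp_le_exp.2 (by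
    have : (0:ℝ) ≤ m := Nat.cast_nonneg m
    linarith)) (min_le_left _ _)
  have qp : ∀ m x, 0 < q m x := fun m x => (exp_pos _).trans_le (ql m x)
  have lb : ∀ (m : ℕ) x, |log (q m x)| ≤ m := fun m x => abs_le.2
    ⟨(le_log_iff_exp_le (qp m x)).2 (ql m x), (log_le_iff_le_exp (qp m x)).2 (qu m x)⟩
  have hI : ∀ m : ℕ, ∫⁻ x, ENNReal.ofReal (ρ x * log (q m x) - q m x + 1) ∂μ ≤ ENNReal.ofReal C := by
    intro m
    have lm : Measurable fun x => log (q m x) := measurable_log.comp (qm m)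
    have h1 := hm _ lm m (lb m)
    have iq : Integrable (q m) μ := bdd_int (K := exp m) (qm m) fun x => by
      rw [abs_of_pos (qp m x)]; exact qu m x
    have il : Integrable (fun x => ρ x * log (q m x)) μ := by
      have := (integrable_rnDeriv_smul_iff (μ := ν) (ν := μ) hac).2 (bdd_int lm (lb m))
      simpa [smul_eq_mul] using this
    have e1 : ∫ x, ρ x * log (q m x) ∂μ = ∫ x, log (q m x) ∂ν := by
      have := integral_rnDeriv_smul (μ := ν) (ν := μ) hac (f := fun x => log (q m x))
      simpa [smul_eq_mul] using this
    have e2 : ∫ x, exp (log (q m x)) ∂μ = ∫ x, q m x ∂μ :=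
      integral_congr_ae (Eventually.of_forall fun x => exp_log (qp m x))
    have i4 : Integrable (fun x => ρ x * log (q m x) - q m x) μ := il.sub iq
    have i5 : Integrable (fun x => ρ x * log (q m x) - q m x + 1) μ := i4.add (integrable_const 1)
    rw [← ofReal_integral_eq_lintegral_ofReal i5]
    · refine ENNReal.ofReal_le_ofReal ?_
      have e3 : ∫ x, (ρ x * log (q m x) - q m x + 1) ∂μ
          = ∫ x, ρ x * log (q m x) ∂μ - ∫ x, q m x ∂μ + 1 := by
        rw [integral_add i4 (integrable_const 1), integral_sub il iq]; simp
      rw [e3, e1]; linarith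
    · refine Eventually.of_forall fun x => kl_ptw (qp m x) ?_
      have hm0 : (0:ℝ) ≤ m := Nat.cast_nonneg m
      simp only [hq]
      rcases le_total (ρ x) (exp (-m)) with c1 | c1
      · have : ρ x ≤ exp m := c1.trans (exp_le_exp.2 (by linarith))
        rw [min_eq_right this, max_eq_left c1, log_exp]
        nlinarith
      · rcases le_total (ρ x) (exp m) with c2 | c2
        · rw [min_eq_right c2, max_eq_right c1]; simp
        · rw [min_eq_left c2, max_eq_right (exp_le_exp.2 (by linarith)), log_exp]
          nlinarith
  have hlim : ∀ x, Tendsto (fun m : ℕ => ENNReal.ofReal (ρ x * log (q m x) - q m x + 1)) atTop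
      (𝓝 (ENNReal.ofReal (klFun (ρ x)))) := by
    intro x
    refine (ENNReal.continuous_ofReal.tendsto _).comp ?_
    have hexp : Tendsto (fun m : ℕ => exp (-(m:ℝ))) atTop (𝓝 0) :=
      (tendsto_exp_neg_atTop_nhds_zero).comp tendsto_natCast_atTop_atTop
    rcases (hρ0 x).eq_or_lt with h0 | h0
    · have : Tendsto (fun m : ℕ => (0:ℝ) - exp (-(m:ℝ)) + 1) atTop (𝓝 (0 - 0 + 1)) :=
        (tendsto_const_nhds.sub hexp).add tendsto_const_nhds
      rw [← h0]
      simp only [klFun, zero_mul, sub_zero, zero_add] at *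
      refine this.congr fun m => ?_
      simp only [hq, ← h0, min_eq_right (exp_pos _).le, max_eq_left (exp_pos _).le]
    · refine tendsto_const_nhds.congr' ?_
      have t2 : Tendsto (fun m : ℕ => exp (m:ℝ)) atTop atTop :=
        tendsto_exp_atTop.comp tendsto_natCast_atTop_atTop
      filter_upwards [hexp.eventually (gt_mem_nhds h0), t2.eventually_ge_atTop (ρ x)] with m h1 h2
      simp only [hq]
      rw [min_eq_right h2, max_eq_right h1.le, klFun]; ring
  calc ∫⁻ x, ENNReal.ofReal (klFun (ρ x)) ∂μ
      = ∫⁻ x, liminf (fun m : ℕ => ENNReal.ofReal (ρ x * log (q m x) - q m x + 1)) atTop ∂μ := by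
        exact lintegral_congr fun x => (hlim x).liminf_eq.symm
    _ ≤ liminf (fun m : ℕ => ∫⁻ x, ENNReal.ofReal (ρ x * log (q m x) - q m x + 1) ∂μ) atTop :=
        lintegral_liminf_le fun m => ENNReal.measurable_ofReal.comp
          (((hρm.mul (measurable_log.comp (qm m))).sub (qm m)).add_const 1)
    _ ≤ ENNReal.ofReal C := by
        refine liminf_le_of_le (by isBoundedDefault) fun b hb => ?_
        obtain ⟨m, hm⟩ := hb.exists
        exact hm.trans (hI m)

/-- Jensen-type bound for direction I. -/
lemma kl_cell {ν μ : Measure ℝ} [IsProbabilityMeasure ν] [IsProbabilityMeasure μ]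
    (hac : ν ≪ μ) (hint : Integrable (llr ν μ) ν) (χ : ℝ → ℝ) (hm : Measurable χ)
    (h0 : ∀ x, 0 ≤ χ x) {K : ℝ} (hK : ∀ x, χ x ≤ K) (hp : 0 < ∫ x, χ x ∂ν) :
    0 < ∫ x, χ x ∂μ ∧
    -∫ x, χ x * llr ν μ x ∂ν ≤
      (∫ x, χ x ∂ν) * log ((∫ x, χ x ∂μ) / (∫ x, χ x ∂ν)) := by
  have hb : ∀ x, |χ x| ≤ K := fun x => by rw [abs_of_nonneg (h0 x)]; exact hK x
  have iν : Integrable χ ν := bdd_int hm hb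
  have iμ : Integrable χ μ := bdd_int hm hb
  set p := ∫ x, χ x ∂ν
  set m := ∫ x, χ x ∂μ
  have mpos : 0 < m := by
    rw [integral_pos_iff_support_of_nonneg h0 iμ]
    rw [integral_pos_iff_support_of_nonneg h0 iν] at hp
    exact pos_iff_ne_zero.2 fun h => hp.ne' (hac h)
  refine ⟨mpos, ?_⟩
  have il : Integrable (fun x => χ x * llr ν μ x) ν :=
    hint.bdd_mul (c := K) hm.aestronglyMeasurable (Eventually.of_forall hb)
  set g : ℝ → ℝ := fun x => χ x * exp (-llr ν μ x) with hg
  have hgl : ∫⁻ x, ENNReal.ofReal (g x) ∂ν ≤ ENNReal.ofReal m := by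
    rw [ofReal_integral_eq_lintegral_ofReal iμ (Eventually.of_forall h0)]
    have e : ν = μ.withDensity (ν.rnDeriv μ) := (Measure.withDensity_rnDeriv_eq _ _ hac).symm
    have gm : Measurable fun x => ENNReal.ofReal (g x) :=
      ENNReal.measurable_ofReal.comp (hm.mul (measurable_exp.comp (measurable_llr _ _).neg))
    conv_lhs => rw [e]
    rw [lintegral_withDensity_eq_lintegral_mul _ (Measure.measurable_rnDeriv _ _) gm]
    refine lintegral_mono_ae ?_
    filter_upwards [Measure.rnDeriv_lt_top ν μ] with x hx
    simp only [Pi.mul_apply, hg, llr_def]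
    rcases eq_or_ne (ν.rnDeriv μ x) 0 with hz | hz
    · simp [hz]
    · have hpos := ENNReal.toReal_pos hz hx.ne
      rw [exp_neg, exp_log hpos]
      nth_rewrite 1 [← ENNReal.ofReal_toReal hx.ne]
      rw [← ENNReal.ofReal_mul hpos.le]
      apply le_of_eq; congr 1; field_simp
  have gm : Measurable g := hm.mul (measurable_exp.comp (measurable_llr _ _).neg)
  have g0 : ∀ x, 0 ≤ g x := fun x => mul_nonneg (h0 x) (exp_pos _).le
  have ig : Integrable g ν := by
    refine ⟨gm.aestronglyMeasurable, ?_⟩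
    rw [hasFiniteIntegral_iff_ofReal (Eventually.of_forall g0)]
    exact hgl.trans_lt ENNReal.ofReal_lt_top
  have hgm : ∫ x, g x ∂ν ≤ m := by
    rw [integral_eq_lintegral_of_nonneg_ae (Eventually.of_forall g0) gm.aestronglyMeasurable]
    exact ENNReal.toReal_le_of_le_ofReal mpos.le hgl
  set c := m / p
  have hc : 0 < c := div_pos mpos hp
  have i3 : Integrable (fun x => g x / c - χ x) ν := (ig.div_const c).sub iν
  have hle : ∫ x, -(χ x * llr ν μ x) ∂ν ≤ ∫ x, (g x / c - χ x + χ x * log c) ∂ν := by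
    refine integral_mono il.neg (i3.add (iν.mul_const _)) fun x => ?_
    have := log_le_sub_one_of_pos (div_pos (exp_pos (-llr ν μ x)) hc)
    rw [log_div (exp_pos _).ne' hc.ne', log_exp] at this
    simp only [hg]
    have := mul_le_mul_of_nonneg_left this (h0 x)
    have e : χ x * exp (-llr ν μ x) / c = χ x * (exp (-llr ν μ x) / c) := by ring
    rw [e]; nlinarith
  rw [integral_neg, integral_add i3 (iν.mul_const _),
    integral_sub (ig.div_const c) iν, integral_div, integral_mul_const] at hle
  have : (∫ x, g x ∂ν) / c ≤ p := by
    rw [div_le_iff₀ hc]; simp only [c]; rw [mul_div_cancel₀ _ hp.ne']; exact hgm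
  linarith

lemma Sf_append {m M : ℕ} (B a : ℝ) (x : Fin m → ℝ) (y : Fin M → ℝ) :
    Sf B a (Fin.append x y) = Sf B a y
      + ∑ j, (B * x j - a * log (x j) - 2 * ∑ i, log |x j - y i|) - En x := by
  unfold Sf En
  have e : ∑ i, ∑ j, log |y i - x j| = ∑ j, ∑ i, log |x j - y i| := by
    rw [Finset.sum_comm]; simp only [abs_sub_comm]
  simp only [Fin.sum_univ_add, Fin.append_left, Fin.append_right, Finset.sum_add_distrib,
    Finset.sum_sub_distrib, ← Finset.mul_sum, e]
  ring

/-- the scale `B` for `m + (N+1)` particles -/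
def BN (τ : ℝ) (m N : ℕ) : ℝ := ((m + (N+1) : ℕ) : ℝ) / τ

lemma BN_pos {τ : ℝ} (hτ : 0 < τ) (m N : ℕ) : 0 < BN τ m N := by
  unfold BN; positivity

lemma BN_c {τ : ℝ} (hτ : 0 < τ) (hτ1 : τ ≤ 1) (m N : ℕ) :
    ((N+1 : ℕ):ℝ) - 1 < BN τ m N - m := by
  have : ((m + (N+1) : ℕ) : ℝ) ≤ BN τ m N := by
    unfold BN; rw [le_div_iff₀ hτ]
    have : (0:ℝ) ≤ ((m + (N+1) : ℕ) : ℝ) := Nat.cast_nonneg _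
    nlinarith
  push_cast at *; linarith

lemma tendsto_ratio (a b : ℝ) : Tendsto (fun N : ℕ => ((N:ℝ) + a) / (N + b)) atTop (𝓝 1) := by
  have h1 : Tendsto (fun N : ℕ => 1 + (a - b) / ((N:ℝ) + b)) atTop (𝓝 (1 + 0)) :=
    tendsto_const_nhds.add ((tendsto_atTop_add_const_right _ b
      tendsto_natCast_atTop_atTop).const_div_atTop _)
  rw [add_zero] at h1
  refine h1.congr' ?_
  filter_upwards [(tendsto_atTop_add_const_right _ b
      (tendsto_natCast_atTop_atTop (R := ℝ))).eventually_gt_atTop 0] with N hN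
  field_simp; ring

lemma gs_lim {τ : ℝ} (hτ : 0 < τ) (m j : ℕ) (hj : 1 ≤ j) :
    Tendsto (fun N => gs (BN τ m N) (BN τ m N - m) (N+1) j) atTop (𝓝 (zMP τ j)) := by
  rcases Nat.even_or_odd' j with ⟨k, rfl | rfl⟩
  · obtain ⟨k, rfl⟩ : ∃ l, k = l + 1 := ⟨k - 1, by omega⟩
    rw [show 2 * (k+1) = 2*k+2 by ring, zMP_even]
    have := (tendsto_ratio (-k) (m+1)).mul_const τ
    rw [one_mul] at this
    refine this.congr fun N => ?_
    rw [gs_even, BN]; push_cast; field_simp; ring_nf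
  · rw [zMP_odd]
    have h : Tendsto (fun N : ℕ => ((N:ℝ) + (m + 1 - τ * (m + k))) / (N + (m+1))) atTop (𝓝 1) :=
      tendsto_ratio _ _
    refine h.congr fun N => ?_
    rw [gs_odd, BN]; push_cast
    field_simp; ring_nf

lemma gs_edges' {τ : ℝ} (hτ0 : 0 < τ) (hτ1 : τ ≤ 1) {m N : ℕ} {x w : Fin (N+1) → ℝ}
    (h : FinSpec (N+1) x w (gs (BN τ m N) (BN τ m N - m) (N+1))) (i : Fin (N+1)) :
    x i ∈ Icc (tauM τ) (tauP τ) := by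
  have key : ∀ K M : ℕ, M = K - m → m < K → ∀ (x w : Fin M → ℝ)
    (_ : FinSpec M x w (gs (K/τ) (K/τ - m) M)) (i : Fin M), x i ∈ Icc (tauM τ) (tauP τ) := by
    rintro K M rfl hm x w h i
    exact gs_edges hτ0 hτ1 hm h i
  exact key (m + (N+1)) (N+1) (by omega) (by omega) x w h i

lemma ground_seq {τ : ℝ} (hτ : 0 < τ) (hτ1 : τ ≤ 1) (m : ℕ) : ∃ x : (N : ℕ) → Fin (N+1) → ℝ,
    (∀ N, Function.Injective (x N)) ∧ (∀ N i, 0 < x N i) ∧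
    (∀ N i, x N i ∈ Icc (tauM τ) (tauP τ)) ∧
    (∀ N, Sf (BN τ m N) (BN τ m N - m + 1 - (N+1 : ℕ)) (x N) + (N+1 : ℕ) * log (N+1 : ℕ)
      = cst (BN τ m N) (BN τ m N - m) (N+1)) ∧
    (∀ f : ℝ → ℝ, ContinuousOn f (Icc (tauM τ) (tauP τ)) →
      Tendsto (fun N => ∑ i, 1 / ((N+1 : ℕ):ℝ) * f (x N i)) atTop (𝓝 (∫ t, f t ∂(MPm τ)))) ∧
    ∀ N p, ((Jmat (N+1) (gs (BN τ m N) (BN τ m N - m) (N+1)))^p).trace = ∑ i, x N i ^ p := by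
  choose x h1 h2 h3 using fun N : ℕ => ground (n := N+1) (Nat.succ_pos N) (BN_pos hτ m N)
    (BN_c hτ hτ1 m N)
  have hI : ∀ N i, x N i ∈ Icc (tauM τ) (tauP τ) := fun N i => gs_edges' hτ hτ1 (h1 N) i
  refine ⟨x, fun N => (h1 N).inj, fun N => (h1 N).xpos, hI, h2, ?_, h3⟩
  intro f hf
  have := MPm_prob hτ hτ1
  refine weak_conv (MPm_supp τ) hI (fun N i => ((h1 N).wpos i).le) (fun N => (h1 N).wsum) ?_ hf
  intro p
  have := func_conv (LN := fun N => Lat (x N) fun _ => 1 / ((N+1 : ℕ):ℝ)) (tendsto_add_atTop_nat 1)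
    (fun N => (h1 N).orth) (fun N => by
      have := (h1 N).wsum
      rw [Lat_apply]; simpa using this) (LMP_orth hτ hτ1)
    (LMP_one hτ hτ1) (gs_lim hτ m) p
  exact this

lemma cst_lim {τ : ℝ} (hτ : 0 < τ) (m : ℕ) : Tendsto (fun N : ℕ =>
    (cst (BN τ m N) (BN τ m N) (m + (N+1)) - cst (BN τ m N) (BN τ m N - m) (N+1)) /
      ((m + (N+1) : ℕ) : ℝ)) atTop (𝓝 (m * (1/τ + 1 - log τ))) := by
  have e : ∀ N : ℕ, (cst (BN τ m N) (BN τ m N) (m + (N+1)) - cst (BN τ m N) (BN τ m N - m) (N+1)) /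
      ((m + (N+1) : ℕ) : ℝ) = ∑ k ∈ Finset.range m, (phi (BN τ m N) (BN τ m N - k) +
        phi (BN τ m N) (((m+(N+1) : ℕ):ℝ) - 1 - k)) / ((m + (N+1) : ℕ) : ℝ) := by
    intro N
    have := cst_diff (BN τ m N) (N := m + (N+1)) (m := m) (by omega)
    rw [Nat.add_sub_cancel_left] at this
    rw [this, Finset.sum_div]
  simp only [e]
  have : (m:ℝ) * (1/τ + 1 - log τ) = ∑ k ∈ Finset.range m, (1/τ + 1 - log τ) := by
    rw [Finset.sum_const, Finset.card_range, nsmul_eq_mul]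
  rw [this]
  refine tendsto_finsetSum _ fun k _ => ?_
  have r1 : Tendsto (fun N : ℕ => ((N:ℝ) + (m + 1 - τ * k)) / (N + (m+1))) atTop (𝓝 1) :=
    tendsto_ratio _ _
  have r2 : Tendsto (fun N : ℕ => ((N:ℝ) + (m - k)) / (N + (m+1))) atTop (𝓝 1) :=
    tendsto_ratio _ _
  have l1 := (continuousAt_log one_ne_zero).tendsto.comp r1
  have l2 := (continuousAt_log (show (1 * τ) ≠ 0 by positivity)).tendsto.comp (r2.mul_const τ)
  have t := ((r1.mul_const (1/τ)).mul ((tendsto_const_nhds (x := (1:ℝ))).sub l1)).add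
    (r2.mul ((tendsto_const_nhds (x := (1:ℝ))).sub l2))
  rw [log_one, one_mul, one_mul, one_mul, sub_zero, mul_one, ← add_sub_assoc] at t
  refine t.congr fun N => ?_
  have hN : (0:ℝ) < (N:ℝ) + (m + 1) := by positivity
  have ec : ((m + (N+1) : ℕ) : ℝ) = N + (m+1) := by push_cast; ring
  have e1 : (BN τ m N - k) / BN τ m N = ((N:ℝ) + (m + 1 - τ * k)) / (N + (m+1)) := by
    rw [BN, ec]; field_simp
    ring
  have e2 : (((m+(N+1) : ℕ):ℝ) - 1 - k) / BN τ m N = ((N:ℝ) + (m - k)) / (N + (m+1)) * τ := by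
    rw [BN, ec]; field_simp
    ring
  simp only [phi, Function.comp]
  rw [e1, e2, BN, ec]
  field_simp
  ring

lemma contOn_log_abs {s : Set ℝ} {x : ℝ} (hx : x ∉ s) : ContinuousOn (fun y => log |x - y|) s := by
  refine ContinuousOn.log (by fun_prop) fun y hy => abs_ne_zero.2 (sub_ne_zero.2 ?_)
  rintro rfl; exact hx hy

lemma disc_limit {τ : ℝ} (hτ : 0 < τ) (hτ1 : τ ≤ 1) {m : ℕ} (x : Fin m → ℝ)
    (hxi : Function.Injective x) (hx0 : ∀ j, 0 < x j) (hxI : ∀ j, x j ∉ Icc (tauM τ) (tauP τ))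
    (u : Fin m → ℝ) (hu : ∀ j, 0 < u j) (f : ℝ → ℝ) (hf : ContinuousOn f (Icc (tauM τ) (tauP τ)))
    (hfp : ∀ t ∈ Icc (tauM τ) (tauP τ), 0 < f t) (hs : ∑ j, u j + ∫ t, f t ∂(MPm τ) = 1)
    {ε : ℝ} (hε : 0 < ε) (D N0 : ℕ) :
    ∃ N ≥ N0, ∃ (Y W : Fin N → ℝ) (z : ℕ → ℝ), FinSpec N Y W z ∧
      (∀ i ≤ D, |Lat Y W (X^i) - (∑ j, u j * x j ^ i + ∫ t, f t * t^i ∂(MPm τ))| < ε) ∧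
      Sf (N/τ) (N/τ+1-N) Y - ∑ i, log (W i) - cst (N/τ) (N/τ) N ≤
        N * (∑ j, FF τ (x j) - ∫ t, log (f t) ∂(MPm τ) + ε) := by
  obtain ⟨y, yi, y0, yI, yS, yc, -⟩ := ground_seq hτ hτ1 m
  have := MPm_prob hτ hτ1
  set s := ∫ t, f t ∂(MPm τ) with hsdef
  have hspos : 0 < s := by
    rw [hsdef, integral_pos_iff_support_of_nonneg_ae]
    · rw [pos_iff_ne_zero]
      intro h0
      have h1 : MPm τ univ ≤ MPm τ (Function.support f) + MPm τ (Icc (tauM τ) (tauP τ))ᶜ := by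
        refine (measure_mono fun t _ => ?_).trans (measure_union_le _ _)
        by_cases h : t ∈ Icc (tauM τ) (tauP τ)
        · exact Or.inl (hfp t h).ne'
        · exact Or.inr h
      rw [h0, MPm_supp, measure_univ] at h1
      simp at h1
    · filter_upwards [ae_mem_Icc (MPm_supp τ)] with t ht using (hfp t ht).le
    · exact integrable_of_contOn (MPm_supp τ) hf
  set a : ℕ → ℝ := fun N => ∑ i, 1 / ((N+1 : ℕ):ℝ) * f (y N i) with ha
  have apos : ∀ N, 0 < a N := fun N => Finset.sum_pos
    (fun i _ => mul_pos (by positivity) (hfp _ (yI N i))) ⟨0, Finset.mem_univ _⟩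
  have alim : Tendsto a atTop (𝓝 s) := yc f hf
  set v : (N : ℕ) → Fin (N+1) → ℝ := fun N i => 1 / ((N+1 : ℕ):ℝ) * f (y N i) * (s / a N) with hv
  have vpos : ∀ N i, 0 < v N i := fun N i =>
    mul_pos (mul_pos (by positivity) (hfp _ (yI N i))) (div_pos hspos (apos N))
  have vsum : ∀ N, ∑ i, v N i = s := fun N => by
    simp only [hv]; rw [← Finset.sum_mul]; exact mul_div_cancel₀ _ (apos N).ne'
  set Y : (N : ℕ) → Fin (m + (N+1)) → ℝ := fun N => Fin.append x (y N) with hY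
  set W : (N : ℕ) → Fin (m + (N+1)) → ℝ := fun N => Fin.append u (v N) with hW
  have Yi : ∀ N, Function.Injective (Y N) := fun N => by
    rw [hY, Fin.append_injective_iff]
    exact ⟨hxi, yi N, fun i j h => hxI i (h ▸ yI N j)⟩
  have hY0 : ∀ N i, 0 < Y N i := fun N i => by
    refine Fin.addCases (fun j => ?_) (fun j => ?_) i
    · simp only [hY, Fin.append_left]; exact hx0 j
    · simp only [hY, Fin.append_right]; exact y0 N j
  have hW0 : ∀ N i, 0 < W N i := fun N i => by
    refine Fin.addCases (fun j => ?_) (fun j => ?_) i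
    · simp only [hW, Fin.append_left]; exact hu j
    · simp only [hW, Fin.append_right]; exact vpos N j
  have hW1 : ∀ N, ∑ i, W N i = 1 := fun N => by
    rw [Fin.sum_univ_add]; simp only [hW, Fin.append_left, Fin.append_right]
    rw [vsum]; exact hs
  have rat : Tendsto (fun N => s / a N) atTop (𝓝 1) := by
    have := (tendsto_const_nhds (x := s)).div alim hspos.ne'
    rwa [div_self hspos.ne'] at this
  have mom : ∀ i : ℕ, Tendsto (fun N => Lat (Y N) (W N) (X^i)) atTop
      (𝓝 (∑ j, u j * x j ^ i + ∫ t, f t * t^i ∂(MPm τ))) := by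
    intro i
    have h := yc (fun t => f t * t^i) (hf.mul (by fun_prop))
    have := (tendsto_const_nhds (x := ∑ j, u j * x j ^ i)).add (h.mul rat)
    rw [mul_one] at this
    refine this.congr fun N => ?_
    rw [Lat_apply, Fin.sum_univ_add (a := m), Finset.sum_mul]
    simp only [hY, hW, Fin.append_left, Fin.append_right, eval_pow, eval_X, hv]
    congr 1
    exact Finset.sum_congr rfl fun j _ => by ring
  -- the energy
  have hN : ∀ N : ℕ, ((m + (N+1) : ℕ):ℝ) / τ = BN τ m N := fun N => rfl
  have en : ∀ N : ℕ, Sf (BN τ m N) (BN τ m N + 1 - (m + (N+1) : ℕ)) (Y N) - ∑ i, log (W N i)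
      - cst (BN τ m N) (BN τ m N) (m + (N+1)) =
      ∑ j, (BN τ m N * x j - (BN τ m N + 1 - (m + (N+1) : ℕ)) * log (x j)
        - 2 * ∑ i, log |x j - y N i|) - (En x + ∑ j, log (u j))
      - (cst (BN τ m N) (BN τ m N) (m + (N+1)) - cst (BN τ m N) (BN τ m N - m) (N+1))
      - (∑ i, log (f (y N i)) + (N+1 : ℕ) * log (s / a N)) := by
    intro N
    have e1 := yS N
    have e2 : BN τ m N - m + 1 - (N+1 : ℕ) = BN τ m N + 1 - (m + (N+1) : ℕ) := by push_cast; ring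
    rw [e2] at e1
    have e3 : ∑ i, log (W N i) = ∑ j, log (u j) + (∑ i, log (f (y N i)) + (N+1 : ℕ) * log (s / a N))
        - (N+1 : ℕ) * log (N+1 : ℕ) := by
      rw [Fin.sum_univ_add]; simp only [hW, Fin.append_left, Fin.append_right, hv]
      have : ∀ i, log (1 / ((N+1 : ℕ):ℝ) * f (y N i) * (s / a N)) =
          log (f (y N i)) + (log (s / a N) - log (N+1 : ℕ)) := fun i => by
        have h1 : (0:ℝ) < 1 / ((N+1 : ℕ):ℝ) := by positivity
        have h2 := hfp _ (yI N i)
        rw [log_mul (mul_pos h1 h2).ne' (div_pos hspos (apos N)).ne', log_mul h1.ne' h2.ne',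
          one_div, log_inv]; ring
      simp only [this]
      rw [Finset.sum_add_distrib (s := (Finset.univ : Finset (Fin (N+1)))), Finset.sum_const,
        Finset.card_univ, Fintype.card_fin, nsmul_eq_mul]
      ring
    rw [Sf_append, e3]
    linarith
  have tinf : Tendsto (fun N : ℕ => ((m + (N+1) : ℕ):ℝ)) atTop atTop :=
    tendsto_natCast_atTop_atTop.comp (tendsto_atTop_mono (fun N => show N ≤ _ by omega) tendsto_id)
  have r1 : Tendsto (fun N : ℕ => ((N+1 : ℕ):ℝ) / ((m + (N+1) : ℕ):ℝ)) atTop (𝓝 1) := by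
    refine (tendsto_ratio 1 (m+1)).congr fun N => ?_
    push_cast; ring_nf
  have avg : ∀ g : ℝ → ℝ, ContinuousOn g (Icc (tauM τ) (tauP τ)) →
      Tendsto (fun N => (∑ i, g (y N i)) / ((m + (N+1) : ℕ):ℝ)) atTop (𝓝 (∫ t, g t ∂(MPm τ))) := by
    intro g hg
    have := (yc g hg).mul r1
    rw [mul_one] at this
    refine this.congr fun N => ?_
    rw [← Finset.mul_sum]; field_simp
  have elim : Tendsto (fun N : ℕ => (Sf (BN τ m N) (BN τ m N + 1 - (m + (N+1) : ℕ)) (Y N)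
      - ∑ i, log (W N i) - cst (BN τ m N) (BN τ m N) (m + (N+1))) / ((m + (N+1) : ℕ):ℝ)) atTop
      (𝓝 (∑ j, FF τ (x j) - ∫ t, log (f t) ∂(MPm τ))) := by
    have t1 : Tendsto (fun N : ℕ => ∑ j, (1/τ * x j - (1/τ + 1/((m + (N+1) : ℕ):ℝ) - 1) * log (x j)
        - 2 * ((∑ i, log |x j - y N i|) / ((m + (N+1) : ℕ):ℝ)))) atTop
        (𝓝 (∑ j, (1/τ * x j - (1/τ + 0 - 1) * log (x j) - 2 * UU τ (x j)))) := by
      refine tendsto_finsetSum _ fun j _ => ?_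
      exact (tendsto_const_nhds.sub (((tendsto_const_nhds.add
        (tinf.const_div_atTop 1)).sub tendsto_const_nhds).mul_const _)).sub
        ((avg _ (contOn_log_abs (hxI j))).const_mul 2)
    have t2 := tinf.const_div_atTop (En x + ∑ j, log (u j))
    have t3 := avg (fun t => log (f t)) (hf.log fun t ht => (hfp t ht).ne')
    have t4 : Tendsto (fun N => log (s / a N)) atTop (𝓝 0) := by
      have := (continuousAt_log one_ne_zero).tendsto.comp rat
      rwa [log_one] at this
    have := ((t1.sub t2).sub (cst_lim hτ m)).sub (t3.add (r1.mul t4))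
    have e : ∑ j, FF τ (x j) - ∫ t, log (f t) ∂(MPm τ) =
        ∑ j, (1/τ * x j - (1/τ + 0 - 1) * log (x j) - 2 * UU τ (x j)) - 0 - m * (1/τ + 1 - log τ)
        - (∫ t, log (f t) ∂(MPm τ) + 1 * 0) := by
      have : (m:ℝ) * (1/τ + 1 - log τ) = ∑ j : Fin m, (1/τ + 1 - log τ) := by
        rw [Finset.sum_const, Finset.card_univ, Fintype.card_fin, nsmul_eq_mul]
      rw [this, sub_zero, ← Finset.sum_sub_distrib, mul_zero, add_zero]
      congr 1
      refine Finset.sum_congr rfl fun j _ => ?_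
      unfold FF; field_simp; ring
    rw [e]
    refine this.congr fun N => ?_
    have hp : (0:ℝ) < ((m + (N+1) : ℕ):ℝ) := by positivity
    have hsum : ∑ j, (1/τ * x j - (1/τ + 1/((m + (N+1) : ℕ):ℝ) - 1) * log (x j)
        - 2 * ((∑ i, log |x j - y N i|) / ((m + (N+1) : ℕ):ℝ))) =
        (∑ j, (BN τ m N * x j - (BN τ m N + 1 - (m + (N+1) : ℕ)) * log (x j)
        - 2 * ∑ i, log |x j - y N i|)) / ((m + (N+1) : ℕ):ℝ) := by
      rw [Finset.sum_div]
      refine Finset.sum_congr rfl fun j _ => ?_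
      rw [BN]; field_simp
    rw [en, hsum]; ring
  have ev1 := elim.eventually (gt_mem_nhds (lt_add_of_pos_right _ hε))
  have ev2 : ∀ᶠ N in atTop, ∀ i ≤ D, |Lat (Y N) (W N) (X^i) -
      (∑ j, u j * x j ^ i + ∫ t, f t * t^i ∂(MPm τ))| < ε := by
    have : ∀ᶠ N in atTop, ∀ i ∈ Finset.range (D+1), |Lat (Y N) (W N) (X^i) -
      (∑ j, u j * x j ^ i + ∫ t, f t * t^i ∂(MPm τ))| < ε := by
      rw [Finset.eventually_all]
      intro i _
      have := Metric.tendsto_nhds.1 (mom i) ε hε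
      simpa [Real.dist_eq] using this
    filter_upwards [this] with N h i hi
    exact h i (Finset.mem_range.2 (by omega))
  obtain ⟨N, h1, h2, h3⟩ := (ev1.and (ev2.and (eventually_ge_atTop N0))).exists
  obtain ⟨z, hz⟩ := exists_finSpec_of_atoms (Yi N) (hY0 N) (hW0 N) (hW1 N)
  refine ⟨m + (N+1), by omega, Y N, W N, z, hz, h2, ?_⟩
  rw [div_lt_iff₀ (by positivity)] at h1
  rw [hN, mul_comm]
  exact h1.le

lemma tauM_lt_tauP {τ : ℝ} (hτ : 0 < τ) : tauM τ < tauP τ := by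
  unfold tauM tauP; nlinarith [Real.sqrt_pos.2 hτ]

lemma mp_pos {τ : ℝ} (hτ : 0 < τ) (hτ1 : τ ≤ 1) {χ : ℝ → ℝ} (hc : Continuous χ) (h0 : ∀ x, 0 ≤ χ x)
    {K : ℝ} (hK : ∀ x, χ x ≤ K) {y : ℝ} (hy : y ∈ Icc (tauM τ) (tauP τ)) (hy0 : 0 < χ y) :
    0 < ∫ x, χ x ∂(MPm τ) := by
  have := MPm_prob hτ hτ1
  rw [integral_pos_iff_support_of_nonneg h0 (bdd_int hc.measurable (K := K) fun x => by
    rw [abs_of_nonneg (h0 x)]; exact hK x), pos_iff_ne_zero]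
  intro h
  rw [MPm_eq, withDensity_apply_eq_zero (mpd_meas τ).ennreal_ofReal] at h
  have ho : IsOpen (Function.support χ) := hc.isOpen_support
  have hcl : y ∈ closure (Ioo (tauM τ) (tauP τ)) := by
    rwa [closure_Ioo (tauM_lt_tauP hτ).ne]
  obtain ⟨t, ht1, ht2⟩ := mem_closure_iff.1 hcl _ ho hy0.ne'
  have hpos : 0 < volume (Function.support χ ∩ Ioo (tauM τ) (tauP τ)) :=
    (ho.inter isOpen_Ioo).measure_pos _ ⟨t, ht1, ht2⟩
  refine hpos.ne' (measure_mono_null ?_ h)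
  rintro s ⟨hs1, hs2⟩
  refine ⟨?_, hs1⟩
  have : 0 < mpd τ s := by
    unfold mpd
    have := tauM_nonneg τ
    have hs0 : 0 < s := this.trans_lt hs2.1
    have : 0 < (s - tauM τ) * (tauP τ - s) := mul_pos (by linarith [hs2.1]) (by linarith [hs2.2])
    positivity
  simpa using this

lemma partition (a b δ0 : ℝ) (hab : a < b) (hδ : 0 < δ0) : ∃ (n : ℕ) (y : ℕ → ℝ) (χ : ℕ → ℝ → ℝ),
    (∀ l, Continuous (χ l)) ∧ (∀ l x, 0 ≤ χ l x) ∧ (∀ l x, χ l x ≤ 1) ∧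
    (∀ x, ∑ l ∈ Finset.range n, χ l x = 1) ∧
    (∀ l x, χ l x ≠ 0 → |max a (min b x) - y l| ≤ δ0) ∧
    ∀ l < n, y l ∈ Icc a b ∧ 0 < χ l (y l) := by
  obtain ⟨n, hn⟩ := exists_nat_gt ((b - a) / δ0)
  have hn0 : (0:ℝ) < n := (div_pos (by linarith) hδ).trans hn
  set δ := (b - a) / n with hd
  have hδ1 : 0 < δ := div_pos (by linarith) hn0
  have hδ2 : δ ≤ δ0 := by
    rw [hd, div_le_iff₀ hn0]; rw [div_lt_iff₀ hδ] at hn; linarith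
  have hnd : n * δ = b - a := by rw [hd]; field_simp
  set t : ℝ → ℝ := fun x => (max a (min b x) - a) / δ with ht
  have t0 : ∀ x, 0 ≤ t x := fun x => div_nonneg (by linarith [le_max_left a (min b x)]) hδ1.le
  have tn : ∀ x, t x ≤ n := fun x => by
    rw [ht]; simp only []; rw [div_le_iff₀ hδ1, hnd]
    linarith [max_le hab.le (min_le_left b x)]
  set s : ℕ → ℝ → ℝ := fun l x => min 1 (max 0 (t x - l + 1)) with hs
  have tc : Continuous t := by rw [ht]; fun_prop
  have sc : ∀ l, Continuous (s l) := fun l => by rw [hs]; fun_prop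
  have smono : ∀ l x, s (l+1) x ≤ s l x := fun l x => by
    simp only [hs]; push_cast; gcongr; linarith
  have s1 : ∀ l x, s l x ≤ 1 := fun l x => min_le_left _ _
  have s0 : ∀ l x, 0 ≤ s l x := fun l x => le_min zero_le_one (le_max_left _ _)
  refine ⟨n+1, fun l => a + l * δ, fun l x => s l x - s (l+1) x, fun l => (sc l).sub (sc _),
    fun l x => sub_nonneg.2 (smono l x), fun l x => by linarith [s1 l x, s0 (l+1) x], ?_, ?_, ?_⟩
  · intro x
    rw [Finset.sum_range_sub' (fun l => s l x)]
    have e1 : s 0 x = 1 := by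
      simp only [hs]; rw [min_eq_left]; refine le_max_of_le_right ?_; push_cast; linarith [t0 x]
    have e2 : s (n+1) x = 0 := by
      simp only [hs]; rw [max_eq_left (by push_cast; linarith [tn x])]; simp
    rw [e1, e2, sub_zero]
  · intro l x hne
    have h1 : (l:ℝ) - 1 ≤ t x := by
      by_contra h
      have e1 : s l x = 0 := by
        simp only [hs]; rw [max_eq_left (by linarith)]; simp
      have e2 : s (l+1) x = 0 := le_antisymm (e1 ▸ smono l x) (s0 _ _)
      exact hne (by show s l x - s (l+1) x = 0; rw [e1, e2, sub_zero])
    have h2 : t x ≤ l + 1 := by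
      by_contra h
      have e1 : s (l+1) x = 1 := by
        simp only [hs]; rw [min_eq_left]; refine le_max_of_le_right ?_; push_cast; linarith
      have e2 : s l x = 1 := le_antisymm (s1 _ _) (e1 ▸ smono l x)
      exact hne (by show s l x - s (l+1) x = 0; rw [e1, e2, sub_self])
    have e : max a (min b x) = a + t x * δ := by rw [ht]; field_simp; ring
    rw [e]
    refine le_trans (abs_le.2 ⟨?_, ?_⟩) hδ2 <;> nlinarith
  · intro l hl
    have hln : (l:ℝ) ≤ n := by exact_mod_cast Nat.lt_succ_iff.1 hl
    have hmem : a + l * δ ∈ Icc a b := by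
      have : (0:ℝ) ≤ l := Nat.cast_nonneg l
      constructor <;> nlinarith
    refine ⟨hmem, ?_⟩
    have et : t (a + l * δ) = l := by
      rw [ht]; simp only []; rw [min_eq_right hmem.2, max_eq_right hmem.1]; field_simp; ring
    simp only [hs, et]; push_cast; norm_num

lemma supp_compl_null (μ : Measure ℝ) : μ (suppSet μ)ᶜ = 0 := by
  refine measure_null_of_locally_null _ fun x hx => ?_
  simp only [suppSet, mem_compl_iff, mem_ofPred_eq, not_forall, not_not] at hx
  obtain ⟨U, hU, h⟩ := hx
  exact ⟨U, mem_nhdsWithin_of_mem_nhds hU, h⟩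

lemma disc_density {τ : ℝ} (hτ : 0 < τ) (hτ1 : τ ≤ 1) {μ : Measure ℝ} [IsProbabilityMeasure μ]
    (hac : MPm τ ≪ μ) (hint : Integrable (llr (MPm τ) μ) (MPm τ)) {A : Set ℝ} (hA : MeasurableSet A)
    (hνA : (MPm τ) Aᶜ = 0) {η δ : ℝ} (hδ : 0 < δ) (hη : 0 ≤ η)
    (hμA : ∀ᵐ t ∂(μ.restrict A), |t - max (tauM τ) (min (tauP τ) t)| ≤ η) :
    ∃ f : ℝ → ℝ, Continuous f ∧ (∀ t, 0 < f t) ∧ ∫ t, f t ∂(MPm τ) = μ.real A ∧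
      -∫ t, log (f t) ∂(MPm τ) ≤ ∫ t, llr (MPm τ) μ t ∂(MPm τ) ∧
      ∀ (g : ℝ → ℝ) (ω : ℝ), Continuous g → Integrable g μ →
        (∀ y ∈ Icc (tauM τ) (tauP τ), ∀ t, |t - y| ≤ δ + η → |g t - g y| ≤ ω) →
        |∫ t, f t * g t ∂(MPm τ) - ∫ t in A, g t ∂μ| ≤ 2 * ω := by
  have hP := MPm_prob hτ hτ1
  obtain ⟨n, y, χ, χc, χ0, χ1, χs, χy, χp⟩ := partition _ _ _ (tauM_lt_tauP hτ) hδ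
  have hνr : (MPm τ).restrict A = MPm τ := Measure.restrict_eq_self_of_ae_mem (by
    rw [ae_iff]; exact hνA)
  have χa : ∀ l x, |χ l x| ≤ 1 := fun l x => by rw [abs_of_nonneg (χ0 l x)]; exact χ1 l x
  set p : ℕ → ℝ := fun l => ∫ x, χ l x ∂(MPm τ) with hp
  set m : ℕ → ℝ := fun l => ∫ x in A, χ l x ∂μ with hm
  have χν : ∀ l, Integrable (fun x => χ l x) (MPm τ) := fun l => bdd_int (χc l).measurable (χa l)
  have χμ : ∀ l, Integrable (fun x => χ l x) (μ.restrict A) := fun l => bdd_int (χc l).measurable (χa l)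
  have hpp : ∀ l ∈ Finset.range n, 0 < p l := fun l hl =>
    mp_pos hτ hτ1 (χc l) (χ0 l) (χ1 l) (χp l (Finset.mem_range.1 hl)).1 (χp l (Finset.mem_range.1 hl)).2
  have cell : ∀ l ∈ Finset.range n, 0 < m l ∧
      -∫ t, χ l t * llr (MPm τ) μ t ∂(MPm τ) ≤ p l * log (m l / p l) := by
    intro l hl
    have e1 : ∫ x, A.indicator (χ l) x ∂(MPm τ) = p l := by
      rw [integral_indicator hA, hνr]
    have e2 : ∫ x, A.indicator (χ l) x ∂μ = m l := by rw [integral_indicator hA]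
    have := kl_cell hac hint (A.indicator (χ l)) ((χc l).measurable.indicator hA)
      (fun x => indicator_nonneg (fun x _ => χ0 l x) x) (K := 1)
      (fun x => indicator_le' (fun x _ => χ1 l x) (fun _ _ => zero_le_one) x) (by rw [e1]; exact hpp l hl)
    rw [e1, e2] at this
    refine ⟨this.1, le_trans (le_of_eq ?_) this.2⟩
    congr 1
    refine integral_congr_ae ?_
    have hae : ∀ᵐ x ∂(MPm τ), x ∈ A := by rw [ae_iff]; exact hνA
    filter_upwards [hae] with x hx
    rw [indicator_of_mem hx]
  have hcp : ∀ l ∈ Finset.range n, 0 < m l / p l := fun l hl => div_pos (cell l hl).1 (hpp l hl)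
  have hmp : ∀ l ∈ Finset.range n, m l / p l * p l = m l := fun l hl => by
    have := (hpp l hl).ne'; field_simp
  set f : ℝ → ℝ := fun t => ∑ l ∈ Finset.range n, m l / p l * χ l t with hf
  have fc : Continuous f := continuous_finsetSum _ fun l _ => continuous_const.mul (χc l)
  have fpos : ∀ t, 0 < f t := by
    intro t
    refine Finset.sum_pos' (fun l hl => mul_nonneg (hcp l hl).le (χ0 l t)) ?_
    by_contra h
    push Not at h
    have : ∑ l ∈ Finset.range n, χ l t = 0 := Finset.sum_eq_zero fun l hl => by
      have h1 := h l hl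
      have h2 := hcp l hl
      have h3 := χ0 l t
      nlinarith
    rw [χs] at this; exact one_ne_zero this
  have fi : Integrable f (MPm τ) := integrable_finsetSum _ fun l _ => (χν l).const_mul _
  have summ : ∑ l ∈ Finset.range n, m l = μ.real A := by
    rw [hm, ← integral_finsetSum _ fun l _ => χμ l, integral_congr_ae (ae_of_all _ χs)]
    simp
  have ff : ∫ t, f t ∂(MPm τ) = μ.real A := by
    rw [hf, integral_finsetSum _ fun l _ => (χν l).const_mul _, ← summ]
    refine Finset.sum_congr rfl fun l hl => ?_
    rw [integral_const_mul]; exact hmp l hl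
  have wA : μ.real A ≤ 1 := measureReal_le_one
  refine ⟨f, fc, fpos, ff, ?_, ?_⟩
  · have h1 : ∑ l ∈ Finset.range n, p l * log (m l / p l) ≤ ∫ t, log (f t) ∂(MPm τ) := by
      have e : ∑ l ∈ Finset.range n, p l * log (m l / p l) =
          ∫ t, ∑ l ∈ Finset.range n, χ l t * log (m l / p l) ∂(MPm τ) := by
        rw [integral_finsetSum _ fun l _ => (χν l).mul_const _]
        exact Finset.sum_congr rfl fun l _ => (integral_mul_const _ _).symm
      rw [e]
      refine integral_mono (integrable_finsetSum _ fun l _ => (χν l).mul_const _) ?_ fun t => ?_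
      · exact integrable_of_contOn (MPm_supp τ) (fc.continuousOn.log fun t _ => (fpos t).ne')
      · have := (strictConcaveOn_log_Ioi.concaveOn).le_map_sum (t := Finset.range n) (w := fun l => χ l t)
          (p := fun l => m l / p l) (fun l _ => χ0 l t) (χs t) hcp
        simp only [smul_eq_mul] at this
        refine this.trans (le_of_eq ?_)
        simp only [hf]; congr 1
        exact Finset.sum_congr rfl fun l _ => mul_comm _ _
    have h2 : -∫ t, llr (MPm τ) μ t ∂(MPm τ) = ∑ l ∈ Finset.range n, -∫ t, χ l t * llr (MPm τ) μ t ∂(MPm τ) := by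
      rw [Finset.sum_neg_distrib, ← integral_finsetSum]
      · congr 1; refine integral_congr_ae (ae_of_all _ fun t => ?_)
        simp only [← Finset.sum_mul]; rw [χs, one_mul]
      · intro l _
        exact hint.bdd_mul (c := 1) (χc l).aestronglyMeasurable (ae_of_all _ (χa l))
    have h3 := Finset.sum_le_sum fun l hl => (cell l hl).2
    rw [← h2] at h3
    linarith
  · intro g ω gc gi hω
    have gν : Integrable (fun t => f t * g t) (MPm τ) :=
      integrable_of_contOn (MPm_supp τ) (fc.mul gc).continuousOn
    have gA : Integrable g (μ.restrict A) := gi.restrict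
    set S := ∑ l ∈ Finset.range n, m l * g (y l) with hS
    have hω0 : 0 ≤ ω := (abs_nonneg _).trans (hω (tauM τ) ⟨le_rfl, (tauM_lt_tauP hτ).le⟩ (tauM τ) (by
      rw [sub_self, abs_zero]; linarith))
    have b1 : |∫ t, f t * g t ∂(MPm τ) - S| ≤ ω := by
      have e : S = ∫ t, ∑ l ∈ Finset.range n, m l / p l * χ l t * g (y l) ∂(MPm τ) := by
        rw [integral_finsetSum _ fun l _ => ((χν l).const_mul _).mul_const _, hS]
        refine Finset.sum_congr rfl fun l hl => ?_
        rw [integral_mul_const, integral_const_mul]; congr 1; exact (hmp l hl).symm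
      have i2 : Integrable (fun t => ∑ l ∈ Finset.range n, m l / p l * χ l t * g (y l)) (MPm τ) :=
        integrable_finsetSum _ fun l _ => ((χν l).const_mul _).mul_const _
      rw [e, ← integral_sub gν i2]
      refine (abs_integral_le_integral_abs).trans ?_
      calc _ ≤ ∫ t, f t * ω ∂(MPm τ) := by
            refine integral_mono_ae (gν.sub i2).abs (fi.mul_const _) ?_
            filter_upwards [ae_mem_Icc (MPm_supp τ)] with t ht
            simp only [hf]
            rw [Finset.sum_mul, ← Finset.sum_sub_distrib, Finset.sum_mul]
            refine (Finset.abs_sum_le_sum_abs _ _).trans (Finset.sum_le_sum fun l hl => ?_)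
            rw [← mul_sub, abs_mul, abs_of_nonneg (mul_nonneg (hcp l hl).le (χ0 l t))]
            rcases eq_or_ne (χ l t) 0 with h | h
            · rw [h]; simp
            · refine mul_le_mul_of_nonneg_left ?_ (mul_nonneg (hcp l hl).le (χ0 l t))
              refine hω _ (χp l (Finset.mem_range.1 hl)).1 _ ?_
              have := χy l t h
              rw [min_eq_right ht.2, max_eq_right ht.1] at this
              linarith
        _ ≤ ω := by rw [integral_mul_const, ff]; nlinarith
    have b2 : |∫ t in A, g t ∂μ - S| ≤ ω := by
      have e : S = ∫ t in A, ∑ l ∈ Finset.range n, χ l t * g (y l) ∂μ := by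
        rw [integral_finsetSum _ fun l _ => (χμ l).mul_const _, hS]
        refine Finset.sum_congr rfl fun l hl => ?_
        rw [integral_mul_const]
      have i2 : Integrable (fun t => ∑ l ∈ Finset.range n, χ l t * g (y l)) (μ.restrict A) :=
        integrable_finsetSum _ fun l _ => (χμ l).mul_const _
      rw [e, ← integral_sub gA i2]
      refine (abs_integral_le_integral_abs).trans ?_
      calc _ ≤ ∫ t in A, ω ∂μ := by
            refine integral_mono_ae (gA.sub i2).abs (integrable_const _) ?_
            filter_upwards [hμA] with t ht
            have e1 : g t = ∑ l ∈ Finset.range n, χ l t * g t := by rw [← Finset.sum_mul, χs, one_mul]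
            have e2 : ω = ∑ l ∈ Finset.range n, χ l t * ω := by rw [← Finset.sum_mul, χs, one_mul]
            rw [e1, ← Finset.sum_sub_distrib]
            conv_rhs => rw [e2]
            refine (Finset.abs_sum_le_sum_abs _ _).trans (Finset.sum_le_sum fun l hl => ?_)
            rw [← mul_sub, abs_mul, abs_of_nonneg (χ0 l t)]
            rcases eq_or_ne (χ l t) 0 with h | h
            · rw [h]; simp
            · refine mul_le_mul_of_nonneg_left ?_ (χ0 l t)
              refine hω _ (χp l (Finset.mem_range.1 hl)).1 _ ?_
              have := χy l t h
              calc |t - y l| = |(t - max (tauM τ) (min (tauP τ) t)) + (max (tauM τ) (min (tauP τ) t) - y l)| := by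
                    congr 1; ring
                _ ≤ _ := abs_add_le _ _
                _ ≤ δ + η := by linarith
        _ ≤ ω := by rw [setIntegral_const, smul_eq_mul]; nlinarith
    rw [abs_le] at b1 b2 ⊢
    constructor <;> linarith [b1.1, b1.2, b2.1, b2.2]

lemma discretize {τ : ℝ} (hτ : 0 < τ) (hτ1 : τ ≤ 1) {μ : Measure ℝ} [IsProbabilityMeasure μ]
    (hac : MPm τ ≪ μ) (hint : Integrable (llr (MPm τ) μ) (MPm τ))
    (hpi : ∀ p : ℝ[X], Integrable (fun x => p.eval x) μ)
    (hS : ∑' x : (ES μ (tauM τ) (tauP τ)), FMP τ x ≠ ⊤) {ε : ℝ} (hε : 0 < ε) (D : ℕ) :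
    ∃ (m : ℕ) (x u : Fin m → ℝ) (f : ℝ → ℝ), Function.Injective x ∧ (∀ j, 0 < x j) ∧
      (∀ j, x j ∉ Icc (tauM τ) (tauP τ)) ∧ (∀ j, 0 < u j) ∧ Continuous f ∧ (∀ t, 0 < f t) ∧
      ∑ j, u j + ∫ t, f t ∂(MPm τ) = 1 ∧
      ∑ j, FF τ (x j) ≤ (∑' x : (ES μ (tauM τ) (tauP τ)), FMP τ x).toReal ∧
      -∫ t, log (f t) ∂(MPm τ) ≤ ∫ t, llr (MPm τ) μ t ∂(MPm τ) ∧
      ∀ i ≤ D, |∑ j, u j * x j ^ i + ∫ t, f t * t^i ∂(MPm τ) - ∫ t, t^i ∂μ| ≤ ε := by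
  have hP := MPm_prob hτ hτ1
  have htM := tauM_nonneg τ
  have hlt := tauM_lt_tauP hτ
  set R := tauP τ + 1 with hR
  have hR1 : 1 ≤ R := by linarith
  set C : ℝ := D * R ^ D with hC
  have hC0 : 0 ≤ C := by positivity
  set δ : ℝ := min (1/2) (ε / (4 * (C + 1))) with hδd
  have hδ : 0 < δ := by positivity
  have hδ2 : δ ≤ 1/2 := min_le_left _ _
  have hδε : 2 * (C * (δ + δ)) ≤ ε := by
    have : δ * (4 * (C+1)) ≤ ε := (le_div_iff₀ (by positivity)).1 (min_le_right _ _)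
    nlinarith
  obtain ⟨c, hc0, hc⟩ := FMP_far hτ hδ
  have hfin := ENNReal.finite_const_le_of_tsum_ne_top hS hc0.ne'
  have hfin2 : {i : ES μ (tauM τ) (tauP τ) | c ≤ FMP τ i ∧ μ {(i:ℝ)} ≠ 0}.Finite := hfin.subset fun i hi => hi.1
  set T := hfin2.toFinset with hT
  set s : Finset ℝ := T.map (Function.Embedding.subtype _) with hs
  have hfv : (MPm τ) (s : Set ℝ) = 0 := by
    rw [MPm_eq]; exact withDensity_absolutelyContinuous _ _ (s.finite_toSet.measure_zero _)
  have hA : MeasurableSet ((s : Set ℝ)ᶜ) := s.measurableSet.compl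
  have hμA : ∀ᵐ t ∂(μ.restrict (s:Set ℝ)ᶜ), |t - max (tauM τ) (min (tauP τ) t)| ≤ δ := by
    rw [ae_restrict_iff' hA]
    have h1 : ∀ᵐ t ∂μ, t ∈ suppSet μ := by
      rw [ae_iff]; exact supp_compl_null μ
    have h2 : ∀ᵐ t ∂μ, t ∉ (Subtype.val '' {i : ES μ (tauM τ) (tauP τ) | c ≤ FMP τ i}) ∩ {t | μ {t} = 0} := by
      rw [ae_iff]
      simp only [not_not]
      have hcnt : ((Subtype.val '' {i : ES μ (tauM τ) (tauP τ) | c ≤ FMP τ i}) ∩ {t | μ {t} = 0}).Countable :=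
        ((hfin.image _).inter_of_left _).countable
      exact (measure_null_iff_singleton hcnt).2 fun t ht => ht.2
    filter_upwards [h1, h2] with t ht1 ht2 ht3
    by_cases hI : t ∈ Icc (tauM τ) (tauP τ)
    · rw [min_eq_right hI.2, max_eq_right hI.1, sub_self, abs_zero]; exact hδ.le
    have hE : t ∈ ES μ (tauM τ) (tauP τ) := ⟨ht1, hI⟩
    have hnf : ¬ (tauP τ + δ ≤ t ∨ t ≤ tauM τ - δ) := by
      intro hf
      have hcf := hc t hf
      by_cases h0 : μ {t} = 0
      · exact ht2 ⟨⟨⟨t, hE⟩, hcf, rfl⟩, h0⟩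
      · refine ht3 ?_
        simp only [hs, hT, Finset.coe_map]
        exact ⟨⟨t, hE⟩, by simpa using ⟨hcf, h0⟩, rfl⟩
    push Not at hnf
    rcases le_total t (tauM τ) with h | h
    · rw [min_eq_right (h.trans hlt.le), max_eq_left h, abs_le]; constructor <;> linarith [hnf.2]
    · rw [max_eq_right (le_min hlt.le h)]
      rcases le_total t (tauP τ) with h' | h'
      · exact absurd ⟨h, h'⟩ hI
      · rw [min_eq_left h', abs_le]; constructor <;> linarith [hnf.1]
  obtain ⟨f, fc, fp, fi, fl, fg⟩ := disc_density hτ hτ1 hac hint hA (by simpa using hfv) hδ hδ.le hμA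
  set x : Fin T.card → ℝ := fun j => ((T.equivFin.symm j : T) : ES μ (tauM τ) (tauP τ)) with hx
  have sumx : ∀ g : ℝ → ℝ, ∑ j, g (x j) = ∑ t ∈ s, g t := by
    intro g
    rw [hs, Finset.sum_map, hx, Equiv.sum_comp T.equivFin.symm (fun i : T => g ((i : ES μ (tauM τ) (tauP τ)) : ℝ)),
      ← Finset.sum_coe_sort T]
    rfl
  have xE : ∀ j, x j ∈ ES μ (tauM τ) (tauP τ) := fun j => Subtype.property _
  have xμ : ∀ j, μ {x j} ≠ 0 := fun j => by
    have := (T.equivFin.symm j).2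
    exact (hfin2.mem_toFinset.1 this).2
  have x0 : ∀ j, 0 < x j := by
    intro j
    by_contra h
    exact ENNReal.ne_top_of_tsum_ne_top hS ⟨x j, xE j⟩ (FMP_top (not_lt.1 h))
  have hdec : ∀ g : ℝ → ℝ, Integrable g μ → ∑ j, μ.real {x j} * g (x j) + ∫ t in (s:Set ℝ)ᶜ, g t ∂μ = ∫ t, g t ∂μ := by
    intro g hg
    rw [← integral_add_compl s.measurableSet hg, sumx (fun t => μ.real {t} * g t), setIntegral_finset s hg.integrableOn]
    rfl
  refine ⟨T.card, x, fun j => μ.real {x j}, f, ?_, x0, fun j => (xE j).2, ?_, fc, fp, ?_, ?_, fl, ?_⟩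
  · exact Subtype.val_injective.comp (Subtype.val_injective.comp T.equivFin.symm.injective)
  · intro j
    exact ENNReal.toReal_pos (xμ j) (measure_ne_top _ _)
  · rw [fi]
    have := hdec (fun _ => 1) (integrable_const _)
    simpa using this
  · have e : ∀ j, FF τ (x j) = (FMP τ (x j)).toReal := fun j => by
      have := FMP_eq hτ hτ1 (x0 j) (xE j).2
      rw [this.1, ENNReal.toReal_ofReal this.2.le]
    rw [Finset.sum_congr rfl fun j _ => e j, sumx (fun t => (FMP τ t).toReal), hs, Finset.sum_map]
    have h := ENNReal.toReal_mono hS (ENNReal.sum_le_tsum T)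
    rw [ENNReal.toReal_sum (fun i _ => ENNReal.ne_top_of_tsum_ne_top hS i)] at h
    exact h
  · intro i hi
    have hgi : Integrable (fun t : ℝ => t^i) μ := by simpa using hpi (X^i)
    have := fg (fun t => t^i) (C * (δ+δ)) (continuous_pow i) hgi (by
      intro y hy t ht
      refine (abs_pow_sub_pow_le t y i).trans ?_
      have hyR : |y| ≤ R := by rw [abs_of_nonneg (htM.trans hy.1)]; linarith [hy.2]
      have htR : |t| ≤ R := by
        have := abs_le.1 ht
        rw [abs_le]; constructor <;> linarith [hy.1, hy.2]
      have hD : (i:ℝ) ≤ D := by exact_mod_cast hi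
      calc |t - y| * i * max |t| |y| ^ (i-1) ≤ (δ+δ) * D * R^(i-1) := by
            gcongr; exact max_le htR hyR
        _ ≤ (δ+δ) * D * R^D := by gcongr; omega
        _ = C * (δ+δ) := by rw [hC]; ring)
    have h2 := hdec (fun t => t^i) hgi
    rw [← h2]
    have e : ∀ a b c : ℝ, a + b - (a + c) = b - c := fun a b c => by ring
    rw [e]
    exact this.trans hδε

lemma Gfun_cont {x : ℝ} (hx : x ≠ 0) : ContinuousAt Gfun x := by
  unfold Gfun; fun_prop (disch := exact hx)

lemma IL_le {τ : ℝ} (hτ : 0 < τ) {z : ℕ → ℝ} (hz : ∀ j, 1 ≤ j → 0 < z j) {C : ℝ≥0∞}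
    (h : ∀ K, ENNReal.ofReal (∑ k ∈ Finset.range K, (τ⁻¹ * Gfun (z (2*k+1)) + Gfun (τ⁻¹ * z (2*k+2)))) ≤ C) :
    IL τ z ≤ C := by
  rw [IL, ENNReal.tsum_eq_iSup_nat]
  refine iSup_le fun K => ?_
  rw [← ENNReal.ofReal_sum_of_nonneg]
  · exact h K
  · intro k _
    have := Gfun_nonneg (hz (2*k+1) (by omega))
    have := Gfun_nonneg (mul_pos (inv_pos.2 hτ) (hz (2*k+2) (by omega)))
    positivity

lemma dirI {τ : ℝ} (hτ : 0 < τ) (hτ1 : τ ≤ 1) {μ : Measure ℝ} [IsProbabilityMeasure μ]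
    (hac : MPm τ ≪ μ) (hint : Integrable (llr (MPm τ) μ) (MPm τ))
    (hpi : ∀ p : ℝ[X], Integrable (fun x => p.eval x) μ)
    (hS : ∑' x : (ES μ (tauM τ) (tauP τ)), FMP τ x ≠ ⊤) {z : ℕ → ℝ} (hz : IsCanonicalZ μ z) :
    IL τ z ≤ ENNReal.ofReal (∫ t, llr (MPm τ) μ t ∂(MPm τ)) + ∑' x : (ES μ (tauM τ) (tauP τ)), FMP τ x := by
  obtain ⟨zpos, zorth⟩ := link hpi hz
  set S := ∑' x : (ES μ (tauM τ) (tauP τ)), FMP τ x with hSd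
  set A := ∫ t, llr (MPm τ) μ t ∂(MPm τ) with hA
  have step : ∀ n : ℕ, ∃ N ≥ n + 1, ∃ (Y W : Fin N → ℝ) (zz : ℕ → ℝ), FinSpec N Y W zz ∧
      (∀ i ≤ n, |Lat Y W (X^i) - Lm μ hpi (X^i)| ≤ 2 * (1/((n:ℝ)+1))) ∧
      Sf (N/τ) (N/τ+1-N) Y - ∑ i, log (W i) - cst (N/τ) (N/τ) N ≤ N * (A + S.toReal + 1/((n:ℝ)+1)) := by
    intro n
    have hε : 0 < 1/((n:ℝ)+1) := by positivity
    obtain ⟨m, x, u, f, xi, x0, xI, u0, fc, fp, h1, h2, h3, h4⟩ := discretize hτ hτ1 hac hint hpi hS hε n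
    obtain ⟨N, hN, Y, W, zz, hF, hm, hs⟩ := disc_limit hτ hτ1 x xi x0 xI u u0 f fc.continuousOn (fun t _ => fp t) h1 hε n (n+1)
    refine ⟨N, hN, Y, W, zz, hF, fun i hi => ?_, hs.trans ?_⟩
    · have a1 := hm i hi
      have a2 := h4 i hi
      rw [Lm_apply]
      simp only [eval_pow, eval_X]
      refine (abs_sub_le _ _ _).trans ((add_le_add a1.le a2).trans (le_of_eq (by ring)))
    · gcongr; linarith
  choose nn hnn Y W zz hF hm hs using step
  have hnt : Tendsto nn atTop atTop := tendsto_atTop_mono (fun n => (Nat.le_succ n).trans (hnn n)) tendsto_id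
  have e0 : Tendsto (fun n : ℕ => 1/((n:ℝ)+1)) atTop (𝓝 0) := tendsto_one_div_add_atTop_nhds_zero_nat
  have Lc : ∀ p, Tendsto (fun n => Lat (Y n) (W n) p) atTop (𝓝 (Lm μ hpi p)) := by
    intro p
    refine (PConv.const atTop p).L (LN := fun n => Lat (Y n) (W n)) fun i _ => ?_
    rw [tendsto_iff_dist_tendsto_zero]
    refine squeeze_zero' (Eventually.of_forall fun _ => dist_nonneg) ?_ (by simpa using e0.const_mul 2)
    filter_upwards [eventually_ge_atTop i] with n hn
    rw [Real.dist_eq]; simpa using hm n i hn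
  have hL1 : Lm μ hpi 1 = 1 := by rw [Lm_apply]; simp
  have zc := coord_conv hnt (fun n => (hF n).orth) zorth hL1 zpos Lc
  have inv0 : ∀ k : ℝ, Tendsto (fun n => k / (nn n : ℝ)) atTop (𝓝 0) := fun k =>
    (tendsto_const_nhds.div_atTop tendsto_natCast_atTop_atTop).comp hnt
  refine IL_le hτ zpos fun K => ?_
  rw [← ENNReal.ofReal_toReal hS]
  refine le_trans (ENNReal.ofReal_le_ofReal ?_) ENNReal.ofReal_add_le
  have lim2 : Tendsto (fun n : ℕ => A + S.toReal + 1/((n:ℝ)+1)) atTop (𝓝 (A + S.toReal)) := by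
    simpa using e0.const_add (A + S.toReal)
  refine le_of_tendsto_of_tendsto (f := fun n => ∑ k ∈ Finset.range K,
    ((τ⁻¹ - k / (nn n : ℝ)) * Gfun (zz n (2*k+1) / (1 - (k * τ) / (nn n : ℝ))) +
     (1 - (1+k) / (nn n : ℝ)) * Gfun (zz n (2*k+2) / (τ * (1 - (1+k)/(nn n : ℝ)))))) ?_ lim2 ?_
  · refine tendsto_finsetSum _ fun k _ => ?_
    have z1 := zpos (2*k+1) (by omega)
    have z2 := zpos (2*k+2) (by omega)
    have t1 : Tendsto (fun n => zz n (2*k+1) / (1 - (k * τ) / (nn n : ℝ))) atTop (𝓝 (z (2*k+1))) := by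
      have := (zc (2*k+1) (by omega)).div (tendsto_const_nhds.sub (inv0 (k*τ))) (by norm_num : (1:ℝ) - 0 ≠ 0)
      rw [sub_zero, div_one] at this; exact this
    have t2 : Tendsto (fun n => zz n (2*k+2) / (τ * (1 - (1+k) / (nn n : ℝ)))) atTop (𝓝 (τ⁻¹ * z (2*k+2))) := by
      have := (zc (2*k+2) (by omega)).div ((tendsto_const_nhds (x := (1:ℝ)).sub (inv0 (1+k))).const_mul τ) (by simpa using hτ.ne')
      rw [show τ⁻¹ * z (2*k+2) = z (2*k+2) / (τ * (1 - 0)) by rw [sub_zero, mul_one]; field_simp]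
      exact this
    have g1 := (Gfun_cont z1.ne').tendsto.comp t1
    have g2 := (Gfun_cont (mul_pos (inv_pos.2 hτ) z2).ne').tendsto.comp t2
    have c1 : Tendsto (fun n => τ⁻¹ - k / (nn n : ℝ)) atTop (𝓝 τ⁻¹) := by simpa using (inv0 k).const_sub τ⁻¹
    have c2 : Tendsto (fun n => 1 - (1+k) / (nn n : ℝ)) atTop (𝓝 1) := by simpa using (inv0 (1+k)).const_sub 1
    have := (c1.mul g1).add (c2.mul g2)
    rw [one_mul] at this
    exact this
  · filter_upwards [hnt.eventually_gt_atTop K] with n hn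
    have hn0 : (0:ℝ) < nn n := by exact_mod_cast (Nat.zero_le K).trans_lt hn
    have hc : (nn n : ℝ) - 1 < nn n / τ := by
      rw [lt_div_iff₀ hτ]; nlinarith
    have hl := (hF n).lower (B := nn n / τ) (c := nn n / τ) (by positivity) hc K hn
    have hh := hs n
    have key : (nn n : ℝ) * ∑ k ∈ Finset.range K,
      ((τ⁻¹ - k / (nn n : ℝ)) * Gfun (zz n (2*k+1) / (1 - (k * τ) / (nn n : ℝ))) +
       (1 - (1+k) / (nn n : ℝ)) * Gfun (zz n (2*k+2) / (τ * (1 - (1+k)/(nn n : ℝ))))) ≤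
       nn n * (A + S.toReal + 1/((n:ℝ)+1)) := by
      refine le_trans (le_of_eq ?_) ((le_sub_iff_add_le'.2 hl).trans hh)
      rw [Finset.mul_sum]
      refine Finset.sum_congr rfl fun k _ => ?_
      have e1 : 1 - (k * τ) / (nn n : ℝ) = gs (nn n/τ) (nn n/τ) (nn n) (2*k+1) := by
        rw [gs_odd]; field_simp
      have e2 : τ * (1 - (1+k)/(nn n : ℝ)) = gs (nn n/τ) (nn n/τ) (nn n) (2*k+2) := by
        rw [gs_even]; field_simp; ring
      rw [e1, e2]; field_simp; ring
    exact le_of_mul_le_mul_left key hn0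

lemma sum_ite_eq_le (n a : ℕ) {c : ℝ} (hc : 0 ≤ c) : ∑ l : Fin n, (if (l:ℕ) = a then c else 0) ≤ c := by
  rw [Fin.sum_univ_eq_sum_range (fun l => if l = a then c else 0) n, Finset.sum_ite_eq']
  split_ifs <;> simp [hc]

lemma sum_ite_lt_le (n a : ℕ) {c : ℝ} (hc : 0 ≤ c) : ∑ l : Fin n, (if (l:ℕ) < a then c else 0) ≤ a * c := by
  rw [Fin.sum_univ_eq_sum_range (fun l => if l < a then c else 0) n, ← Finset.sum_filter, Finset.sum_const, nsmul_eq_mul]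
  gcongr
  calc _ ≤ (Finset.range a).card := Finset.card_le_card fun x hx => by
        simp only [Finset.mem_filter] at hx; exact Finset.mem_range.2 hx.2
    _ = a := Finset.card_range a

lemma Jent_le {z : ℕ → ℝ} {b : ℝ} {n : ℕ} (hb : 0 ≤ b) (hz : ∀ j, 1 ≤ j → j < 2*n → 0 ≤ z j ∧ z j ≤ b) {k l : ℕ}
    (hk : k < n) (hl : l < n) : |Jent z k l| ≤ (if l = k then 2*b else 0) + (if l = k+1 then b else 0) + (if l = k-1 then b else 0) := by
  have hJa : ∀ k, k + 1 < n → |Ja z k| ≤ b := fun k hk => by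
    rw [Ja, abs_of_nonneg (Real.sqrt_nonneg _)]
    refine Real.sqrt_le_iff.2 ⟨hb, ?_⟩
    have h1 := hz (2*k+1) (by omega) (by omega)
    have h2 := hz (2*k+2) (by omega) (by omega)
    nlinarith [mul_le_mul h1.2 h2.2 h2.1 hb]
  unfold Jent
  refine (abs_add_le _ _).trans (add_le_add ((abs_add_le _ _).trans (add_le_add ?_ ?_)) ?_)
  · split_ifs with h
    · unfold Jb
      split_ifs with h0
      · have := hz 1 le_rfl (by omega); rw [abs_of_nonneg this.1]; linarith [this.2]
      · have h1 := hz (2*k) (by omega) (by omega)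
        have h2 := hz (2*k+1) (by omega) (by omega)
        rw [abs_of_nonneg (by linarith [h1.1, h2.1])]; linarith [h1.2, h2.2]
    · simp
  · split_ifs with h
    · exact hJa k (by omega)
    · simp
  · split_ifs with h h' h'
    · exact hJa l (by omega)
    · omega
    · simpa using hb
    · simp

lemma Jpow_bound {z : ℕ → ℝ} {b : ℝ} {n : ℕ} (hb : 0 ≤ b) (hz : ∀ j, 1 ≤ j → j < 2*n → 0 ≤ z j ∧ z j ≤ b)
    (p : ℕ) (i j : Fin n) : |((Jmat n z)^p) i j| ≤ (4*b)^p := by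
  induction p generalizing i j with
  | zero => rw [pow_zero, pow_zero, Matrix.one_apply]; split_ifs <;> simp
  | succ p ih =>
    rw [pow_succ', Matrix.mul_apply, pow_succ', show 4*b = 2*b + b + b by ring]
    refine (Finset.abs_sum_le_sum_abs _ _).trans ?_
    have h1 : ∀ l : Fin n, |Jmat n z i l * ((Jmat n z)^p) l j| ≤
        ((if (l:ℕ) = i then 2*b else 0) + (if (l:ℕ) = i+1 then b else 0) + (if (l:ℕ) = i-1 then b else 0)) * (4*b)^p := by
      intro l
      rw [abs_mul]
      have := Jent_le hb hz i.2 l.2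
      exact mul_le_mul this (ih l j) (abs_nonneg _) ((abs_nonneg _).trans this)
    refine (Finset.sum_le_sum fun l _ => h1 l).trans ?_
    rw [← Finset.sum_mul, Finset.sum_add_distrib, Finset.sum_add_distrib, show 4*b = 2*b + b + b by ring]
    gcongr
    · exact sum_ite_eq_le _ _ (by linarith)
    · exact sum_ite_eq_le _ _ hb
    · exact sum_ite_eq_le _ _ hb

lemma Jpow_eq {z z' : ℕ → ℝ} {n K : ℕ} (h : ∀ j, 2*K < j → z j = z' j) (p : ℕ) (i j : Fin n) (hi : K + 1 + p ≤ i) :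
    ((Jmat n z)^p) i j = ((Jmat n z')^p) i j := by
  induction p generalizing i j with
  | zero => simp
  | succ p ih =>
    rw [pow_succ', pow_succ', Matrix.mul_apply, Matrix.mul_apply]
    refine Finset.sum_congr rfl fun l _ => ?_
    have e : Jmat n z i l = Jmat n z' i l := by
      simp only [Jmat, Jent]
      have hJ : ∀ k, K ≤ k → Ja z k = Ja z' k := fun k hk => by
        rw [Ja, Ja, h _ (by omega), h _ (by omega)]
      have hB : Jb z i = Jb z' i := by
        rw [Jb, Jb, if_neg (by omega), if_neg (by omega), h _ (by omega), h _ (by omega)]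
      congr 1
      · rw [hB, hJ _ (by omega)]
      · split_ifs with hh
        · exact hJ _ (by omega)
        · rfl
    rw [e]
    by_cases hl : K + 1 + p ≤ l
    · rw [ih l j hl]
    · have : Jmat n z' i l = 0 := by
        simp only [Jmat, Jent]
        rw [if_neg (by omega), if_neg (by omega), if_neg (by omega)]; simp
      rw [this, zero_mul, zero_mul]

lemma trace_diff {z z' : ℕ → ℝ} {b : ℝ} {n K : ℕ} (hb : 0 ≤ b) (hz : ∀ j, 1 ≤ j → j < 2*n → 0 ≤ z j ∧ z j ≤ b)
    (hz' : ∀ j, 1 ≤ j → j < 2*n → 0 ≤ z' j ∧ z' j ≤ b) (h : ∀ j, 2*K < j → z j = z' j) (p : ℕ) :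
    |((Jmat n z)^p).trace - ((Jmat n z')^p).trace| ≤ ((K + 1 + p : ℕ):ℝ) * (2 * (4*b)^p) := by
  rw [Matrix.trace, Matrix.trace, ← Finset.sum_sub_distrib]
  refine (Finset.abs_sum_le_sum_abs _ _).trans (le_trans (Finset.sum_le_sum fun i _ => ?_)
    (sum_ite_lt_le n (K+1+p) (by positivity)))
  simp only [Matrix.diag_apply]
  split_ifs with hi
  · refine (abs_sub _ _).trans ?_
    linarith [Jpow_bound hb hz p i i, Jpow_bound hb hz' p i i]
  · rw [Jpow_eq h p i i (by omega)]; simp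

lemma le_of_Gfun {x M : ℝ} (hx : 0 < x) (h : Gfun x ≤ M) : x ≤ 2 * (M + 1) := by
  unfold Gfun at h
  have := Real.log_le_sub_one_of_pos (half_pos hx)
  rw [Real.log_div hx.ne' two_ne_zero] at this
  have := Real.log_two_lt_d9
  linarith

lemma sqrt_lim : Tendsto Nat.sqrt atTop atTop :=
  tendsto_atTop_atTop.2 fun b => ⟨b*b, fun _ ha => Nat.le_sqrt.2 ha⟩

lemma sqrt_ratio (p : ℕ) (c : ℝ) : Tendsto (fun N : ℕ => (((Nat.sqrt N + 1 + p : ℕ):ℝ) * c) / ((N+1:ℕ):ℝ)) atTop (𝓝 0) := by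
  have h1 : Tendsto (fun N : ℕ => (Nat.sqrt N : ℝ) / ((N+1:ℕ):ℝ)) atTop (𝓝 0) := by
    refine squeeze_zero (fun N => by positivity) (fun N => ?_)
      (tendsto_inv_atTop_zero.comp (tendsto_natCast_atTop_atTop.comp sqrt_lim))
    simp only [Function.comp]
    rcases Nat.eq_zero_or_pos (Nat.sqrt N) with h | h
    · simp [h]
    · have h0 : (0:ℝ) < Nat.sqrt N := by exact_mod_cast h
      have h2 : (Nat.sqrt N : ℝ) * Nat.sqrt N ≤ N := by exact_mod_cast Nat.sqrt_le N
      rw [div_le_iff₀ (by positivity), ← div_eq_inv_mul, le_div_iff₀ h0]; push_cast; linarith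
  have h2 : Tendsto (fun N : ℕ => ((1 + p : ℕ):ℝ) / ((N+1:ℕ):ℝ)) atTop (𝓝 0) :=
    tendsto_const_nhds.div_atTop (tendsto_natCast_atTop_atTop.comp (tendsto_add_atTop_nat 1))
  have := (h1.add h2).mul_const c
  simp only [add_zero, zero_mul] at this
  refine this.congr fun N => ?_
  push_cast; ring

lemma approx {τ : ℝ} (hτ : 0 < τ) (hτ1 : τ ≤ 1) {μ : Measure ℝ} [IsProbabilityMeasure μ]
    (hpos : μ (Iio 0) = 0) (hcs : ∃ R, μ (Icc (-R) R)ᶜ = 0)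
    (hpi : ∀ p : ℝ[X], Integrable (fun x => p.eval x) μ) {z : ℕ → ℝ} (hz : IsCanonicalZ μ z) {I : ℝ}
    (hI : ∀ K, ∑ k ∈ Finset.range K, (τ⁻¹ * Gfun (z (2*k+1)) + Gfun (τ⁻¹ * z (2*k+2))) ≤ I) :
    ∃ (R : ℝ) (x w : (N : ℕ) → Fin (N+1) → ℝ), (∀ N, Function.Injective (x N)) ∧ (∀ N i, 0 < x N i) ∧
      (∀ N i, 0 < w N i) ∧ (∀ N, Sf (((N+1:ℕ):ℝ)/τ) (((N+1:ℕ):ℝ)/τ + 1 - (N+1:ℕ)) (x N) - ∑ i, log (w N i)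
        ≤ cst (((N+1:ℕ):ℝ)/τ) (((N+1:ℕ):ℝ)/τ) (N+1) + (N+1:ℕ) * I) ∧
      (∀ f : ℝ → ℝ, ContinuousOn f (Icc 0 R) →
        Tendsto (fun N => ∑ i, 1 / ((N+1 : ℕ):ℝ) * f (x N i)) atTop (𝓝 (∫ t, f t ∂(MPm τ)))) ∧
      (∀ f : ℝ → ℝ, ContinuousOn f (Icc 0 R) →
        Tendsto (fun N => ∑ i, w N i * f (x N i)) atTop (𝓝 (∫ t, f t ∂μ))) := by
  obtain ⟨zpos, zorth⟩ := link hpi hz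
  have hP := MPm_prob hτ hτ1
  obtain ⟨R0, hR0⟩ := hcs
  have zMP_pos : ∀ j, 0 < zMP τ j := fun j => by unfold zMP; split_ifs <;> linarith
  set r : ℕ → ℝ := fun j => z j / zMP τ j with hr
  have hr1 : ∀ k, r (2*k+1) = z (2*k+1) := fun k => by rw [hr]; simp only []; rw [zMP_odd, div_one]
  have hr2 : ∀ k, r (2*k+2) = τ⁻¹ * z (2*k+2) := fun k => by
    rw [hr]; simp only []; rw [zMP_even, div_eq_inv_mul]
  have rpos : ∀ j, 1 ≤ j → 0 < r j := fun j hj => div_pos (zpos j hj) (zMP_pos j)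
  have gnn : ∀ k, 0 ≤ τ⁻¹ * Gfun (z (2*k+1)) ∧ 0 ≤ Gfun (τ⁻¹ * z (2*k+2)) := fun k =>
    ⟨mul_nonneg (inv_pos.2 hτ).le (Gfun_nonneg (zpos _ (by omega))),
      Gfun_nonneg (mul_pos (inv_pos.2 hτ) (zpos _ (by omega)))⟩
  have hI0 : 0 ≤ I := by simpa using hI 0
  have gI : ∀ k, τ⁻¹ * Gfun (z (2*k+1)) + Gfun (τ⁻¹ * z (2*k+2)) ≤ I := fun k =>
    (Finset.single_le_sum (f := fun k => τ⁻¹ * Gfun (z (2*k+1)) + Gfun (τ⁻¹ * z (2*k+2)))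
      (fun k _ => add_nonneg (gnn k).1 (gnn k).2) (Finset.self_mem_range_succ k)).trans (hI (k+1))
  set b := 2 * (I + 1) with hb
  have rb : ∀ j, 1 ≤ j → r j ≤ b := by
    intro j hj
    refine le_of_Gfun (rpos j hj) ?_
    obtain ⟨k, rfl | rfl⟩ : ∃ k, j = 2*k+1 ∨ j = 2*k+2 := ⟨(j-1)/2, by omega⟩
    · rw [hr1]
      have h1 := gI k
      have h2 := (gnn k).2
      have h3 := Gfun_nonneg (zpos (2*k+1) (by omega))
      have h4 : 1 ≤ τ⁻¹ := (one_le_inv₀ hτ).2 hτ1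
      nlinarith
    · rw [hr2]; linarith [gI k, (gnn k).1]
  have hb1 : 1 ≤ b := by rw [hb]; linarith
  set B : ℕ → ℝ := fun N => ((N+1:ℕ):ℝ)/τ with hB
  have Bpos : ∀ N, 0 < B N := fun N => by rw [hB]; simp only []; positivity
  have BN0 : ∀ N, BN τ 0 N = B N := fun N => by rw [hB]; simp only [BN, Nat.zero_add]
  have Bc : ∀ N, ((N+1 : ℕ):ℝ) - 1 < B N := fun N => by
    have := BN_c hτ hτ1 0 N; rw [BN0] at this; simpa using this
  set g : ℕ → ℕ → ℝ := fun N j => gs (B N) (B N) (N+1) j with hg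
  have gpos : ∀ N j, 1 ≤ j → j < 2*(N+1) → 0 < g N j := fun N j => gs_pos (Bpos N) (Bc N) j
  have g1 : ∀ N j, 1 ≤ j → g N j ≤ 1 := by
    intro N j hj
    obtain ⟨k, rfl | rfl⟩ : ∃ k, j = 2*k+1 ∨ j = 2*k+2 := ⟨(j-1)/2, by omega⟩
    · rw [hg]; simp only []; rw [gs_odd, div_le_one (Bpos N)]; linarith [Nat.cast_nonneg (α := ℝ) k]
    · rw [hg]; simp only []; rw [gs_even, div_le_one (Bpos N)]; linarith [Nat.cast_nonneg (α := ℝ) k, Bc N]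
  set zN : ℕ → ℕ → ℝ := fun N j => if j ≤ 2 * Nat.sqrt N then r j * g N j else g N j with hzN
  have sqN : ∀ N, Nat.sqrt N ≤ N := Nat.sqrt_le_self
  have zNpos : ∀ N j, 1 ≤ j → j < 2*(N+1) → 0 < zN N j := by
    intro N j h1 h2
    simp only [hzN]
    split_ifs
    · exact mul_pos (rpos j h1) (gpos N j h1 h2)
    · exact gpos N j h1 h2
  have zNb : ∀ N j, 1 ≤ j → j < 2*(N+1) → zN N j ≤ b := by
    intro N j h1 h2
    simp only [hzN]
    split_ifs
    · have := rb j h1; have := rpos j h1; have := g1 N j h1; have := gpos N j h1 h2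
      nlinarith
    · linarith [g1 N j h1]
  have zNlast : ∀ N, zN N (2*(N+1)) = 0 := by
    intro N
    simp only [hzN]
    rw [if_neg (by have := sqN N; omega)]; exact gs_last _ _ _
  choose x w hF htr using fun N => favard (Nat.succ_pos N) (zNpos N) (zNlast N)
  have hxR : ∀ N i, x N i ≤ 4 * b := by
    intro N i
    have hs : √b ^ 2 = b := Real.sq_sqrt (by linarith)
    have := (hF N).atom_lt (a := √b) (b := √b) (Real.sqrt_pos.2 (by linarith)) (Real.sqrt_pos.2 (by linarith))
      (fun k hk => by rw [hs]; exact zNb N _ (by omega) (by omega))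
      (fun k hk => by rw [hs]; exact zNb N _ (by omega) (by omega)) i
    nlinarith
  set R := max (max (4*b) R0) (tauP τ) with hR
  have hxI : ∀ N i, x N i ∈ Icc 0 R := fun N i => ⟨((hF N).xpos i).le,
    (hxR N i).trans ((le_max_left _ _).trans (le_max_left _ _))⟩
  have hμR : μ (Icc 0 R)ᶜ = 0 := by
    refine measure_mono_null (t := Iio 0 ∪ (Icc (-R0) R0)ᶜ) ?_ (measure_union_null hpos hR0)
    intro t ht
    by_contra h
    simp only [mem_union, mem_Iio, mem_compl_iff, not_or, not_not, not_lt] at h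
    exact ht ⟨h.1, h.2.2.trans ((le_max_right _ _).trans (le_max_left _ _))⟩
  have hMR : (MPm τ) (Icc 0 R)ᶜ = 0 := by
    refine measure_mono_null (compl_subset_compl.2 (Icc_subset_Icc (tauM_nonneg τ) (le_max_right _ _))) (MPm_supp τ)
  have glim : ∀ j, 1 ≤ j → Tendsto (fun N => g N j) atTop (𝓝 (zMP τ j)) := by
    intro j hj
    have := gs_lim hτ 0 j hj
    simpa only [BN0, Nat.cast_zero, sub_zero] using this
  refine ⟨R, x, w, fun N => (hF N).inj, fun N => (hF N).xpos, fun N => (hF N).wpos, ?_, ?_, ?_⟩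
  · intro N
    rw [(hF N).gform (Bpos N) (Bc N)]
    gcongr
    rw [← Finset.sum_subset (Finset.range_subset_range.2 (show Nat.sqrt N ≤ N+1 by have := sqN N; omega))]
    · refine le_trans ?_ (mul_le_mul_of_nonneg_left (hI (Nat.sqrt N)) (Nat.cast_nonneg _))
      rw [Finset.mul_sum]
      refine Finset.sum_le_sum fun k hk => ?_
      have hk' := Finset.mem_range.1 hk
      have hkN := sqN N
      have e : ∀ j, 1 ≤ j → j ≤ 2 * Nat.sqrt N → zN N j / gs (B N) (B N) (N+1) j = r j := by
        intro j h1 h2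
        simp only [hzN]; rw [if_pos h2]
        exact mul_div_cancel_right₀ _ (gpos N j h1 (by omega)).ne'
      rw [e _ (by omega) (by omega), e _ (by omega) (by omega), hr1, hr2]
      have h1 := Gfun_nonneg (zpos (2*k+1) (by omega))
      have h2 := (gnn k).2
      have hk0 : (0:ℝ) ≤ k := Nat.cast_nonneg k
      have hBe : B N = ((N+1:ℕ):ℝ) * τ⁻¹ := by rw [hB]; simp only []; rw [div_eq_mul_inv]
      rw [hBe]
      nlinarith [mul_nonneg hk0 h1, mul_nonneg hk0 h2]
    · intro k hk hk'
      have hk1 := Finset.mem_range.1 hk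
      have hk2 : Nat.sqrt N ≤ k := by simpa using hk'
      have e1 : zN N (2*k+1) / gs (B N) (B N) (N+1) (2*k+1) = 1 := by
        simp only [hzN]; rw [if_neg (by omega)]; exact div_self (gpos N _ (by omega) (by omega)).ne'
      rw [e1, Gfun_one, mul_zero, zero_add]
      rcases Nat.lt_succ_iff_lt_or_eq.1 hk1 with h | h
      · have e2 : zN N (2*k+2) / gs (B N) (B N) (N+1) (2*k+2) = 1 := by
          simp only [hzN]; rw [if_neg (by omega)]; exact div_self (gpos N _ (by omega) (by omega)).ne'
        rw [e2, Gfun_one, mul_zero]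
      · rw [h]; push_cast; ring
  · intro f hf
    have hn : ∀ N : ℕ, (0:ℝ) < ((N+1:ℕ):ℝ) := fun N => by positivity
    refine weak_conv (n := fun N => N+1) (x := x) (w := fun N _ => 1 / ((N+1 : ℕ):ℝ)) hMR hxI
      (fun N _ => by positivity) (fun N => ?_) (fun p => ?_) hf
    · rw [Finset.sum_const, Finset.card_univ, Fintype.card_fin, nsmul_eq_mul]
      have := (hn N).ne'; field_simp
    obtain ⟨y, -, -, -, -, yc, yt⟩ := ground_seq hτ hτ1 0
    have pw : ∀ q : ℕ, Tendsto (fun N => ∑ i, 1 / ((N+1 : ℕ):ℝ) * (x N i)^q) atTop (𝓝 (∫ t, t^q ∂(MPm τ))) := by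
      intro q
      have h1 := yc (fun t => t^q) (continuous_pow q).continuousOn
      have h2 : Tendsto (fun N => ∑ i, 1 / ((N+1 : ℕ):ℝ) * (x N i)^q - ∑ i, 1 / ((N+1 : ℕ):ℝ) * (y N i)^q) atTop (𝓝 0) := by
        refine squeeze_zero_norm (fun N => ?_) (sqrt_ratio q (2 * (4*b)^q))
        rw [← Finset.mul_sum, ← Finset.mul_sum, ← mul_sub, ← htr, ← yt N q, Real.norm_eq_abs, abs_mul,
          abs_of_pos (one_div_pos.2 (hn N)), one_div, div_eq_inv_mul]
        refine mul_le_mul_of_nonneg_left ?_ (inv_pos.2 (hn N)).le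
        rw [BN0, Nat.cast_zero, sub_zero]
        refine trace_diff (z := zN N) (z' := g N) (n := N+1) (by linarith) (fun j h1 h2 => ⟨(zNpos N j h1 h2).le, zNb N j h1 h2⟩)
          (fun j h1 h2 => ⟨(gpos N j h1 h2).le, (g1 N j h1).trans hb1⟩) (fun j hj => ?_) q
        simp only [hzN]; rw [if_neg (by omega)]
      have := h2.add h1
      simpa using this
    have hpM : ∀ p : ℝ[X], Integrable (fun x => p.eval x) (MPm τ) := fun p =>
      integrable_of_contOn hMR p.continuous.continuousOn
    have := (PConv.const atTop p).L (LN := fun N => Lat (x N) (fun _ => 1 / ((N+1 : ℕ):ℝ))) (L := Lm (MPm τ) hpM)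
      fun i _ => by
        simpa only [Lat_apply, Lm_apply, eval_pow, eval_X] using pw i
    exact this
  · intro f hf
    refine weak_conv (n := fun N => N+1) (x := x) (w := w) hμR hxI
      (fun N i => ((hF N).wpos i).le) (fun N => (hF N).wsum) (fun p => ?_) hf
    refine func_conv (zN := zN) (z := z) (LN := fun N => Lat (x N) (w N)) (L := Lm μ hpi) (nN := fun N => N+1)
      (tendsto_add_atTop_nat 1) (fun N => (hF N).orth) (fun N => ?_) zorth ?_ (fun j hj => ?_) p
    · rw [Lat_apply]; simpa using (hF N).wsum
    · rw [Lm_apply]; simp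
    · have h1 := (glim j hj).const_mul (r j)
      have e : r j * zMP τ j = z j := by rw [hr]; simp only []; have := (zMP_pos j).ne'; field_simp
      rw [e] at h1
      refine h1.congr' ?_
      filter_upwards [sqrt_lim.eventually_ge_atTop j] with N hN
      simp only [hzN]; rw [if_pos (by omega)]

def hh (η t : ℝ) : ℝ := log (max |t| η)

lemma hh_cont {η : ℝ} (hη : 0 < η) : Continuous (hh η) := by
  unfold hh
  exact Continuous.log (by fun_prop) fun t => (lt_max_of_lt_right hη).ne'

lemma hh_lip {η : ℝ} (hη : 0 < η) (s t : ℝ) : hh η s ≤ hh η t + |s - t| / η := by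
  have ha : 0 < max |s| η := lt_max_of_lt_right hη
  have hb : 0 < max |t| η := lt_max_of_lt_right hη
  have h1 : max |s| η ≤ max |t| η + |s - t| := by
    refine max_le ?_ (by linarith [le_max_right |t| η, abs_nonneg (s-t)])
    have := abs_sub_abs_le_abs_sub s t
    linarith [le_max_left |t| η]
  have h2 := Real.log_le_sub_one_of_pos (div_pos ha hb)
  rw [Real.log_div ha.ne' hb.ne'] at h2
  have h3 : max |s| η / max |t| η - 1 ≤ |s - t| / η := by
    rw [div_sub_one hb.ne']
    exact div_le_div₀ (abs_nonneg _) (by linarith) hη (le_max_right _ _)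
  unfold hh; linarith

lemma le_hh {η : ℝ} (hη : 0 < η) {t : ℝ} (ht : t ≠ 0) : log |t| ≤ hh η t :=
  Real.log_le_log (abs_pos.2 ht) (le_max_left _ _)

lemma exists_perm {m M : ℕ} {i : Fin m → Fin (m+M)} (hi : Function.Injective i) :
    ∃ σ : Equiv.Perm (Fin (m+M)), ∀ j, σ (Fin.castAdd M j) = i j := by
  let e := (Equiv.ofInjective (Fin.castAdd (n := m) M) (Fin.castAdd_injective m M)).symm.trans (Equiv.ofInjective i hi)
  refine ⟨e.extendSubtype, fun j => ?_⟩
  rw [Equiv.extendSubtype_apply_of_mem e _ ⟨j, rfl⟩]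
  have : (⟨Fin.castAdd M j, ⟨j, rfl⟩⟩ : Set.range (Fin.castAdd (n := m) M)) =
    Equiv.ofInjective (Fin.castAdd (n := m) M) (Fin.castAdd_injective m M) j := rfl
  simp only [e, Equiv.trans_apply]
  erw [this, Equiv.symm_apply_apply]
  rfl

lemma Sf_perm {n : ℕ} (B a : ℝ) (x : Fin n → ℝ) (σ : Equiv.Perm (Fin n)) : Sf B a (x ∘ σ) = Sf B a x := by
  simp only [Sf, En, Function.comp]
  rw [Equiv.sum_comp σ x, Equiv.sum_comp σ (fun i => log (x i)),
    Equiv.sum_comp σ (fun i => ∑ j, log |x i - x (σ j)|)]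
  congr 1
  exact Finset.sum_congr rfl fun i _ => Equiv.sum_comp σ (fun j => log |x i - x j|)

lemma core {m N : ℕ} {B θ : ℝ} (hB : 0 < B) (hBn : ((m+(N+1):ℕ):ℝ) ≤ B) (hθ : 0 < θ)
    {Y W : Fin (m+(N+1)) → ℝ} (hY : Function.Injective Y) (hY0 : ∀ i, 0 < Y i) (hW : ∀ i, 0 < W i)
    {i : Fin m → Fin (m+(N+1))} (hi : Function.Injective i) (η xs : Fin m → ℝ) (hη : ∀ j, 0 < η j) (f : ℝ → ℝ) :
    cst B (B-m) (N+1) + ∑ j, (B * Y (i j) - (B+1-(m+(N+1):ℕ)) * log (max (Y (i j)) θ)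
      - 2 * (∑ k, hh (η j) (xs j - Y k) - ∑ k, hh (η j) (xs j - Y (i k))
        + (m+(N+1):ℕ) * (|Y (i j) - xs j| / η j))) - En (fun j => Y (i j))
      + (∑ k, f (Y k) - (m+(N+1):ℕ) * ∑ k, W k * exp (f (Y k)) + (m+(N+1):ℕ))
      ≤ Sf B (B+1-(m+(N+1):ℕ)) Y - ∑ k, log (W k) := by
  obtain ⟨σ, hσ⟩ := exists_perm hi
  set n : ℝ := ((m+(N+1):ℕ):ℝ) with hn
  have hne : n = m + ((N+1:ℕ):ℝ) := by rw [hn]; push_cast; ring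
  have hN1 : (0:ℝ) < ((N+1:ℕ):ℝ) := by positivity
  have hm0 : (0:ℝ) ≤ m := Nat.cast_nonneg m
  have hn0 : 0 < n := by rw [hne]; linarith
  set Z := Y ∘ σ with hZ
  set y1 : Fin m → ℝ := fun j => Z (Fin.castAdd (N+1) j) with hy1
  set y2 : Fin (N+1) → ℝ := fun j => Z (Fin.natAdd m j) with hy2
  have hap : Fin.append y1 y2 = Z := Fin.append_castAdd_natAdd
  have hZi : Function.Injective Z := hY.comp σ.injective
  have y1e : ∀ j, y1 j = Y (i j) := fun j => by simp only [hy1, hZ, Function.comp]; rw [hσ]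
  have hS : Sf B (B+1-n) Y = Sf B (B+1-n) y2
      + ∑ j, (B * y1 j - (B+1-n) * log (y1 j) - 2 * ∑ i, log |y1 j - y2 i|) - En y1 := by
    rw [← Sf_append, hap, hZ, Sf_perm]
  have hE := energy_lower (Nat.succ_pos N) (x := y2) (hZi.comp (Fin.natAdd_injective _ _)) (fun _ => hY0 _)
    hB (c := B - m) (by linarith [hne, hBn] : ((N+1:ℕ):ℝ) - 1 < B - m)
  have ea : B - m + 1 - ((N+1:ℕ):ℝ) = B + 1 - n := by rw [hne]; ring
  have hE' : cst B (B-m) (N+1) ≤ Sf B (B+1-n) y2 + n * log n := by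
    rw [← ea]
    refine hE.trans ?_
    gcongr
    · rw [Nat.succ_eq_add_one, hne]; linarith
    · rw [Nat.succ_eq_add_one, hne]; linarith
  have hw : n * log n + (∑ k, f (Y k) - n * ∑ k, W k * exp (f (Y k)) + n) ≤ - ∑ k, log (W k) := by
    have h1 : ∀ k, log n + f (Y k) - n * (W k * exp (f (Y k))) + 1 ≤ - log (W k) := by
      intro k
      have hp : 0 < n * (W k * exp (f (Y k))) := mul_pos hn0 (mul_pos (hW k) (exp_pos _))
      have := Real.log_le_sub_one_of_pos hp
      rw [Real.log_mul hn0.ne' (mul_pos (hW k) (exp_pos _)).ne', Real.log_mul (hW k).ne' (exp_pos _).ne', Real.log_exp] at this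
      linarith
    have h2 := Finset.sum_le_sum fun k (_ : k ∈ Finset.univ) => h1 k
    simp only [Finset.sum_add_distrib, Finset.sum_sub_distrib, Finset.sum_const, Finset.card_univ, Fintype.card_fin,
      nsmul_eq_mul, ← Finset.mul_sum, Finset.sum_neg_distrib, mul_one] at h2
    rw [← hn] at h2
    linarith
  have hEn : En (fun j => Y (i j)) = En y1 := by congr 1; ext j; exact (y1e j).symm
  have hj : ∀ j, B * Y (i j) - (B+1-n) * log (max (Y (i j)) θ)
      - 2 * (∑ k, hh (η j) (xs j - Y k) - ∑ k, hh (η j) (xs j - Y (i k)) + n * (|Y (i j) - xs j| / η j)) ≤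
      B * y1 j - (B+1-n) * log (y1 j) - 2 * ∑ i, log |y1 j - y2 i| := by
    intro j
    have hsplit : ∑ k, hh (η j) (xs j - Y k) = ∑ k, hh (η j) (xs j - Y (i k)) + ∑ k, hh (η j) (xs j - y2 k) := by
      rw [← Equiv.sum_comp σ, Fin.sum_univ_add (a := m)]
      congr 1
      exact Finset.sum_congr rfl fun k _ => by rw [hσ]
    rw [hsplit, y1e]
    have h1 : log (Y (i j)) ≤ log (max (Y (i j)) θ) := Real.log_le_log (hY0 _) (le_max_left _ _)
    have h2 : ∑ k, log |Y (i j) - y2 k| ≤ ∑ k, hh (η j) (xs j - y2 k) + n * (|Y (i j) - xs j| / η j) := by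
      have h3 : ∀ k, log |Y (i j) - y2 k| ≤ hh (η j) (xs j - y2 k) + |Y (i j) - xs j| / η j := by
        intro k
        have hne' : Y (i j) - y2 k ≠ 0 := by
          rw [← y1e, sub_ne_zero]
          intro h
          have := congrArg Fin.val (hZi h)
          simp at this; have := j.2; omega
        have := hh_lip (hη j) (Y (i j) - y2 k) (xs j - y2 k)
        rw [show Y (i j) - y2 k - (xs j - y2 k) = Y (i j) - xs j by ring] at this
        exact (le_hh (hη j) hne').trans this
      refine (Finset.sum_le_sum fun k _ => h3 k).trans ?_
      rw [Finset.sum_add_distrib, Finset.sum_const, Finset.card_univ, Fintype.card_fin, nsmul_eq_mul]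
      have : 0 ≤ |Y (i j) - xs j| / η j := div_nonneg (abs_nonneg _) (hη j).le
      gcongr
      rw [hne]; linarith
    nlinarith [mul_le_mul_of_nonneg_left h1 (by linarith : 0 ≤ B + 1 - n)]
  have hsum := Finset.sum_le_sum fun j (_ : j ∈ Finset.univ) => hj j
  rw [hS, hEn]
  linarith

lemma near {μ : Measure ℝ} [IsProbabilityMeasure μ] {x w : (N : ℕ) → Fin (N+1) → ℝ}
    (hlim : ∀ f : ℝ → ℝ, Continuous f → Tendsto (fun N => ∑ i, w N i * f (x N i)) atTop (𝓝 (∫ t, f t ∂μ)))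
    {xs : ℝ} (hxs : xs ∈ suppSet μ) :
    ∃ i : (N : ℕ) → Fin (N+1), Tendsto (fun N => x N (i N)) atTop (𝓝 xs) := by
  have h : ∀ N, ∃ i : Fin (N+1), ∀ k, |x N i - xs| ≤ |x N k - xs| := fun N =>
    Finite.exists_min (fun i => |x N i - xs|)
  choose i hi using h
  refine ⟨i, ?_⟩
  rw [Metric.tendsto_nhds]
  intro ε hε
  set φ : ℝ → ℝ := fun t => max 0 (ε - |t - xs|) with hφ
  have hc : Continuous φ := by fun_prop
  have h0 : ∀ t, 0 ≤ φ t := fun t => le_max_left _ _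
  have hint : Integrable φ μ := bdd_int hc.measurable (K := ε) fun t => by
    rw [abs_of_nonneg (h0 t)]
    exact max_le hε.le (by linarith [abs_nonneg (t - xs)])
  have hp : 0 < ∫ t, φ t ∂μ := by
    rw [integral_pos_iff_support_of_nonneg h0 hint]
    refine lt_of_lt_of_le (pos_iff_ne_zero.2 (hxs _ (Metric.ball_mem_nhds xs hε))) (measure_mono ?_)
    intro t ht
    rw [Metric.mem_ball, Real.dist_eq] at ht
    exact (lt_max_of_lt_right (by linarith)).ne'
  filter_upwards [(hlim φ hc).eventually (lt_mem_nhds hp)] with N hN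
  by_contra hcon
  refine hN.ne' (Finset.sum_eq_zero fun k _ => ?_)
  rw [Real.dist_eq, not_lt] at hcon
  have : φ (x N k) = 0 := max_eq_left (by linarith [hi N k])
  rw [this, mul_zero]

def FFt (τ θ x : ℝ) : ℝ := (x - (1-τ) * log (max x θ))/τ - 2 * UU τ x - (1/τ + 1 - log τ)

lemma UU_hh {τ x : ℝ} {η : ℝ} (h : ∀ t ∈ Icc (tauM τ) (tauP τ), η ≤ |x - t|) :
    ∫ t, hh η (x - t) ∂(MPm τ) = UU τ x := by
  refine integral_congr_ae ?_
  filter_upwards [ae_mem_Icc (MPm_supp τ)] with t ht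
  rw [hh, max_eq_left (h t ht)]

lemma limI {τ : ℝ} (hτ : 0 < τ) (hτ1 : τ ≤ 1) {μ : Measure ℝ} [IsProbabilityMeasure μ]
    (hpos : μ (Iio 0) = 0) (hcs : ∃ R, μ (Icc (-R) R)ᶜ = 0)
    (hpi : ∀ p : ℝ[X], Integrable (fun x => p.eval x) μ) {z : ℕ → ℝ} (hz : IsCanonicalZ μ z) {I : ℝ}
    (hI : ∀ K, ∑ k ∈ Finset.range K, (τ⁻¹ * Gfun (z (2*k+1)) + Gfun (τ⁻¹ * z (2*k+2))) ≤ I)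
    {m : ℕ} (xs : Fin m → ℝ) (hxi : Function.Injective xs) (hxs : ∀ j, xs j ∈ ES μ (tauM τ) (tauP τ))
    {θ : ℝ} (hθ : 0 < θ) {f : ℝ → ℝ} (hf : Continuous f) :
    ∑ j, FFt τ θ (xs j) + (∫ t, f t ∂(MPm τ) - ∫ t, exp (f t) ∂μ + 1) ≤ I := by
  obtain ⟨R, x, w, hinj, hx0, hw0, hS, hMP, hμ⟩ := approx hτ hτ1 hpos hcs hpi hz hI
  have hi : ∀ j, ∃ i : (N : ℕ) → Fin (N+1), Tendsto (fun N => x N (i N)) atTop (𝓝 (xs j)) := fun j =>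
    near (fun g hg => hμ g hg.continuousOn) (hxs j).1
  choose i hil using hi
  have heta : ∀ j, ∃ η, 0 < η ∧ ∀ t ∈ Icc (tauM τ) (tauP τ), η ≤ |xs j - t| := by
    intro j
    have hnm := (hxs j).2
    obtain ⟨ε, hε, hb⟩ := Metric.isOpen_iff.1 (isClosed_Icc (a := tauM τ) (b := tauP τ)).isOpen_compl _ hnm
    refine ⟨ε, hε, fun t ht => ?_⟩
    by_contra hlt
    refine hb (?_ : t ∈ _) ht
    rw [Metric.mem_ball, dist_comm, Real.dist_eq]; exact not_le.1 hlt
  choose η hη hηle using heta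
  let Y : (N : ℕ) → Fin (m+(N+1)) → ℝ := fun N => x (m+N)
  let W : (N : ℕ) → Fin (m+(N+1)) → ℝ := fun N => w (m+N)
  let ι : (N : ℕ) → Fin m → Fin (m+(N+1)) := fun N j => i j (m+N)
  let n : ℕ → ℝ := fun N => ((m+(N+1):ℕ):ℝ)
  have hn0 : ∀ N, 0 < n N := fun N => Nat.cast_pos.2 (by omega)
  have hsh : Tendsto (fun N => m + N) atTop atTop := tendsto_atTop_mono (fun N => Nat.le_add_left N m) tendsto_id
  have hy : ∀ j, Tendsto (fun N => Y N (ι N j)) atTop (𝓝 (xs j)) := fun j => (hil j).comp hsh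
  have hnt : Tendsto (fun N => 1 / n N) atTop (𝓝 0) :=
    tendsto_one_div_atTop_nhds_zero_nat.comp (tendsto_atTop_mono (fun N => (by omega : N ≤ m + (N+1))) tendsto_id)
  have hMP' : ∀ g : ℝ → ℝ, Continuous g → Tendsto (fun N => ∑ k, 1 / n N * g (Y N k)) atTop (𝓝 (∫ t, g t ∂(MPm τ))) :=
    fun g hg => (hMP g hg.continuousOn).comp hsh
  have hμ' : ∀ g : ℝ → ℝ, Continuous g → Tendsto (fun N => ∑ k, W N k * g (Y N k)) atTop (𝓝 (∫ t, g t ∂μ)) :=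
    fun g hg => (hμ g hg.continuousOn).comp hsh
  have hιi : ∀ᶠ N in atTop, Function.Injective (ι N) := by
    have h1 : ∀ j k, ∀ᶠ N in atTop, j ≠ k → ι N j ≠ ι N k := by
      intro j k
      by_cases hjk : j = k
      · exact Eventually.of_forall fun N h => absurd hjk h
      have h2 := ((hy j).sub (hy k)).eventually_ne (sub_ne_zero.2 fun h => hjk (hxi h))
      filter_upwards [h2] with N hN _ he
      exact hN (by rw [he, sub_self])
    have h3 := eventually_all.2 fun j => eventually_all.2 (h1 j)
    filter_upwards [h3] with N hN j k he
    by_contra hjk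
    exact hN j k hjk he
  let T : ℕ → ℝ := fun N =>
    - ((cst (BN τ m N) (BN τ m N) (m + (N+1)) - cst (BN τ m N) (BN τ m N - m) (N+1)) / ((m + (N+1) : ℕ) : ℝ))
    + ∑ j, (1/τ * Y N (ι N j) - (1/τ - 1 + 1 / n N) * log (max (Y N (ι N j)) θ)
      - 2 * (∑ k, 1 / n N * hh (η j) (xs j - Y N k) - 1 / n N * ∑ k, hh (η j) (xs j - Y N (ι N k))
        + |Y N (ι N j) - xs j| / η j)) - 1 / n N * En (fun j => Y N (ι N j))
    + (∑ k, 1 / n N * f (Y N k) - ∑ k, W N k * exp (f (Y N k)) + 1)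
  have hTI : ∀ᶠ N in atTop, T N ≤ I := by
    filter_upwards [hιi] with N hN
    have hBn : n N ≤ BN τ m N := by
      unfold BN; rw [le_div_iff₀ hτ]; nlinarith [hn0 N]
    have hcore := core (BN_pos hτ m N) hBn hθ (Y := Y N) (W := W N) (hinj (m+N)) (hx0 (m+N)) (hw0 (m+N)) hN η xs hη f
    have hSN : Sf (BN τ m N) (BN τ m N + 1 - (m+(N+1):ℕ)) (Y N) - ∑ k, log (W N k) ≤
      cst (BN τ m N) (BN τ m N) (m+(N+1)) + (m+(N+1):ℕ) * I := hS (m+N)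
    have hfin := hcore.trans hSN
    have hB : BN τ m N = n N * (1/τ) := by simp only [BN, n]; ring
    have hnn := (hn0 N).ne'
    have e1 : n N * T N = cst (BN τ m N) (BN τ m N - m) (N+1) - cst (BN τ m N) (BN τ m N) (m+(N+1)) +
      ∑ j, (BN τ m N * Y N (ι N j) - (BN τ m N+1-(m+(N+1):ℕ)) * log (max (Y N (ι N j)) θ)
      - 2 * (∑ k, hh (η j) (xs j - Y N k) - ∑ k, hh (η j) (xs j - Y N (ι N k))
        + (m+(N+1):ℕ) * (|Y N (ι N j) - xs j| / η j))) - En (fun j => Y N (ι N j))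
      + (∑ k, f (Y N k) - (m+(N+1):ℕ) * ∑ k, W N k * exp (f (Y N k)) + (m+(N+1):ℕ)) := by
      have e2 : n N * ∑ j, (1/τ * Y N (ι N j) - (1/τ - 1 + 1 / n N) * log (max (Y N (ι N j)) θ)
        - 2 * (∑ k, 1 / n N * hh (η j) (xs j - Y N k) - 1 / n N * ∑ k, hh (η j) (xs j - Y N (ι N k))
        + |Y N (ι N j) - xs j| / η j)) = ∑ j, (BN τ m N * Y N (ι N j) - (BN τ m N+1-n N) * log (max (Y N (ι N j)) θ)
      - 2 * (∑ k, hh (η j) (xs j - Y N k) - ∑ k, hh (η j) (xs j - Y N (ι N k))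
        + n N * (|Y N (ι N j) - xs j| / η j))) := by
        rw [Finset.mul_sum]
        refine Finset.sum_congr rfl fun j _ => ?_
        rw [hB, ← Finset.mul_sum]
        generalize |Y N (ι N j) - xs j| / η j = q
        field_simp
        ring
      have e3 : n N * ((cst (BN τ m N) (BN τ m N) (m + (N+1)) - cst (BN τ m N) (BN τ m N - m) (N+1)) / n N) =
        cst (BN τ m N) (BN τ m N) (m + (N+1)) - cst (BN τ m N) (BN τ m N - m) (N+1) := mul_div_cancel₀ _ hnn
      have e4 : ∀ s, n N * (1 / n N * s) = s := fun s => by field_simp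
      change n N * (- ((cst (BN τ m N) (BN τ m N) (m + (N+1)) - cst (BN τ m N) (BN τ m N - m) (N+1)) / n N) + _ - _ + _) = _
      rw [mul_add, mul_sub, mul_add, e2, mul_neg, e3, e4, ← Finset.mul_sum, mul_add, mul_sub, e4]
      change _ = _ - _ + ∑ j, (BN τ m N * Y N (ι N j) - (BN τ m N+1-n N) * log (max (Y N (ι N j)) θ)
      - 2 * (∑ k, hh (η j) (xs j - Y N k) - ∑ k, hh (η j) (xs j - Y N (ι N k))
        + n N * (|Y N (ι N j) - xs j| / η j))) - _ + (_ - n N * _ + n N)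
      ring
    have e5 : n N * T N ≤ n N * I := by
      rw [e1]
      change _ ≤ ((m+(N+1):ℕ):ℝ) * I
      linarith
    exact le_of_mul_le_mul_left e5 (hn0 N)
  have hlimT : Tendsto T atTop (𝓝 (- (m * (1/τ + 1 - log τ)) + ∑ j, (1/τ * xs j - (1/τ - 1 + 0) * log (max (xs j) θ)
      - 2 * (UU τ (xs j) - 0 * ∑ k, hh (η j) (xs j - xs k) + |xs j - xs j| / η j)) - 0 * En xs
      + (∫ t, f t ∂(MPm τ) - ∫ t, exp (f t) ∂μ + 1))) := by
    refine ((((cst_lim hτ m).neg).add (tendsto_finsetSum _ fun j _ => ?_)).sub (hnt.mul ?_)).add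
      (((hMP' f hf).sub (hμ' _ hf.rexp)).add_const 1)
    · refine (((hy j).const_mul _).sub ((hnt.const_add _).mul ?_)).sub (((Tendsto.sub ?_ (hnt.mul ?_)).add ?_).const_mul 2)
      · exact ((hy j).max tendsto_const_nhds).log (lt_max_of_lt_right hθ).ne'
      · have := hMP' (fun t => hh (η j) (xs j - t)) ((hh_cont (hη j)).comp (by fun_prop))
        rwa [UU_hh (hηle j)] at this
      · exact tendsto_finsetSum _ fun k _ => ((hh_cont (hη j)).tendsto _).comp ((hy k).const_sub _)
      · exact ((hy j).sub_const _).abs.div_const _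
    · unfold En
      refine tendsto_finsetSum _ fun j _ => tendsto_finsetSum _ fun k _ => ?_
      by_cases hjk : j = k
      · subst hjk; simp
      · exact ((hy j).sub (hy k)).abs.log (abs_ne_zero.2 (sub_ne_zero.2 fun h => hjk (hxi h)))
  have hle := le_of_tendsto hlimT hTI
  convert hle using 1
  congr 1
  have : ∑ j, (1/τ * xs j - (1/τ - 1 + 0) * log (max (xs j) θ)
      - 2 * (UU τ (xs j) - 0 * ∑ k, hh (η j) (xs j - xs k) + |xs j - xs j| / η j)) =
      ∑ j, (FFt τ θ (xs j) + (1/τ + 1 - log τ)) := by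
    refine Finset.sum_congr rfl fun j _ => ?_
    simp only [sub_self, abs_zero, zero_div, FFt]
    field_simp
    ring
  rw [this, Finset.sum_add_distrib, Finset.sum_const, Finset.card_univ, Fintype.card_fin, nsmul_eq_mul]
  ring

lemma supp_nonneg {μ : Measure ℝ} (hpos : μ (Iio 0) = 0) {x : ℝ} (hx : x ∈ suppSet μ) : 0 ≤ x := by
  by_contra h
  exact hx _ (Iio_mem_nhds (not_le.1 h)) hpos

lemma ES_pos {τ : ℝ} (hτ : 0 < τ) (hτ1 : τ ≤ 1) {μ : Measure ℝ} [IsProbabilityMeasure μ]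
    (hpos : μ (Iio 0) = 0) (hcs : ∃ R, μ (Icc (-R) R)ᶜ = 0)
    (hpi : ∀ p : ℝ[X], Integrable (fun x => p.eval x) μ) {z : ℕ → ℝ} (hz : IsCanonicalZ μ z) {I : ℝ}
    (hI : ∀ K, ∑ k ∈ Finset.range K, (τ⁻¹ * Gfun (z (2*k+1)) + Gfun (τ⁻¹ * z (2*k+2))) ≤ I)
    {x : ℝ} (hx : x ∈ ES μ (tauM τ) (tauP τ)) : 0 < x := by
  refine lt_of_le_of_ne (supp_nonneg hpos hx.1) ?_
  rintro rfl
  have hτ2 : τ < 1 := by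
    refine lt_of_le_of_ne hτ1 ?_
    rintro rfl
    exact hx.2 ⟨by simp [tauM], (tauP_pos (τ := 1)).le⟩
  have hc : 0 < (1 - τ)/τ := div_pos (by linarith) hτ
  set C := -2 * UU τ 0 - (1/τ + 1 - log τ) with hC
  have h := limI hτ hτ1 hpos hcs hpi hz hI (m := 1) (fun _ => 0) (Function.injective_of_subsingleton _)
    (fun _ => hx) (θ := exp (-((|I - C| + 1) / ((1-τ)/τ)))) (exp_pos _) (f := fun _ => 0) continuous_const
  have := MPm_prob hτ hτ1
  simp only [Finset.univ_unique, Finset.sum_singleton, FFt, max_eq_right (exp_pos _).le, log_exp, integral_zero, exp_zero,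
    integral_const, probReal_univ, smul_eq_mul, mul_one] at h
  have e : (0 - (1 - τ) * -((|I - C| + 1) / ((1 - τ) / τ))) / τ = |I - C| + 1 := by
    have : (1 - τ) ≠ 0 := by linarith
    field_simp
    ring
  rw [e] at h
  linarith [le_abs_self (I - C)]

lemma dirII {τ : ℝ} (hτ : 0 < τ) (hτ1 : τ ≤ 1) {μ : Measure ℝ} [IsProbabilityMeasure μ]
    (hpos : μ (Iio 0) = 0) (hcs : ∃ R, μ (Icc (-R) R)ᶜ = 0)
    (hpi : ∀ p : ℝ[X], Integrable (fun x => p.eval x) μ) {z : ℕ → ℝ} (hz : IsCanonicalZ μ z)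
    (hIL : IL τ z ≠ ⊤) :
    (ES μ (tauM τ) (tauP τ)).Countable ∧
      KLdiv (MPm τ) μ + ∑' x : (ES μ (tauM τ) (tauP τ)), FMP τ x ≤ IL τ z := by
  have hP := MPm_prob hτ hτ1
  set I := (IL τ z).toReal with hId
  have hI : ∀ K, ∑ k ∈ Finset.range K, (τ⁻¹ * Gfun (z (2*k+1)) + Gfun (τ⁻¹ * z (2*k+2))) ≤ I := by
    intro K
    obtain ⟨zpos, zorth⟩ := link hpi hz
    have gnn : ∀ k ∈ Finset.range K, 0 ≤ τ⁻¹ * Gfun (z (2*k+1)) + Gfun (τ⁻¹ * z (2*k+2)) := fun k _ =>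
      add_nonneg (mul_nonneg (inv_pos.2 hτ).le (Gfun_nonneg (zpos _ (by omega))))
        (Gfun_nonneg (mul_pos (inv_pos.2 hτ) (zpos _ (by omega))))
    rw [hId, ← ENNReal.ofReal_le_iff_le_toReal hIL, ENNReal.ofReal_sum_of_nonneg gnn]
    exact ENNReal.sum_le_tsum _
  have hxp : ∀ x ∈ ES μ (tauM τ) (tauP τ), 0 < x := fun x hx => ES_pos hτ hτ1 hpos hcs hpi hz hI hx
  have hF : ∀ x ∈ ES μ (tauM τ) (tauP τ), FMP τ x = ENNReal.ofReal (FF τ x) ∧ 0 < FF τ x := fun x hx =>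
    FMP_eq hτ hτ1 (hxp x hx) hx.2
  have hmain : ∀ (s : Finset (ES μ (tauM τ) (tauP τ))) (f : ℝ → ℝ), Continuous f →
      ∑ x ∈ s, FF τ x + (∫ t, f t ∂(MPm τ) - ∫ t, exp (f t) ∂μ + 1) ≤ I := by
    intro s f hf
    let e := s.equivFin.symm
    obtain ⟨θ, hθ0, hθ⟩ : ∃ θ > 0, ∀ x ∈ s, θ ≤ (x : ℝ) := by
      rcases s.eq_empty_or_nonempty with h | h
      · exact ⟨1, one_pos, by simp [h]⟩
      · obtain ⟨y, _, hy'⟩ := s.exists_min_image (fun x => (x : ℝ)) h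
        exact ⟨y, hxp y y.2, hy'⟩
    have h := limI hτ hτ1 hpos hcs hpi hz hI (m := s.card) (fun j => ((e j : ES μ (tauM τ) (tauP τ)) : ℝ))
      (fun a b hab => e.injective (Subtype.ext (Subtype.ext hab))) (fun j => (e j : ES μ (tauM τ) (tauP τ)).2) hθ0 hf
    have e1 : ∑ j, FFt τ θ ((e j : ES μ (tauM τ) (tauP τ)) : ℝ) = ∑ x ∈ s, FF τ x := by
      rw [← Finset.sum_coe_sort s, ← Equiv.sum_comp e]
      refine Finset.sum_congr rfl fun j _ => ?_
      rw [FFt, FF, max_eq_left (hθ _ (e j).2)]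
    rwa [e1] at h
  have hfs : ∀ s : Finset (ES μ (tauM τ) (tauP τ)), KLdiv (MPm τ) μ + ∑ x ∈ s, FMP τ x ≤ IL τ z := by
    intro s
    have h0 : ∑ x ∈ s, FF τ x ≤ I := by
      have := hmain s (fun _ => 0) continuous_const
      simpa using this
    have h1 : KLdiv (MPm τ) μ ≤ ENNReal.ofReal (I - ∑ x ∈ s, FF τ x) :=
      KLdiv_le_of_dv fun f hf _ => by linarith [hmain s f hf]
    have h2 : ∑ x ∈ s, FMP τ x = ENNReal.ofReal (∑ x ∈ s, FF τ x) := by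
      rw [ENNReal.ofReal_sum_of_nonneg (s := s) (f := fun x => FF τ (x:ℝ)) fun x _ => (hF x x.2).2.le]
      exact Finset.sum_congr rfl fun x _ => (hF x x.2).1
    have h3 : 0 ≤ ∑ x ∈ s, FF τ x := Finset.sum_nonneg fun x _ => (hF x x.2).2.le
    rw [h2]
    refine (add_le_add_left h1 _).trans ?_
    rw [← ENNReal.ofReal_add (by linarith) h3, sub_add_cancel, hId, ENNReal.ofReal_toReal hIL]
  have htot : KLdiv (MPm τ) μ + ∑' x : (ES μ (tauM τ) (tauP τ)), FMP τ x ≤ IL τ z := by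
    rw [ENNReal.tsum_eq_iSup_sum, ENNReal.add_iSup]
    exact iSup_le hfs
  refine ⟨?_, htot⟩
  have hne : ∑' x : (ES μ (tauM τ) (tauP τ)), FMP τ x ≠ ⊤ :=
    ne_top_of_le_ne_top hIL (le_add_self.trans htot)
  have hct := Summable.countable_support_ennreal hne
  have hu : Function.support (fun x : (ES μ (tauM τ) (tauP τ)) => FMP τ x) = univ := by
    ext x
    simp only [Function.mem_support, mem_univ, iff_true]
    rw [(hF x x.2).1]
    exact (ENNReal.ofReal_pos.2 (hF x x.2).2).ne'
  rw [hu] at hct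
  exact countable_coe_iff.1 (countable_univ_iff.1 hct)

/-- **Marchenko–Pastur sum rule.** -/
theorem marchenko_pastur_sum_rule (τ : ℝ) (hτ0 : 0 < τ) (hτ1 : τ ≤ 1)
    (μ : Measure ℝ) [IsProbabilityMeasure μ]
    (hpos : μ (Iio 0) = 0) (hcs : ∃ R : ℝ, μ (Icc (-R) R)ᶜ = 0)
    (hnt : InfiniteSupport μ) (z : ℕ → ℝ) (hz : IsCanonicalZ μ z) :
    (¬ InS1 μ (tauM τ) (tauP τ) → IL τ z = ⊤) ∧
    (InS1 μ (tauM τ) (tauP τ) →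
      KLdiv (MPm τ) μ + ∑' x : (ES μ (tauM τ) (tauP τ)), FMP τ (x : ℝ) = IL τ z) := by
  have hpi : ∀ p : ℝ[X], Integrable (fun x => p.eval x) μ := fun p => by
    obtain ⟨R, hR⟩ := hcs
    exact integrable_of_contOn hR p.continuous.continuousOn
  constructor
  · intro h
    by_contra hIL
    exact h (dirII hτ0 hτ1 hpos hcs hpi hz hIL).1
  · intro _
    refine le_antisymm ?_ ?_
    · by_cases hIL : IL τ z = ⊤
      · rw [hIL]; exact le_top
      · exact (dirII hτ0 hτ1 hpos hcs hpi hz hIL).2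
    · by_cases hS : ∑' x : (ES μ (tauM τ) (tauP τ)), FMP τ x = ⊤
      · rw [hS]; simp
      · unfold KLdiv
        split_ifs with hk
        · exact dirI hτ0 hτ1 hk.1 hk.2 hpi hS hz
        · simp

end SumRules
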